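/- Let X = SYT'(2n−1, 2n−3, …, 1), the set of standard shifted Young tableaux of doubled staircase shape, with C = ℤ/n²ℤ acting on X by promotion. Then (X, C, X(q)) exhibits the cyclic sieving phenomenon, where X(q) = [n²]_q! / ([n]_q^n Π_{i=1}^{n−1} ([i]_q · [2n−i]_q)^i) is the q-analogue of the hook length formula for the n×n square Young diagram. -/

import Mathlib

/-! ### Tableau machinery: fillings as functions `ℕ × ℕ → ℕ` (entry `0` = empty/absent cell) -/

/-- One jeu de taquin slide: starting from an empty box at position `c`, repeatedly swap the
empty box with the smaller of the entries directly to its right and directly below it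
(`0` denotes an empty/absent cell), until neither exists.  Returns the resulting filling
together with the final position of the empty box; `fuel` bounds the number of steps. -/
def jdtSlide : ℕ → ((ℕ × ℕ) → ℕ) → (ℕ × ℕ) → (((ℕ × ℕ) → ℕ) × (ℕ × ℕ))
  | 0, f, c => (f, c)
  | fuel+1, f, c =>
    let a := c.1
    let b := c.2
    let r := f (a, b+1)
    let d := f (a+1, b)
    if r = 0 ∧ d = 0 then (f, c)
    else if d = 0 ∨ (r ≠ 0 ∧ r < d) then
      jdtSlide fuel (Function.update (Function.update f (a, b+1) 0) (a, b) r) (a, b+1)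
    else
      jdtSlide fuel (Function.update (Function.update f (a+1, b) 0) (a, b) d) (a+1, b)

/-- Jeu de taquin promotion of a standard filling with `N` boxes: delete the entry `1`
(in the upper left corner `(0,0)`), decrease every other entry by `1`, slide the empty box
by jeu de taquin, and fill the final empty box with `N`. -/
def promote (N : ℕ) (f : (ℕ × ℕ) → ℕ) : (ℕ × ℕ) → ℕ :=
  let s := jdtSlide N (fun c => f c - 1) (0, 0)
  Function.update s.1 s.2 N

/-- The cells of the (straight-shape) Young diagram of a partition `lam`:
row `a` consists of the cells `(a, b)` with `b < lam a`. -/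
def strCell (lam : List ℕ) (c : ℕ × ℕ) : Prop := c.2 < lam.getD c.1 0

/-- The cells of the shifted Young diagram of a strict partition `lam`:
row `a` consists of the cells `(a, b)` with `a ≤ b < a + lam a`. -/
def shiftCell (lam : List ℕ) (c : ℕ × ℕ) : Prop :=
  c.1 ≤ c.2 ∧ c.2 < c.1 + lam.getD c.1 0

/-- `IsStdFilling cells N f` : `f` is a standard tableau on the cell set `cells` with
entries `1, …, N`: it vanishes off `cells`, restricts to a bijection `cells → {1, …, N}`,
and is strictly increasing along rows and columns. -/
def IsStdFilling (cells : ℕ × ℕ → Prop) (N : ℕ) (f : (ℕ × ℕ) → ℕ) : Prop :=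
  (∀ c, ¬ cells c → f c = 0) ∧
  (∀ c, cells c → 1 ≤ f c ∧ f c ≤ N) ∧
  (∀ c c', cells c → cells c' → f c = f c' → c = c') ∧
  (∀ v, 1 ≤ v → v ≤ N → ∃ c, cells c ∧ f c = v) ∧
  (∀ a b, cells (a, b) → cells (a, b+1) → f (a, b) < f (a, b+1)) ∧
  (∀ a b, cells (a, b) → cells (a+1, b) → f (a, b) < f (a+1, b))

/-- The rectangular partition with `b` rows and `n` columns. -/
def rectShape (b n : ℕ) : List ℕ := List.replicate b n

/-- The square partition with `n` rows and `n` columns. -/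
def sqShape (n : ℕ) : List ℕ := List.replicate n n

/-- The doubled staircase strict partition `(2n-1, 2n-3, …, 1)`. -/
def dblStair (n : ℕ) : List ℕ := (List.range n).map (fun i => 2*n - 1 - 2*i)

/-- The index of the row containing the entry `v` of a filling
(rows numbered `0, 1, 2, …` from the top). -/
noncomputable def rowOf (f : (ℕ × ℕ) → ℕ) (v : ℕ) : ℕ := sInf {a | ∃ b, f (a, b) = v}

/-! ### `q`-analogues, as polynomials with integer coefficients -/

open Polynomial in
/-- The `q`-integer `[m]_q = 1 + q + ⋯ + q^(m-1)`, as a polynomial in `ℤ[q]`. -/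
noncomputable def qInt (m : ℕ) : Polynomial ℤ := ∑ k ∈ Finset.range m, Polynomial.X ^ k

/-- The `q`-factorial `[N]_q! = [N]_q [N-1]_q ⋯ [1]_q`. -/
noncomputable def qFact (N : ℕ) : Polynomial ℤ := ∏ m ∈ Finset.range N, qInt (m + 1)

open Polynomial in
/-- The `q`-analogue of the hook length formula for the `n × n` square Young diagram,
`[n²]_q! / ([n]_q^n · ∏_(i=1)^(n-1) ([i]_q [2n-i]_q)^i)`.
(The division is exact; it is expressed by `Polynomial.divByMonic`, the divisor being
a monic polynomial.) -/
noncomputable def qHookSquare (n : ℕ) : Polynomial ℤ :=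
  qFact (n ^ 2) /ₘ ((qInt n) ^ n * ∏ i ∈ Finset.Icc 1 (n - 1), (qInt i * qInt (2 * n - i)) ^ i)


/-! ## Hop words -/

/-- A letter `x` is valid at the state `s`. -/
def Hvalid (s : Set ℤ) (x : ℤ) : Prop := x ∈ s ∧ x + 1 ∉ s

/-- Hop of a particle from `x` to `x+1`; if `b` then `0` is a reservoir. -/
def hop (b : Bool) (s : Set ℤ) (x : ℤ) : Set ℤ :=
  {y | y = x + 1 ∨ (y ∈ s ∧ (y ≠ x ∨ (b = true ∧ x = 0)))}

/-- Final state of a word. -/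
def hopW (b : Bool) : Set ℤ → List ℤ → Set ℤ
  | s, [] => s
  | s, x :: w => hopW b (hop b s x) w

/-- Validity of a word from a state. -/
def WValid (b : Bool) : Set ℤ → List ℤ → Prop
  | _, [] => True
  | s, x :: w => Hvalid s x ∧ WValid b (hop b s x) w

/-- `w` is a hop path from `s` to `t`. -/
def HPath (b : Bool) (s : Set ℤ) (w : List ℤ) (t : Set ℤ) : Prop :=
  WValid b s w ∧ hopW b s w = t

/-- two letters are far apart -/
def Far (x y : ℤ) : Prop := x + 2 ≤ y ∨ y + 2 ≤ x

instance (x y : ℤ) : Decidable (Far x y) := by unfold Far; infer_instance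

lemma Far.symm {x y : ℤ} (h : Far x y) : Far y x := by unfold Far at *; omega

lemma far_comm (x y : ℤ) : Far x y ↔ Far y x := by unfold Far; omega

/-- Slide the letter `x` through the word. -/
def thru : ℤ → List ℤ → List ℤ × ℤ
  | x, [] => ([], x)
  | x, y :: l => if Far x y then (y :: (thru x l).1, (thru x l).2)
      else (x :: (thru y l).1, (thru y l).2)

/-- promotion of words -/
def wprom : List ℤ → List ℤ
  | [] => []
  | x :: l => (thru x l).1 ++ [(thru x l).2]

lemma mem_hop {b : Bool} {s : Set ℤ} {x y : ℤ} :
    y ∈ hop b s x ↔ (y = x + 1 ∨ (y ∈ s ∧ (y ≠ x ∨ (b = true ∧ x = 0)))) := Iff.rfl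

lemma hopW_append (b : Bool) (s : Set ℤ) (u v : List ℤ) :
    hopW b s (u ++ v) = hopW b (hopW b s u) v := by
  induction u generalizing s with
  | nil => rfl
  | cons x u ih => simp [hopW, ih]

lemma WValid_append (b : Bool) (s : Set ℤ) (u v : List ℤ) :
    WValid b s (u ++ v) ↔ WValid b s u ∧ WValid b (hopW b s u) v := by
  induction u generalizing s with
  | nil => simp [WValid, hopW]
  | cons x u ih => simp [hopW, WValid, ih, and_assoc]

lemma HPath_nil {b : Bool} {s t : Set ℤ} : HPath b s [] t ↔ s = t := by
  simp [HPath, WValid, hopW]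

lemma HPath_cons {b : Bool} {s t : Set ℤ} {x : ℤ} {w : List ℤ} :
    HPath b s (x :: w) t ↔ Hvalid s x ∧ HPath b (hop b s x) w t := by
  simp [HPath, WValid, hopW, and_assoc]

lemma HPath_append {b : Bool} {s t : Set ℤ} {u v : List ℤ} :
    HPath b s (u ++ v) t ↔ HPath b s u (hopW b s u) ∧ HPath b (hopW b s u) v t := by
  simp [HPath, WValid_append, hopW_append, and_assoc]

lemma HPath_append' {b : Bool} {s t : Set ℤ} {u v : List ℤ} :
    HPath b s (u ++ v) t ↔ ∃ r, HPath b s u r ∧ HPath b r v t := by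
  rw [HPath_append]
  constructor
  · rintro h; exact ⟨_, h⟩
  · rintro ⟨r, ⟨h1, rfl⟩, h2⟩; exact ⟨⟨h1, rfl⟩, h2⟩

lemma hop_comm (b : Bool) (s : Set ℤ) {x y : ℤ} (h : Far x y) :
    hop b (hop b s x) y = hop b (hop b s y) x := by
  unfold Far at h
  ext z
  simp only [mem_hop]
  grind

lemma Hvalid_comm {b : Bool} {s : Set ℤ} {x y : ℤ} (h : Far x y) :
    Hvalid (hop b s x) y ↔ Hvalid s y := by
  unfold Far at h
  simp only [Hvalid, mem_hop]
  grind

lemma Hvalid_ne {b : Bool} {s : Set ℤ} {x y : ℤ} 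
    (h : Hvalid (hop b s x) y) : x ≠ y := by
  rintro rfl
  simp only [Hvalid, mem_hop] at h
  grind

lemma thru_append (x : ℤ) (A B : List ℤ) :
    thru x (A ++ B) = ((thru x A).1 ++ (thru (thru x A).2 B).1, (thru (thru x A).2 B).2) := by
  induction A generalizing x with
  | nil => simp [thru]
  | cons a A ih =>
    simp only [List.cons_append, thru]
    split_ifs <;> simp [ih]

lemma thru_length (x : ℤ) (A : List ℤ) : (thru x A).1.length = A.length := by
  induction A generalizing x with
  | nil => rfl
  | cons a A ih => simp only [thru]; split_ifs <;> simp [ih]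

lemma wprom_length (w : List ℤ) : (wprom w).length = w.length := by
  cases w <;> simp [wprom, thru_length]

lemma thru_path_iff {b : Bool} {s t : Set ℤ} {x : ℤ} {T : List ℤ} :
    HPath b s ((thru x T).1 ++ [(thru x T).2]) t ↔ HPath b s (x :: T) t := by
  induction T generalizing x s with
  | nil => simp [thru]
  | cons y T ih =>
    simp only [thru]
    rw [HPath_cons, HPath_cons]
    split_ifs with hf
    · rw [List.cons_append, HPath_cons, ih, HPath_cons, Hvalid_comm hf, Hvalid_comm hf.symm,
        hop_comm b s hf]
      tauto
    · rw [List.cons_append, HPath_cons, ih, HPath_cons]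

lemma thru_path {b : Bool} {s t : Set ℤ} {x : ℤ} {T : List ℤ} (h : HPath b s (x :: T) t) :
    HPath b s ((thru x T).1 ++ [(thru x T).2]) t := thru_path_iff.2 h

lemma wprom_path {b : Bool} {s t : Set ℤ} {w : List ℤ} (h : HPath b s w t) :
    HPath b s (wprom w) t := by
  cases w with
  | nil => exact h
  | cons x l => exact thru_path h

/-- reversed slide -/
lemma thru_reverse (x : ℤ) (T : List ℤ) :
    thru (thru x T).2 (thru x T).1.reverse = (T.reverse, x) := by
  induction T generalizing x with
  | nil => rfl
  | cons y T ih =>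
    simp only [thru]
    split_ifs with hf
    · simp only [List.reverse_cons, thru_append, ih]
      simp [thru, hf]
    · simp only [List.reverse_cons, thru_append, ih]
      have : ¬ Far y x := fun h => hf h.symm
      simp [thru, this]

lemma thru_inj {x x' : ℤ} {T T' : List ℤ} (h : thru x T = thru x' T') : x = x' ∧ T = T' := by
  have h1 := thru_reverse x T
  have h2 := thru_reverse x' T'
  rw [h, h2] at h1
  simp only [Prod.mk.injEq, List.reverse_inj] at h1
  exact ⟨h1.2.symm, h1.1.symm⟩

lemma wprom_inj {w w' : List ℤ} (h : wprom w = wprom w') : w = w' := by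
  have hl : w.length = w'.length := by rw [← wprom_length, h, wprom_length]
  cases w with
  | nil => cases w' with
    | nil => rfl
    | cons => simp at hl
  | cons x l => cases w' with
    | nil => simp at hl
    | cons x' l' =>
      simp only [wprom] at h
      have := List.append_inj' h rfl
      have h3 : thru x l = thru x' l' := by
        apply Prod.ext
        · exact this.1
        · simpa using this.2
      obtain ⟨rfl, rfl⟩ := thru_inj h3
      rfl

lemma thru_surj (T' : List ℤ) (x' : ℤ) : ∃ x T, thru x T = (T', x') := by
  have := thru_reverse x' T'.reverse
  rw [List.reverse_reverse] at this
  exact ⟨_, _, this⟩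

/-- Switching of two words. -/
def sw : List ℤ → List ℤ → List ℤ × List ℤ
  | [], T => (T, [])
  | s :: S, T => ((thru s (sw S T).1).1, (thru s (sw S T).1).2 :: (sw S T).2)

lemma sw_append_left (S₁ S₂ T : List ℤ) :
    sw (S₁ ++ S₂) T = ((sw S₁ (sw S₂ T).1).1, (sw S₁ (sw S₂ T).1).2 ++ (sw S₂ T).2) := by
  induction S₁ with
  | nil => simp [sw]
  | cons s S₁ ih => simp [sw, ih]

lemma sw_append_right (S T₁ T₂ : List ℤ) :
    sw S (T₁ ++ T₂) = ((sw S T₁).1 ++ (sw (sw S T₁).2 T₂).1, (sw (sw S T₁).2 T₂).2) := by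
  induction S with
  | nil => simp [sw]
  | cons s S ih => simp [sw, ih, thru_append]

lemma sw_nil (S : List ℤ) : sw S [] = ([], S) := by
  induction S with
  | nil => simp [sw]
  | cons s S ih => simp [sw, ih, thru]

lemma sw_length (S T : List ℤ) :
    (sw S T).1.length = T.length ∧ (sw S T).2.length = S.length := by
  induction S with
  | nil => simp [sw]
  | cons s S ih => simp [sw, ih, thru_length]

lemma sw_single_left (s : ℤ) (T : List ℤ) : sw [s] T = ((thru s T).1, [(thru s T).2]) := by
  simp [sw]

lemma sw_path_iff {b : Bool} {s t : Set ℤ} {S T : List ℤ} :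
    HPath b s ((sw S T).1 ++ (sw S T).2) t ↔ HPath b s (S ++ T) t := by
  induction S generalizing s with
  | nil => simp [sw]
  | cons x S ih =>
    simp only [sw, List.cons_append]
    rw [HPath_cons, ← ih]
    rw [← HPath_cons, ← List.cons_append, List.append_cons, HPath_append', HPath_append']
    simp only [thru_path_iff]

lemma sw_inj {S S' T T' : List ℤ} (hl : S.length = S'.length) (h : sw S T = sw S' T') :
    S = S' ∧ T = T' := by
  induction S generalizing S' with
  | nil => cases S' with
    | nil => simpa [sw] using h
    | cons => simp at hl
  | cons x S ih => cases S' with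
    | nil => simp at hl
    | cons x' S' =>
      simp only [sw, Prod.mk.injEq, List.cons.injEq] at h
      obtain ⟨h1, h2, h3⟩ := h
      obtain ⟨rfl, h4⟩ := thru_inj (Prod.ext h1 h2)
      obtain ⟨rfl, rfl⟩ := ih (by simpa using hl) (Prod.ext h4 h3)
      exact ⟨rfl, rfl⟩

lemma sw_cross (x y : ℤ) : sw (sw [x] [y]).1 (sw [x] [y]).2 = ([x], [y]) := by
  simp only [sw, thru]
  by_cases h : Far x y
  · simp [h, h.symm, thru, sw]
  · simp [h, thru, sw]

lemma sw_invol_single (x : ℤ) (T : List ℤ) : sw (sw [x] T).1 (sw [x] T).2 = ([x], T) := by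
  induction T generalizing x with
  | nil => simp [sw, thru]
  | cons y T ih =>
    have hc := sw_cross x y
    have e : sw [x] (y :: T) = sw [x] ([y] ++ T) := rfl
    rw [e, sw_append_right]
    obtain ⟨a, ha⟩ : ∃ a, (sw [x] [y]).1 = [a] := List.length_eq_one_iff.1 (sw_length _ _).1
    obtain ⟨c, hc'⟩ : ∃ a, (sw [x] [y]).2 = [a] := List.length_eq_one_iff.1 (sw_length _ _).2
    rw [hc'] at hc ⊢
    rw [sw_append_left]
    simp only [ih, hc]
    simp

lemma sw_invol (S T : List ℤ) : sw (sw S T).1 (sw S T).2 = (S, T) := by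
  induction S with
  | nil => simp [sw, sw_nil]
  | cons x S ih =>
    have e : sw (x :: S) T = sw ([x] ++ S) T := rfl
    rw [e, sw_append_left, sw_append_right]
    simp only [sw_invol_single]
    rw [ih]
    simp

/-- elementary dual equivalence of triples -/
def R3 (p q r p' q' r' : ℤ) : Prop :=
  (p' = p ∧ q' = r ∧ r' = q ∧ ((q < p ∧ p < r) ∨ (r < p ∧ p < q))) ∨
  (p' = q ∧ q' = p ∧ r' = r ∧ ((p < r ∧ r < q) ∨ (q < r ∧ r < p)))

lemma valid3 {s : Set ℤ} {p q r : ℤ} (h : WValid false s [p, q, r]) :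
    p ≠ q ∧ q ≠ r ∧ p ≠ r := by
  simp only [WValid, Hvalid, mem_hop] at h
  grind

lemma valid4 {s : Set ℤ} {p q r y : ℤ} (h : WValid false s [p, q, r, y]) :
    p ≠ q ∧ q ≠ r ∧ p ≠ r ∧ r ≠ y ∧ q ≠ y ∧
      (y = p → (q = p + 1 ∧ r = p - 1) ∨ (q = p - 1 ∧ r = p + 1)) := by
  have h1 := valid3 (s := s) (p := p) (q := q) (r := r) (by simp only [WValid] at h ⊢; tauto)
  have h2 := valid3 (s := hop false s p) (p := q) (q := r) (r := y)
    (by simp only [WValid] at h ⊢; tauto)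
  refine ⟨h1.1, h1.2.1, h1.2.2, h2.2.1, h2.2.2, ?_⟩
  rintro rfl
  simp only [WValid, Hvalid, mem_hop] at h
  grind

/-- crossing rule: emitted letter -/
def cr1 (x y : ℤ) : ℤ := if Far x y then y else x
/-- crossing rule: carried letter -/
def cr2 (x y : ℤ) : ℤ := if Far x y then x else y

lemma thru_cons (x y : ℤ) (l : List ℤ) :
    thru x (y :: l) = (cr1 x y :: (thru (cr2 x y) l).1, (thru (cr2 x y) l).2) := by
  simp only [thru, cr1, cr2]; split_ifs <;> rfl

lemma cr_spec (x y : ℤ) : ((x + 2 ≤ y ∨ y + 2 ≤ x) ∧ cr1 x y = y ∧ cr2 x y = x) ∨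
    (¬ (x + 2 ≤ y ∨ y + 2 ≤ x) ∧ cr1 x y = x ∧ cr2 x y = y) := by
  by_cases h : Far x y
  · exact Or.inl ⟨h, by simp [cr1, h], by simp [cr2, h]⟩
  · exact Or.inr ⟨h, by simp [cr1, h], by simp [cr2, h]⟩

set_option maxHeartbeats 4000000 in
lemma R3_slide {s : Set ℤ} {p q r y p' q' r' : ℤ} (h : WValid false s [p, q, r, y])
    (hR : R3 p q r p' q' r') :
    cr1 p (cr1 q (cr1 r y)) = cr1 p' (cr1 q' (cr1 r' y)) ∧
    R3 (cr2 p (cr1 q (cr1 r y))) (cr2 q (cr1 r y)) (cr2 r y)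
      (cr2 p' (cr1 q' (cr1 r' y))) (cr2 q' (cr1 r' y)) (cr2 r' y) := by
  obtain ⟨h1, h2, h3, h4, h5, h6⟩ := valid4 h
  have s1 := cr_spec r y
  have s2 := cr_spec q (cr1 r y)
  have s3 := cr_spec p (cr1 q (cr1 r y))
  have s4 := cr_spec r' y
  have s5 := cr_spec q' (cr1 r' y)
  have s6 := cr_spec p' (cr1 q' (cr1 r' y))
  generalize cr2 p (cr1 q (cr1 r y)) = b3 at *
  generalize cr1 p (cr1 q (cr1 r y)) = a3 at *
  generalize cr2 q (cr1 r y) = b2 at *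
  generalize cr1 q (cr1 r y) = a2 at *
  generalize cr2 r y = b1 at *
  generalize cr1 r y = a1 at *
  generalize cr2 p' (cr1 q' (cr1 r' y)) = b3' at *
  generalize cr1 p' (cr1 q' (cr1 r' y)) = a3' at *
  generalize cr2 q' (cr1 r' y) = b2' at *
  generalize cr1 q' (cr1 r' y) = a2' at *
  generalize cr2 r' y = b1' at *
  generalize cr1 r' y = a1' at *
  clear h
  rcases hR with ⟨rfl, rfl, rfl, hR | hR⟩ | ⟨rfl, rfl, rfl, hR | hR⟩ <;>
  · unfold R3
    rcases s1 with ⟨c1, rfl, rfl⟩ | ⟨c1, rfl, rfl⟩ <;>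
    rcases s2 with ⟨c2, rfl, rfl⟩ | ⟨c2, rfl, rfl⟩ <;>
    (try (exfalso; omega)) <;>
    rcases s3 with ⟨c3, rfl, rfl⟩ | ⟨c3, rfl, rfl⟩ <;>
    (try (exfalso; omega)) <;>
    rcases s4 with ⟨c4, rfl, rfl⟩ | ⟨c4, rfl, rfl⟩ <;>
    (try (exfalso; omega)) <;>
    rcases s5 with ⟨c5, rfl, rfl⟩ | ⟨c5, rfl, rfl⟩ <;>
    (try (exfalso; omega)) <;>
    rcases s6 with ⟨c6, rfl, rfl⟩ | ⟨c6, rfl, rfl⟩ <;>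
    omega

lemma sw3_cons (p q r y : ℤ) (T : List ℤ) :
    (sw [p, q, r] (y :: T)).1 = cr1 p (cr1 q (cr1 r y)) ::
      (sw [cr2 p (cr1 q (cr1 r y)), cr2 q (cr1 r y), cr2 r y] T).1 := by
  simp [sw, thru_cons]

lemma R3_sw {T : List ℤ} {s : Set ℤ} {p q r p' q' r' : ℤ}
    (h : WValid false s (p :: q :: r :: T)) (hR : R3 p q r p' q' r') :
    (sw [p, q, r] T).1 = (sw [p', q', r'] T).1 := by
  induction T generalizing s p q r p' q' r' with
  | nil => simp [sw_nil]
  | cons y T ih =>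
    have h4 : WValid false s [p, q, r, y] := by simp only [WValid] at h ⊢; tauto
    obtain ⟨e1, e2⟩ := R3_slide h4 hR
    rw [sw3_cons, sw3_cons, e1]
    congr 1
    refine ih (s := hop false s (cr1 p (cr1 q (cr1 r y)))) ?_ e2
    have hp : HPath false s ([p, q, r, y] ++ T) (hopW false s ([p, q, r, y] ++ T)) := ⟨h, rfl⟩
    have : HPath false s ((sw [p, q, r] ([y] ++ T)).1 ++ (sw [p, q, r] ([y] ++ T)).2)
      (hopW false s ([p, q, r, y] ++ T)) := sw_path_iff.2 hp
    have hp2 : HPath false s (([p, q, r] ++ [y]) ++ T) (hopW false s ([p, q, r, y] ++ T)) := hp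
    rw [HPath_append'] at hp2
    obtain ⟨u, hu1, hu2⟩ := hp2
    have hu3 := sw_path_iff.2 hu1
    have hu4 := (HPath_append'.2 ⟨u, hu3, hu2⟩).1
    have hu5 : WValid false s (cr1 p (cr1 q (cr1 r y)) ::
        [cr2 p (cr1 q (cr1 r y)), cr2 q (cr1 r y), cr2 r y] ++ T) := by
      simpa [sw, thru_cons, thru] using hu4
    exact hu5.2

lemma hop_mem_iff {s : Set ℤ} {x y : ℤ} (h : Hvalid s x) :
    y ∈ s ↔ (y = x ∨ (y ∈ hop false s x ∧ y ≠ x + 1)) := by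
  simp only [Hvalid, mem_hop] at *
  grind

lemma hop_inj {s t : Set ℤ} {x : ℤ} (h : Hvalid s x) (h' : Hvalid t x)
    (e : hop false s x = hop false t x) : s = t := by
  ext y
  rw [hop_mem_iff h, hop_mem_iff h', e]

/-- inverse hop -/
def unhop (t : Set ℤ) (y : ℤ) : Set ℤ := {z | z = y ∨ (z ∈ t ∧ z ≠ y + 1)}

lemma mem_unhop {t : Set ℤ} {y z : ℤ} : z ∈ unhop t y ↔ z = y ∨ (z ∈ t ∧ z ≠ y + 1) := Iff.rfl

lemma hop_unhop {t : Set ℤ} {y : ℤ} (h1 : y + 1 ∈ t) (h2 : y ∉ t) :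
    hop false (unhop t y) y = t := by
  ext z; simp only [mem_hop, mem_unhop]; grind

lemma Hvalid_unhop {t : Set ℤ} {y : ℤ} : Hvalid (unhop t y) y := by
  simp only [Hvalid, mem_unhop]; grind

lemma unhop_hop {s : Set ℤ} {y : ℤ} (h : Hvalid s y) : unhop (hop false s y) y = s := by
  ext z; simp only [Hvalid, mem_hop, mem_unhop] at *; grind

lemma HPath_snoc {b : Bool} {s t : Set ℤ} {w : List ℤ} {x : ℤ} :
    HPath b s (w ++ [x]) t ↔ ∃ r, HPath b s w r ∧ Hvalid r x ∧ hop b r x = t := by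
  rw [HPath_append']
  simp [HPath_cons, HPath_nil]

/-- Any removable letter can be made the last one. -/
lemma exists_path_unhop {w : List ℤ} {t : Set ℤ} {y : ℤ}
    (h : HPath false (Set.Iic 0) w t) (h1 : y + 1 ∈ t) (h2 : y ∉ t) :
    ∃ w', HPath false (Set.Iic 0) w' (unhop t y) ∧ w'.length + 1 = w.length := by
  induction w using List.reverseRecOn generalizing t with
  | nil =>
    rw [HPath_nil] at h
    subst h
    simp only [Set.mem_Iic] at h1 h2
    omega
  | append_singleton w z ih =>
    rw [HPath_snoc] at h
    obtain ⟨r, hr, hv, rfl⟩ := h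
    by_cases hzy : z = y
    · subst hzy
      exact ⟨w, by rwa [unhop_hop hv], by simp⟩
    · have hf : y + 1 ∈ r ∧ y ∉ r ∧ Far z y := by
        simp only [Hvalid, mem_hop, Far] at *
        grind
      obtain ⟨w', hw', hl⟩ := ih hr hf.1 hf.2.1
      refine ⟨w' ++ [z], HPath_snoc.2 ⟨_, hw', ?_, ?_⟩, by simp [hl]⟩
      · have := hf.2.2
        simp only [Hvalid, mem_unhop, Far] at *
        grind
      · have := hf.2.2
        ext u
        simp only [Hvalid, mem_hop, mem_unhop, Far] at *
        grind

lemma exists_betw {s : Set ℤ} {x y : ℤ} (hxy : x < y) (hx : x + 1 ∉ s) (hy : y ∈ s) :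
    ∃ z, x < z ∧ z < y ∧ z ∉ s ∧ z + 1 ∈ s := by
  by_contra hcon
  push Not at hcon
  have : ∀ k : ℕ, x + 1 + k ≤ y → x + 1 + k ∉ s := by
    intro k
    induction k with
    | zero => intro _; simpa using hx
    | succ k ih =>
      intro hk
      have := hcon (x + 1 + k) (by omega) (by push_cast at hk; omega)
        (ih (by push_cast at hk; omega))
      push_cast
      rwa [← add_assoc]
  have := this (y - x - 1).toNat (by omega)
  rw [show x + 1 + ((y - x - 1).toNat : ℤ) = y by omega] at this
  exact this hy

/-- Confluence in type A. -/
theorem confluence_A (m : ℕ) : ∀ (S S₂ T : List ℤ) (t : Set ℤ), S.length = m → S₂.length = m →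
    HPath false (Set.Iic 0) S t → HPath false (Set.Iic 0) S₂ t → WValid false t T →
    (sw S T).1 = (sw S₂ T).1 := by
  induction m using Nat.strong_induction_on with
  | _ m IH =>
  -- the swap of two last letters
  have swp : ∀ (u T : List ℤ) (t : Set ℤ) (x y : ℤ), u.length + 2 = m → x < y →
      HPath false (Set.Iic 0) u t → Hvalid t x → Hvalid t y → Far x y →
      WValid false t (x :: y :: T) →
      (sw (u ++ [x, y]) T).1 = (sw (u ++ [y, x]) T).1 := by
    intro u T t x y hm hxy hu hx hy hf hT
    obtain ⟨z, hz1, hz2, hz3, hz4⟩ := exists_betw hxy hx.2 hy.1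
    obtain ⟨w, hw, hl⟩ := exists_path_unhop hu hz4 hz3
    have hw2 : HPath false (Set.Iic 0) (w ++ [z]) t :=
      HPath_snoc.2 ⟨_, hw, Hvalid_unhop, hop_unhop hz4 hz3⟩
    have hT' : WValid false t (y :: x :: T) := by
      simp only [WValid] at hT ⊢
      rw [Hvalid_comm hf.symm, hop_comm _ _ hf.symm]
      exact ⟨hy, hx, hT.2.2⟩
    have key : ∀ a b : ℤ, WValid false t (a :: b :: T) →
        (sw (u ++ [a, b]) T).1 = (sw w (sw [z, a, b] T).1).1 := by
      intro a b hab
      rw [sw_append_left]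
      dsimp only
      rw [IH (m - 2) (by omega) u (w ++ [z]) _ t (by omega) (by simp; omega) hu hw2]
      · rw [sw_append_left]
        rfl
      · have h1 : HPath false t ([a, b] ++ T) (hopW false t ([a, b] ++ T)) := ⟨hab, rfl⟩
        have h2 := sw_path_iff.2 h1
        rw [HPath_append] at h2
        exact h2.1.1
    rw [key x y hT, key y x hT']
    congr 2
    refine R3_sw (s := unhop t z) ?_ (Or.inl ⟨rfl, rfl, rfl, Or.inl ⟨hz1, hz2⟩⟩)
    show Hvalid _ _ ∧ WValid false (hop false (unhop t z) z) (x :: y :: T)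
    rw [hop_unhop hz4 hz3]
    exact ⟨Hvalid_unhop, hT⟩
  intro S S₂ T t hS hS₂ pS pS₂ hT
  rcases List.eq_nil_or_concat' S with rfl | ⟨S₁, x, rfl⟩
  · have : S₂ = [] := by
      apply List.length_eq_zero_iff.1; rw [hS₂, ← hS]; rfl
    rw [this]
  rcases List.eq_nil_or_concat' S₂ with rfl | ⟨S₃, y, rfl⟩
  · simp at hS hS₂; omega
  simp only [List.length_append, List.length_singleton] at hS hS₂
  -- reduction on sliding a last letter
  have slide : ∀ (A B : List ℤ) (r : Set ℤ) (a : ℤ), A.length + 1 = m → B.length + 1 = m →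
      HPath false (Set.Iic 0) A r → HPath false (Set.Iic 0) B r → Hvalid r a →
      hop false r a = t → (sw (A ++ [a]) T).1 = (sw (B ++ [a]) T).1 := by
    intro A B r a hA hB pA pB hv he
    rw [sw_append_left, sw_append_left]
    dsimp only
    refine IH (m - 1) (by omega) _ _ _ r (by omega) (by omega) pA pB ?_
    have h1 : HPath false r ([a] ++ T) (hopW false r ([a] ++ T)) := by
      refine ⟨⟨hv, ?_⟩, rfl⟩
      rw [he]; exact hT
    have h2 := sw_path_iff.2 h1
    rw [HPath_append] at h2
    exact h2.1.1
  rw [HPath_snoc] at pS pS₂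
  obtain ⟨r, pr, vr, hr⟩ := pS
  obtain ⟨r₂, pr₂, vr₂, hr₂⟩ := pS₂
  by_cases hxy : x = y
  · subst hxy
    have : r = r₂ := hop_inj vr vr₂ (hr.trans hr₂.symm)
    subst this
    exact slide _ _ r x hS hS₂ pr pr₂ vr hr
  · have memr : ∀ z, z ∈ r ↔ (z = x ∨ (z ∈ t ∧ z ≠ x + 1)) := fun z => by
      rw [← hr]; exact hop_mem_iff vr
    have memr₂ : ∀ z, z ∈ r₂ ↔ (z = y ∨ (z ∈ t ∧ z ≠ y + 1)) := fun z => by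
      rw [← hr₂]; exact hop_mem_iff vr₂
    have hx1 : x + 1 ∈ t ∧ x ∉ t := by
      rw [← hr]; simp only [mem_hop]; grind
    have hy1 : y + 1 ∈ t ∧ y ∉ t := by
      rw [← hr₂]; simp only [mem_hop]; grind
    have hf : Far x y := by
      unfold Far; grind
    have hyr : y + 1 ∈ r ∧ y ∉ r := by
      rw [memr, memr]; unfold Far at hf; grind
    obtain ⟨u, hu, hul⟩ := exists_path_unhop pr hyr.1 hyr.2
    have hu1 : HPath false (Set.Iic 0) (u ++ [y]) r :=
      HPath_snoc.2 ⟨_, hu, Hvalid_unhop, hop_unhop hyr.1 hyr.2⟩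
    set t' := unhop r y with ht'
    have vx : Hvalid t' x := by
      simp only [Hvalid, ht', mem_unhop, memr]; unfold Far at hf; grind
    have vy : Hvalid t' y := Hvalid_unhop
    have ey : hop false t' y = r := hop_unhop hyr.1 hyr.2
    have exx : hop false t' x = r₂ := by
      ext z
      simp only [ht', mem_hop, mem_unhop, memr, memr₂]; unfold Far at hf; grind
    have hu2 : HPath false (Set.Iic 0) (u ++ [x]) r₂ := HPath_snoc.2 ⟨_, hu, vx, exx⟩
    rw [slide S₁ (u ++ [y]) r x hS (by simp; omega) pr hu1 vr hr,
      slide S₃ (u ++ [x]) r₂ y hS₂ (by simp; omega) pr₂ hu2 vr₂ hr₂]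
    have hvT1 : WValid false t' (x :: y :: T) := by
      refine ⟨vx, ?_, ?_⟩
      · rw [exx]; exact vr₂
      · rw [exx, hr₂]; exact hT
    have hvT2 : WValid false t' (y :: x :: T) := by
      refine ⟨vy, ?_, ?_⟩
      · rw [ey]; exact vr
      · rw [ey, hr]; exact hT
    simp only [List.append_assoc, List.cons_append, List.nil_append]
    rcases lt_or_gt_of_ne hxy with h | h
    · exact (swp u T t' x y (by omega) h hu vx vy hf hvT1).symm
    · exact swp u T t' y x (by omega) h hu vy vx hf.symm hvT2

/-- doubling of shifted words -/
def dW : List ℤ → List ℤ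
  | [] => []
  | c :: w => -c :: (c + 1) :: dW w

lemma dW_append (u v : List ℤ) : dW (u ++ v) = dW u ++ dW v := by
  induction u with
  | nil => rfl
  | cons c u ih => simp [dW, ih]

lemma dW_inj {u v : List ℤ} (h : dW u = dW v) : u = v := by
  induction u generalizing v with
  | nil => cases v with
    | nil => rfl
    | cons => simp [dW] at h
  | cons c u ih => cases v with
    | nil => simp [dW] at h
    | cons c' v =>
      simp only [dW, List.cons.injEq, neg_inj] at h
      rw [h.1, ih h.2.2]

lemma dW_length (u : List ℤ) : (dW u).length = 2 * u.length := by
  induction u with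
  | nil => rfl
  | cons c u ih => simp [dW, ih]; ring

/-- doubling of shifted states -/
def dS (B : Set ℤ) : Set ℤ := {y | (y ≤ 0 ∧ 1 - y ∉ B) ∨ (2 ≤ y ∧ y - 1 ∈ B)}

lemma mem_dS {B : Set ℤ} {y : ℤ} : y ∈ dS B ↔ (y ≤ 0 ∧ 1 - y ∉ B) ∨ (2 ≤ y ∧ y - 1 ∈ B) := Iff.rfl

/-- admissible shifted states -/
def SB (B : Set ℤ) : Prop := 0 ∈ B ∧ ∀ x ∈ B, 0 ≤ x

lemma SB.hop {B : Set ℤ} (h : SB B) {c : ℤ} (hc : Hvalid B c) : SB (hop true B c) := by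
  obtain ⟨h1, h2⟩ := h
  have := h2 c hc.1
  refine ⟨?_, ?_⟩
  · rw [mem_hop]; right; refine ⟨h1, ?_⟩
    by_cases h : c = 0
    · right; exact ⟨rfl, h⟩
    · left; exact fun h' => h h'.symm
  · intro x hx
    rw [mem_hop] at hx
    rcases hx with rfl | hx
    · omega
    · exact h2 x hx.1

lemma dS_step1 {B : Set ℤ} (h : SB B) {c : ℤ} (hc : Hvalid B c) :
    HPath false (dS B) [-c, c + 1] (dS (hop true B c)) := by
  have h0 := h.2 c hc.1
  have h1 := h.1
  have hc1 := hc.1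
  have hc2 := hc.2
  have hB : ∀ x, x ∈ B → 0 ≤ x := h.2
  rw [HPath_cons, HPath_cons, HPath_nil]
  refine ⟨?_, ?_, ?_⟩
  · simp only [Hvalid, mem_dS]
    rcases h0.eq_or_lt with rfl | h0
    · simpa using hc2
    · have e1 : 1 - -c = c + 1 := by ring
      have e2 : 1 - (-c + 1) = c := by ring
      rw [e1, e2]
      grind
  · simp only [Hvalid, mem_hop, mem_dS]
    have e1 : c + 1 - 1 = c := by ring
    have e2 : c + 1 + 1 - 1 = c + 1 := by ring
    rw [e1, e2]
    grind
  · ext z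
    simp only [mem_hop, mem_dS]
    rcases h0.eq_or_lt with rfl | h0
    · by_cases hz : z = 2
      · subst hz; simp
      · by_cases hz' : z = 0
        · subst hz'; simp
        · by_cases hz'' : z = 1
          · subst hz''; simp
          · grind
    · by_cases hz1 : z = c + 2
      · subst hz1; grind
      by_cases hz2 : z = c + 1
      · subst hz2; grind
      by_cases hz3 : z = -c
      · subst hz3; grind
      by_cases hz4 : z = -c + 1
      · subst hz4
        have e1 : 1 - (-c + 1) = c := by ring
        rw [e1]; grind
      grind

lemma dS_path {B t : Set ℤ} {w : List ℤ} (h : SB B) (hp : HPath true B w t) :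
    HPath false (dS B) (dW w) (dS t) ∧ SB t := by
  induction w generalizing B with
  | nil => rw [HPath_nil] at hp; subst hp; exact ⟨by simp [dW, HPath_nil], h⟩
  | cons c w ih =>
    rw [HPath_cons] at hp
    have h1 := dS_step1 h hp.1
    have h2 := ih (h.hop hp.1) hp.2
    exact ⟨HPath_append'.2 ⟨_, h1, h2.1⟩, h2.2⟩

lemma dS_zero : dS {0} = Set.Iic 0 := by
  ext y
  simp only [mem_dS, Set.mem_singleton_iff, Set.mem_Iic]
  omega

lemma SB_zero : SB {0} := by simp [SB]

lemma cross_dW {c e : ℤ} (hc : 0 ≤ c) (he : 0 ≤ e) (hne : c ≠ e) :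
    sw [-c, c + 1] [-e, e + 1] = ([-cr1 c e, cr1 c e + 1], [-cr2 c e, cr2 c e + 1]) := by
  by_cases h : Far c e
  · have f1 : Far (c + 1) (-e) := by unfold Far at *; omega
    have f2 : Far (c + 1) (e + 1) := by unfold Far at *; omega
    have f3 : Far (-c) (-e) := by unfold Far at *; omega
    have f4 : Far (-c) (e + 1) := by unfold Far at *; omega
    simp [sw, thru, cr1, cr2, h, f1, f2, f3, f4]
  · have f1 : Far (c + 1) (-e) := by unfold Far at *; omega
    have f2 : ¬ Far (c + 1) (e + 1) := by unfold Far at *; omega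
    have f3 : ¬ Far (-c) (-e) := by unfold Far at *; omega
    have f4 : Far (-e) (c + 1) := by unfold Far at *; omega
    simp [sw, thru, cr1, cr2, h, f1, f2, f3, f4]

lemma sw_dW_single {B : Set ℤ} {c : ℤ} {T : List ℤ} (h : SB B) (hv : WValid true B (c :: T)) :
    sw [-c, c + 1] (dW T) = (dW (thru c T).1, dW [(thru c T).2]) := by
  induction T generalizing B c with
  | nil => simp [dW, thru, sw]
  | cons e T ih =>
    obtain ⟨v1, v2, v3⟩ := hv
    have hc := h.2 c v1.1
    have he := (h.hop v1).2 e v2.1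
    have hne := Hvalid_ne v2
    have e1 : dW (e :: T) = [-e, e + 1] ++ dW T := rfl
    rw [e1, sw_append_right, cross_dW hc he hne, thru_cons]
    dsimp only
    by_cases hf : Far c e
    · have v2' := (Hvalid_comm hf).1 v2
      have := ih (B := hop true B e) (c := c) (h.hop v2')
        ⟨(Hvalid_comm hf.symm).2 v1, by rwa [hop_comm _ _ hf.symm]⟩
      simp [cr1, cr2, hf, this, dW]
    · have := ih (B := hop true B c) (c := e) (h.hop v1) ⟨v2, v3⟩
      simp [cr1, cr2, hf, this, dW]

lemma sw_dW {B : Set ℤ} {S T : List ℤ} (h : SB B) (hv : WValid true B (S ++ T)) :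
    sw (dW S) (dW T) = (dW (sw S T).1, dW (sw S T).2) := by
  induction S generalizing B with
  | nil => simp [dW, sw]
  | cons c S ih =>
    have h1 := ih (h.hop hv.1) hv.2
    have e1 : dW (c :: S) = [-c, c + 1] ++ dW S := rfl
    rw [e1, sw_append_left, h1]
    have h2 : HPath true (hop true B c) ((sw S T).1 ++ (sw S T).2) (hopW true (hop true B c) (S ++ T)) :=
      sw_path_iff.2 ⟨hv.2, rfl⟩
    have h3 : WValid true B (c :: (sw S T).1) := by
      rw [HPath_append] at h2
      exact ⟨hv.1, h2.1.1⟩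
    rw [sw_dW_single h h3]
    simp [sw, dW]

/-- Confluence for shifted words. -/
theorem confluence_B {S S₂ T : List ℤ} {t : Set ℤ} (hl : S.length = S₂.length)
    (h1 : HPath true {0} S t) (h2 : HPath true {0} S₂ t) (hT : WValid true t T) :
    (sw S T).1 = (sw S₂ T).1 := by
  have a1 := dS_path SB_zero h1
  have a2 := dS_path SB_zero h2
  have a3 := dS_path a1.2 (w := T) (t := hopW true t T) ⟨hT, rfl⟩
  rw [dS_zero] at a1 a2
  have key := confluence_A (2 * S.length) (dW S) (dW S₂) (dW T) (dS t) (dW_length S)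
    (by rw [dW_length, hl]) a1.1 a2.1 a3.1.1
  have v1 : WValid true {0} (S ++ T) := by
    rw [WValid_append]; exact ⟨h1.1, by rw [h1.2]; exact hT⟩
  have v2 : WValid true {0} (S₂ ++ T) := by
    rw [WValid_append]; exact ⟨h2.1, by rw [h2.2]; exact hT⟩
  rw [sw_dW SB_zero v1, sw_dW SB_zero v2] at key
  exact dW_inj key

/-- increasing run -/
def up (a : ℤ) : ℕ → List ℤ
  | 0 => []
  | k + 1 => a :: up (a + 1) k

/-- decreasing run -/
def dn (a : ℤ) : ℕ → List ℤ
  | 0 => []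
  | k + 1 => a :: dn (a - 1) k

lemma mem_up {a y : ℤ} {k : ℕ} : y ∈ up a k ↔ a ≤ y ∧ y < a + k := by
  induction k generalizing a with
  | zero => simp [up]
  | succ k ih => simp only [up, List.mem_cons, ih]; push_cast; omega

lemma mem_dn {a y : ℤ} {k : ℕ} : y ∈ dn a k ↔ a - k < y ∧ y ≤ a := by
  induction k generalizing a with
  | zero => simp [dn]
  | succ k ih => simp only [dn, List.mem_cons, ih]; push_cast; omega

lemma up_length (a : ℤ) (k : ℕ) : (up a k).length = k := by
  induction k generalizing a with
  | zero => rfl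
  | succ k ih => simp [up, ih]

lemma dn_length (a : ℤ) (k : ℕ) : (dn a k).length = k := by
  induction k generalizing a with
  | zero => rfl
  | succ k ih => simp [dn, ih]

lemma dn_snoc (a : ℤ) (k : ℕ) : dn a (k + 1) = dn a k ++ [a - k] := by
  induction k generalizing a with
  | zero => simp [dn]
  | succ k ih => rw [dn, ih, dn, List.cons_append]; push_cast; congr 3; ring

lemma up_snoc (a : ℤ) (k : ℕ) : up a (k + 1) = up a k ++ [a + k] := by
  induction k generalizing a with
  | zero => simp [up]
  | succ k ih => rw [up, ih, up, List.cons_append]; push_cast; congr 3; ring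

lemma thru_far {x : ℤ} {T : List ℤ} (h : ∀ y ∈ T, Far x y) : thru x T = (T, x) := by
  induction T with
  | nil => rfl
  | cons y T ih =>
    simp only [thru, h y (by simp), if_true, ih (fun z hz => h z (by simp [hz]))]

lemma sw_far {S T : List ℤ} (h : ∀ x ∈ S, ∀ y ∈ T, Far x y) : sw S T = (T, S) := by
  induction S with
  | nil => rfl
  | cons x S ih =>
    simp only [sw, ih (fun z hz => h z (by simp [hz])), thru_far (h x (by simp))]

lemma thru_up (k : ℤ) (n : ℕ) : thru k (up (k + 1) n) = (up k n, k + n) := by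
  induction n generalizing k with
  | zero => simp [up, thru]
  | succ n ih =>
    have : ¬ Far k (k + 1) := by unfold Far; omega
    simp only [up, thru, this, if_false, ih]
    push_cast; congr 1; ring

lemma sw_alpha (B : List ℤ) (k n : ℕ) (hB : ∀ x ∈ B, (k : ℤ) + n + 1 ≤ x) :
    sw (B ++ dn k (k + 1)) (up (k + 1) n) = (up k n, (B ++ [(k : ℤ) + n]) ++ dn (k - 1) k) := by
  rw [sw_append_left]
  have h1 : sw (dn (k - 1) k) (up (k + 1) n) = (up (k + 1) n, dn (k - 1) k) := by
    apply sw_far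
    intro x hx y hy
    rw [mem_dn] at hx; rw [mem_up] at hy; unfold Far; omega
  have h2 : sw (dn k (k + 1)) (up (k + 1) n) = (up k n, (k + n : ℤ) :: dn (k - 1) k) := by
    simp only [dn, sw, h1, thru_up]
  rw [h2]
  dsimp only
  rw [sw_far (S := B) (T := up k n)]
  · simp
  · intro x hx y hy
    have := hB x hx; rw [mem_up] at hy; unfold Far; omega

/-- the rows of the initial tableau -/
def rA (n : ℕ) : ℕ → List ℤ
  | 0 => []
  | k + 1 => up (k + 1) n ++ rA n k

/-- the rows shifted -/
def rA' (n : ℕ) : ℕ → List ℤ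
  | 0 => []
  | k + 1 => up k n ++ rA' n k

lemma rA'_succ (n k : ℕ) : rA' n (k + 1) = rA n k ++ up 0 n := by
  induction k with
  | zero => simp [rA', rA]
  | succ k ih => rw [rA', ih, rA]; simp

lemma rA_length (n k : ℕ) : (rA n k).length = k * n := by
  induction k with
  | zero => simp [rA]
  | succ k ih => simp [rA, ih, up_length]; ring

lemma sw_rA (n k : ℕ) (B : List ℤ) (hB : ∀ x ∈ B, (k : ℤ) + n ≤ x) :
    sw (B ++ dn (k - 1) k) (rA n k) = (rA' n k, B ++ dn (k - 1 + n) k) := by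
  induction k generalizing B with
  | zero => simp [dn, rA, rA', sw_nil]
  | succ k ih =>
    rw [rA, sw_append_right]
    have e : ((k + 1 : ℕ) : ℤ) - 1 = k := by push_cast; ring
    rw [e, sw_alpha B k n (fun x hx => by have := hB x hx; push_cast at this; omega)]
    dsimp only
    rw [ih]
    · simp [rA', dn]; ring_nf
    · intro x hx
      simp only [List.mem_append, List.mem_singleton] at hx
      rcases hx with hx | rfl
      · have := hB x hx; push_cast at this; omega
      · exact le_rfl

lemma sw_beta (a l : ℕ) (tail : List ℤ) (ht : ∀ y ∈ tail, (a : ℤ) + (l + 1) + 2 ≤ y) :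
    sw (dn (a + (l + 1)) (l + 1)) (up 0 (a + 1) ++ tail) =
      (up 0 a ++ ((a + (l + 1) : ℤ) :: tail), dn (a + l) (l + 1)) := by
  induction l with
  | zero =>
    simp only [dn, sw]
    rw [up_snoc, List.append_assoc, thru_append, thru_far (T := up 0 a)]
    · have h1 : ¬ Far ((a : ℤ) + ((0 : ℕ) + 1)) (0 + a) := by unfold Far; push_cast; omega
      simp only [List.singleton_append, thru, h1, if_false]
      rw [thru_far]
      · simp
      · intro y hy; have := ht y hy; unfold Far; push_cast at *; omega
    · intro y hy; rw [mem_up] at hy; unfold Far; push_cast; omega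
  | succ l ih =>
    have ih := ih (fun y hy => by have := ht y hy; push_cast at *; omega)
    have e : dn ((a : ℤ) + ((l + 1 : ℕ) + 1)) (l + 1 + 1) =
      ((a : ℤ) + ((l + 1 : ℕ) + 1)) :: dn (a + (l + 1)) (l + 1) := by
      rw [dn]; congr 2; push_cast; ring
    rw [e, sw, ih]
    dsimp only
    rw [thru_append, thru_far (T := up 0 a)]
    · have h1 : ¬ Far ((a : ℤ) + ((l + 1 : ℕ) + 1)) (a + (l + 1)) := by
        unfold Far; push_cast; omega
      simp only [thru, h1, if_false]
      rw [thru_far]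
      · rw [dn.eq_2 _ (l + 1)]; push_cast; congr 4 ; ring
      · intro y hy; have := ht y hy; unfold Far; push_cast at *; omega
    · intro y hy; rw [mem_up] at hy; unfold Far; push_cast; omega

/-- shape of the lower rows during the computation -/
inductive URows : ℕ → ℕ → ℤ → List ℤ → Prop
  | nil (l : ℕ) (x : ℤ) : URows 0 l x []
  | cons (r l : ℕ) (x : ℤ) (tail rest : List ℤ) (ht : ∀ y ∈ tail, x + 2 ≤ y)
      (h : URows r l (x - 1) rest) : URows (r + 1) (l + 1) x (up 0 (l + 1) ++ tail ++ rest)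

lemma sw_URows (m : ℕ) (r : ℕ) : ∀ (l : ℕ) (Us : List ℤ),
    URows r (l + 1) (l + (m + 1)) Us → r ≤ l →
    ∃ Us', URows r l (l + (m + 1) - 2) Us' ∧
      sw (dn (l + (m + 1)) (m + 1)) Us = (Us', dn (l + (m + 1) - r) (m + 1)) := by
  induction r with
  | zero =>
    intro l Us h _
    cases h
    exact ⟨[], .nil _ _, by simp [sw_nil]⟩
  | succ r ih =>
    intro l Us h hr
    obtain ⟨l', rfl⟩ : ∃ l', l = l' + 1 := ⟨l - 1, by omega⟩
    cases h with
    | cons _ _ _ tail rest ht h =>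
    have e : (((l' + 1 : ℕ) : ℤ) + (m + 1) - 1) = l' + (m + 1) := by push_cast; ring
    rw [e] at h
    obtain ⟨Us', h1, h2⟩ := ih l' rest h (by omega)
    refine ⟨up 0 (l' + 1) ++ (((l' + 1 : ℕ) + (m + 1) : ℤ) :: tail) ++ Us', ?_, ?_⟩
    · refine .cons _ _ _ _ _ ?_ ?_
      · intro y hy
        simp only [List.mem_cons] at hy
        rcases hy with rfl | hy
        · omega
        · have := ht y hy; omega
      · convert h1 using 1; push_cast; ring
    · rw [sw_append_right, sw_beta _ _ _ ht]
      dsimp only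
      have e2 : (((l' + 1 : ℕ) : ℤ) + m) = l' + (m + 1) := by push_cast; ring
      rw [e2, h2]
      simp only [Prod.mk.injEq, true_and]
      congr 1; push_cast; ring

/-- column superstandard word -/
def Scol : ℕ → List ℤ
  | 0 => []
  | k + 1 => Scol k ++ dn k (k + 1)

/-- the word leading from the doubled staircase to the shifted trapezoid -/
def S0 : ℕ → List ℤ
  | 0 => []
  | k + 1 => S0 k ++ dn (2 * k + 1) (k + 1)

lemma Scol_S0_length (k : ℕ) : (Scol k).length = (S0 k).length := by
  induction k with
  | zero => rfl
  | succ k ih => simp [Scol, S0, ih, dn_length]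

lemma sw_Scol (n k : ℕ) : ∀ Us, k ≤ n → URows (n - k) n (n + k - 1) Us →
    (sw (Scol k) (rA n k ++ Us)).2 = S0 k := by
  induction k with
  | zero => intro Us _ _; simp [Scol, S0, sw]
  | succ k ih =>
    intro Us hk hU
    rw [Scol, sw_append_left]
    have h1 := sw_rA n (k + 1) [] (by simp)
    have e : ((k + 1 : ℕ) : ℤ) - 1 = k := by push_cast; ring
    rw [e] at h1
    simp only [List.nil_append] at h1
    obtain ⟨l, rfl⟩ : ∃ l, n = l + 1 := ⟨n - 1, by omega⟩
    have e2 : (((l + 1 : ℕ) : ℤ) + (k + 1 : ℕ) - 1) = l + (k + 1) := by push_cast; ring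
    rw [e2] at hU
    obtain ⟨Us', h2, h3⟩ := sw_URows k (l + 1 - (k + 1)) l Us hU (by omega)
    have h4 : sw (dn k (k + 1)) (rA (l + 1) (k + 1) ++ Us) =
        (rA (l + 1) k ++ (up 0 (l + 1) ++ [] ++ Us'), dn (2 * k + 1) (k + 1)) := by
      rw [sw_append_right, h1]
      dsimp only
      have e3 : ((k : ℤ) + (l + 1 : ℕ)) = l + (k + 1) := by push_cast; ring
      rw [e3, h3, rA'_succ]
      simp only [Prod.mk.injEq, List.append_assoc, List.append_nil, true_and]
      congr 1
      omega
    rw [h4]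
    dsimp only
    rw [ih _ (by omega), S0]
    have e5 : l + 1 - k = (l + 1 - (k + 1)) + 1 := by omega
    rw [e5]
    refine .cons _ _ _ _ _ (by simp) ?_
    convert h2 using 1
    push_cast; ring

lemma sw_T0 (n : ℕ) : (sw (Scol n) (rA n n)).2 = S0 n := by
  have := sw_Scol n n [] le_rfl (by rw [Nat.sub_self]; exact .nil _ _)
  simpa using this

lemma dn_path {b : Bool} {l : ℕ} : ∀ {a : ℤ} {s : Set ℤ}, (∀ y, a - l ≤ y → y ≤ a → y ∈ s) →
    a + 1 ∉ s → (b = true → 0 ≤ a - l) →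
    HPath b s (dn a (l + 1)) {y | y = a + 1 ∨ (y ∈ s ∧ (y ≠ a - l ∨ (b = true ∧ a - l = 0)))} := by
  induction l with
  | zero =>
    intro a s h1 h2 h3
    rw [dn, dn, HPath_cons, HPath_nil]
    refine ⟨⟨h1 a (by simp) le_rfl, h2⟩, ?_⟩
    ext y; rw [mem_hop]; simp
  | succ l ih =>
    intro a s h1 h2 h3
    rw [dn, HPath_cons]
    push_cast at h1 h3 ⊢
    have ha := h1 a (by omega) le_rfl
    refine ⟨⟨ha, h2⟩, ?_⟩
    have := @ih (a - 1) (hop b s a) ?_ ?_ ?_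
    · convert this using 1
      ext y
      have e1 : a - 1 - (l : ℤ) = a - (l + 1) := by ring
      have e2 : a - 1 + 1 = a := by ring
      simp only [Set.mem_ofPred_eq, mem_hop, e1, e2]
      have h4 : b = true → a ≠ 0 := fun h => by have := h3 h; omega
      grind
    · intro y hy1 hy2
      rw [mem_hop]; right
      exact ⟨h1 y (by omega) (by omega), Or.inl (by omega)⟩
    · rw [mem_hop]
      have e2 : a - 1 + 1 = a := by ring
      rw [e2]
      have h4 : b = true → a ≠ 0 := fun h => by have := h3 h; omega
      rintro (h | ⟨_, h | ⟨h, h'⟩⟩)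
      · omega
      · exact h rfl
      · exact h4 h h'
    · intro h; have := h3 h; omega

lemma up_path {b : Bool} {l : ℕ} : ∀ {a : ℤ} {s : Set ℤ}, a ∈ s →
    (∀ y, a < y → y ≤ a + l + 1 → y ∉ s) → (0 < a) →
    HPath b s (up a (l + 1)) {y | y = a + l + 1 ∨ (y ∈ s ∧ y ≠ a)} := by
  induction l with
  | zero =>
    intro a s h1 h2 h3
    rw [up, up, HPath_cons, HPath_nil]
    refine ⟨⟨h1, h2 _ (by omega) (by simp)⟩, ?_⟩
    ext y; rw [mem_hop]; simp [h3.ne']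
  | succ l ih =>
    intro a s h1 h2 h3
    rw [up, HPath_cons]
    push_cast at h2 ⊢
    refine ⟨⟨h1, h2 _ (by omega) (by omega)⟩, ?_⟩
    have := @ih (a + 1) (hop b s a) ?_ ?_ ?_
    · convert this using 1
      ext y
      have e1 : a + 1 + (l : ℤ) + 1 = a + (l + 1) + 1 := by ring
      simp only [Set.mem_ofPred_eq, mem_hop, e1]
      have := h2 (a + 1) (by omega) (by omega)
      by_cases hy : y = a + 1
      · subst hy; simp [this]
      · grind
    · rw [mem_hop]; left; rfl
    · intro y hy1 hy2
      rw [mem_hop]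
      have := h2 y (by omega) (by omega)
      grind
    · omega

/-- trapezoid start state (with reservoir) -/
def stD (n : ℕ) : Set ℤ := {y | 0 ≤ y ∧ y ≤ n}
/-- end state -/
def stN (n : ℕ) : Set ℤ := {y | y = 0 ∨ (n + 1 ≤ y ∧ y ≤ 2 * n)}
/-- doubled staircase state -/
def stB (n : ℕ) : Set ℤ := {y | y = 0 ∨ (0 ≤ y ∧ y < 2 * n ∧ y % 2 = 1)}

lemma Scol_path (k : ℕ) : HPath true {0} (Scol k) (stD k) := by
  induction k with
  | zero => rw [Scol, HPath_nil]; ext y; simp [stD]; omega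
  | succ k ih =>
    rw [Scol, HPath_append']
    refine ⟨_, ih, ?_⟩
    convert dn_path (b := true) (l := k) (a := k) (s := stD k) ?_ ?_ ?_ using 1
    · ext y; simp [stD]; push_cast; omega
    · intro y; simp [stD]; exact fun h1 h2 => ⟨h1, h2⟩
    · simp [stD]
    · simp

lemma S0_path (n k : ℕ) (hk : k ≤ n) : HPath true (stB n) (S0 k)
    {y | y = 0 ∨ (k + 1 ≤ y ∧ y ≤ 2 * k) ∨ (2 * k < y ∧ y < 2 * n ∧ y % 2 = 1)} := by
  induction k with
  | zero => rw [S0, HPath_nil]; ext y; simp [stB]; omega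
  | succ k ih =>
    rw [S0, HPath_append']
    refine ⟨_, ih (by omega), ?_⟩
    convert dn_path (b := true) (l := k) (a := 2 * k + 1) (s := _) ?_ ?_ ?_ using 1
    · ext y; simp only [Set.mem_ofPred_eq]; push_cast; omega
    · intro y; simp only [Set.mem_ofPred_eq]; omega
    · simp only [Set.mem_ofPred_eq]; omega
    · omega

lemma S0_path' (n : ℕ) : HPath true (stB n) (S0 n) (stN n) := by
  convert S0_path n n le_rfl using 1
  ext y; simp only [stN, Set.mem_ofPred_eq]; omega

lemma rA_path (n k : ℕ) (hk : k ≤ n) :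
    HPath true {y | (0 ≤ y ∧ y ≤ k) ∨ (n + k + 1 ≤ y ∧ y ≤ 2 * n)} (rA n k) (stN n) := by
  induction k with
  | zero => rw [rA, HPath_nil]; ext y; simp [stN]; omega
  | succ k ih =>
    rw [rA, HPath_append']
    refine ⟨_, ?_, ih (by omega)⟩
    obtain ⟨m, rfl⟩ : ∃ m, n = m + 1 := ⟨n - 1, by omega⟩
    convert up_path (b := true) (l := m) (a := k + 1) (s := _) ?_ ?_ ?_ using 1
    · ext y; simp only [Set.mem_ofPred_eq]; push_cast; omega
    · simp only [Set.mem_ofPred_eq]; push_cast; omega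
    · intro y; simp only [Set.mem_ofPred_eq]; push_cast; omega
    · omega

lemma T0_path (n : ℕ) : HPath true (stD n) (rA n n) (stN n) := by
  convert rA_path n n le_rfl using 1
  ext y; simp only [stD, Set.mem_ofPred_eq]; omega

lemma hop_injB {s t : Set ℤ} {x : ℤ} (h : Hvalid s x) (h' : Hvalid t x)
    (e : hop true s x = hop true t x) : s = t := by
  ext y
  have := congrArg (fun A => y ∈ A) e
  simp only [Hvalid, mem_hop] at *
  grind

lemma path_injB {s s' t : Set ℤ} {w : List ℤ} (h : HPath true s w t) (h' : HPath true s' w t) :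
    s = s' := by
  induction w generalizing s s' with
  | nil => rw [HPath_nil] at h h'; rw [h, h']
  | cons x w ih =>
    rw [HPath_cons] at h h'
    exact hop_injB h.1 h'.1 (ih h.2 h'.2)

/-- words of shifted doubled staircase tableaux -/
def WB (n : ℕ) (Q : List ℤ) : Prop := HPath true {0} Q (stB n) ∧ Q.length = n * n

/-- the first row state of the square -/
def sqA (n : ℕ) : Set ℤ := {y | 1 ≤ y ∧ y ≤ n}
/-- the final state of the square -/
def sqB (n : ℕ) : Set ℤ := {y | n + 1 ≤ y ∧ y ≤ 2 * n}

/-- words of square tableaux -/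
def WA (n : ℕ) (T : List ℤ) : Prop := HPath false (sqA n) T (sqB n) ∧ T.length = n * n

/-- the bijection -/
def Psi (n : ℕ) (Q : List ℤ) : List ℤ := (sw Q (S0 n)).2

lemma Q0_WB (n : ℕ) : WB n (sw (Scol n) (rA n n)).1 := by
  refine ⟨?_, by rw [(sw_length _ _).1, rA_length]⟩
  have h : HPath true {0} ((sw (Scol n) (rA n n)).1 ++ (sw (Scol n) (rA n n)).2) (stN n) :=
    sw_path_iff.2 (HPath_append'.2 ⟨_, Scol_path n, T0_path n⟩)
  rw [sw_T0, HPath_append'] at h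
  obtain ⟨r, h1, h2⟩ := h
  rwa [path_injB h2 (S0_path' n)] at h1

lemma sw_Q_S0 {n : ℕ} {Q : List ℤ} (hQ : WB n Q) : sw Q (S0 n) = (Scol n, Psi n Q) := by
  have h0 := Q0_WB n
  have h1 := confluence_B (hQ.2.trans h0.2.symm) hQ.1 h0.1 (S0_path' n).1
  have h2 := sw_invol (Scol n) (rA n n)
  rw [sw_T0] at h2
  rw [h2] at h1
  ext1
  · exact h1
  · rfl

lemma sw_Scol_Psi {n : ℕ} {Q : List ℤ} (hQ : WB n Q) : sw (Scol n) (Psi n Q) = (Q, S0 n) := by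
  have := sw_invol Q (S0 n)
  rwa [sw_Q_S0 hQ] at this

lemma Psi_inj {n : ℕ} {Q Q' : List ℤ} (hQ : WB n Q) (hQ' : WB n Q') (h : Psi n Q = Psi n Q') :
    Q = Q' := by
  have h1 := sw_Scol_Psi hQ
  rw [h, sw_Scol_Psi hQ'] at h1
  simpa using h1.symm

lemma Psi_path {n : ℕ} {Q : List ℤ} (hQ : WB n Q) :
    HPath true (stD n) (Psi n Q) (stN n) := by
  have h : HPath true {0} ((sw Q (S0 n)).1 ++ (sw Q (S0 n)).2) (stN n) :=
    sw_path_iff.2 (HPath_append'.2 ⟨_, hQ.1, S0_path' n⟩)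
  rw [sw_Q_S0 hQ, HPath_append] at h
  have := (Scol_path n).2
  rw [this] at h
  exact h.2

lemma path_cardB {w : List ℤ} : ∀ {s t : Set ℤ}, HPath true s w t → s.Finite → 0 ∈ s →
    t.Finite ∧ s.ncard ≤ t.ncard ∧
    (s.ncard = t.ncard → HPath false (s \ {0}) w (t \ {0})) := by
  induction w with
  | nil =>
    intro s t h hf h0
    rw [HPath_nil] at h; subst h
    exact ⟨hf, le_rfl, fun _ => HPath_nil.2 rfl⟩
  | cons x w ih =>
    intro s t h hf h0
    rw [HPath_cons] at h
    obtain ⟨hv, hp⟩ := h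
    by_cases hx : x = 0
    · subst hx
      have e : hop true s 0 = insert 1 s := by
        ext y; rw [mem_hop]; simp
      rw [e] at hp
      have hc : (insert 1 s).ncard = s.ncard + 1 := Set.ncard_insert_of_notMem (by simpa using hv.2) hf
      obtain ⟨a1, a2, a3⟩ := ih hp (hf.insert 1) (by simp [h0])
      exact ⟨a1, by omega, fun h => by omega⟩
    · have e : hop true s x = insert (x + 1) (s \ {x}) := by
        ext y; rw [mem_hop]; simp [hx]
      have hc : (hop true s x).ncard = s.ncard := by
        rw [e, Set.ncard_insert_of_notMem (fun h => hv.2 h.1) hf.sdiff,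
          Set.ncard_sdiff_singleton_add_one hv.1 hf]
      have h0' : 0 ∈ hop true s x := by
        rw [mem_hop]; right; exact ⟨h0, Or.inl (Ne.symm hx)⟩
      have hf' : (hop true s x).Finite := by rw [e]; exact hf.sdiff.insert _
      obtain ⟨a1, a2, a3⟩ := ih hp hf' h0'
      refine ⟨a1, by omega, fun h => ?_⟩
      rw [HPath_cons]
      have hx1 : x + 1 ≠ 0 := fun h' => hv.2 (h' ▸ h0)
      refine ⟨⟨⟨hv.1, hx⟩, fun h => hv.2 h.1⟩, ?_⟩
      convert a3 (by omega) using 1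
      ext y
      simp only [mem_hop, Set.mem_sdiff, Set.mem_singleton_iff]
      grind

lemma stD_eq (n : ℕ) : stD n \ {0} = sqA n := by
  ext y; simp [stD, sqA]; omega
lemma stN_eq (n : ℕ) : stN n \ {0} = sqB n := by
  ext y; simp [stN, sqB]; omega

lemma stD_Icc (n : ℕ) : stD n = Set.Icc 0 (n : ℤ) := rfl
lemma sqB_Icc (n : ℕ) : sqB n = Set.Icc (n + 1 : ℤ) (2 * n) := rfl

lemma ncard_Icc_int (a b : ℤ) : (Set.Icc a b).ncard = (b + 1 - a).toNat := by
  rw [← Finset.coe_Icc, Set.ncard_coe_finset, Int.card_Icc]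

lemma Psi_WA {n : ℕ} {Q : List ℤ} (hQ : WB n Q) : WA n (Psi n Q) := by
  refine ⟨?_, ?_⟩
  · have hf : (stD n).Finite := Set.finite_Icc _ _
    have h := path_cardB (Psi_path hQ) hf (by simp [stD])
    rw [stD_eq, stN_eq] at h
    refine h.2.2 ?_
    have e : stN n = insert 0 (sqB n) := by ext y; simp [stN, sqB]
    have h0 : (0 : ℤ) ∉ sqB n := by
      intro h; have := h.1; omega
    rw [e, Set.ncard_insert_of_notMem h0 (sqB_Icc n ▸ Set.finite_Icc _ _), stD_Icc, sqB_Icc,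
      ncard_Icc_int, ncard_Icc_int]
    omega
  · have h1 := sw_Scol_Psi hQ
    have h2 := (sw_length (Scol n) (Psi n Q)).1
    rw [h1] at h2
    rw [← h2]; exact hQ.2

lemma wprom_WB {n : ℕ} {Q : List ℤ} (hQ : WB n Q) : WB n (wprom Q) :=
  ⟨wprom_path hQ.1, by rw [wprom_length, hQ.2]⟩

lemma wprom_WA {n : ℕ} {Q : List ℤ} (hQ : WA n Q) : WA n (wprom Q) :=
  ⟨wprom_path hQ.1, by rw [wprom_length, hQ.2]⟩

lemma sw_cons_right (S T : List ℤ) (b : ℤ) :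
    sw S (b :: T) = ((sw S [b]).1 ++ (sw (sw S [b]).2 T).1, (sw (sw S [b]).2 T).2) :=
  sw_append_right S [b] T

/-- last letter determined by the end states -/
lemma last_eq {b : Bool} {s t : Set ℤ} {u : List ℤ} {x y : ℤ}
    (h1 : HPath b s (u ++ [x]) t) (h2 : HPath b s (u ++ [y]) t) : x = y := by
  rw [HPath_append, HPath_cons, HPath_nil] at h1 h2
  have e := h1.2.2.trans h2.2.2.symm
  have v1 := h1.2.1
  have v2 := h2.2.1
  have := congrArg (fun A => x + 1 ∈ A) e
  simp only [Hvalid, mem_hop] at *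
  by_contra hne
  have h3 : x + 1 ≠ y + 1 := by omega
  grind

lemma Psi_wprom {n : ℕ} (hsurj : ∀ T, WA n T → ∃ Q, WB n Q ∧ Psi n Q = T)
    {Q : List ℤ} (hQ : WB n Q) : Psi n (wprom Q) = wprom (Psi n Q) := by
  have hP := sw_Scol_Psi hQ
  have hPP := Psi_path hQ
  rcases hT : Psi n Q with _ | ⟨b, T1⟩
  · rw [hT, sw_nil] at hP
    have : Q = [] := by simpa using (congrArg Prod.fst hP).symm
    subst this
    simpa [wprom] using hT
  rw [hT] at hP hPP
  -- split
  obtain ⟨b0, hb0⟩ : ∃ b0, (sw (Scol n) [b]).1 = [b0] := by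
    have := (sw_length (Scol n) [b]).1
    simpa [List.length_eq_one_iff] using this
  set S'' := (sw (Scol n) [b]).2 with hS''
  have hP' := hP
  rw [sw_cons_right, hb0, ← hS''] at hP'
  have hQe : Q = b0 :: (sw S'' T1).1 := by
    have := congrArg Prod.fst hP'; simpa using this.symm
  have hSe : (sw S'' T1).2 = S0 n := congrArg Prod.snd hP'
  -- paths
  have p1 : HPath true {0} (Scol n ++ [b]) (hop true (stD n) b) := by
    rw [HPath_append']
    refine ⟨_, Scol_path n, ?_⟩
    rw [HPath_cons, HPath_nil]
    exact ⟨(HPath_cons.1 hPP).1, rfl⟩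
  have p2 : HPath true {0} (b0 :: S'') (hop true (stD n) b) := by
    have := sw_path_iff.2 p1
    rwa [hb0] at this
  have p3 := (HPath_cons.1 hPP).2
  have len : (b0 :: S'').length = (Scol n ++ [b]).length := by
    have := (sw_length (Scol n) [b]).2
    simp only [List.length_cons, List.length_append, List.length_nil]
    rw [hS'', this]
  have conf := confluence_B len p2 p1 p3.1
  -- compute both sides
  have c1 : (sw (b0 :: S'') T1).1 = (thru b0 (sw S'' T1).1).1 := rfl
  have c2 : (sw (Scol n ++ [b]) T1).1 = (sw (Scol n) (thru b T1).1).1 := by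
    rw [sw_append_left, sw_single_left]
  rw [c1, c2] at conf
  set U := (thru b T1).1 with hU
  have hwQ : wprom Q = (sw (Scol n) U).1 ++ [(thru b0 (sw S'' T1).1).2] := by
    rw [hQe, wprom, conf]
  have hwT : wprom (b :: T1) = U ++ [(thru b T1).2] := rfl
  obtain ⟨Q1, hQ1, hQ1T⟩ := hsurj _ (wprom_WA (hT ▸ Psi_WA hQ))
  have key := sw_Scol_Psi hQ1
  rw [hQ1T, hwT, sw_append_right] at key
  have k1 := congrArg Prod.fst key
  dsimp only at k1
  obtain ⟨z, hz⟩ : ∃ z, (sw (sw (Scol n) U).2 [(thru b T1).2]).1 = [z] := by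
    have := (sw_length (sw (Scol n) U).2 [(thru b T1).2]).1
    simpa [List.length_eq_one_iff] using this
  rw [hz] at k1
  have hw := wprom_WB hQ
  have : Q1 = wprom Q := by
    rw [hwQ, ← k1]
    have h1 := hQ1.1
    have h2 := hw.1
    rw [← k1] at h1
    rw [hwQ] at h2
    rw [last_eq h1 h2]
  rw [← this, hQ1T]

/-! Full twist in a monoid with braid relations -/
section twist
variable {M : Type*} [Monoid M]

/-- product `T a * T (a+1) * ... * T (a+l-1)` -/
def upP (T : ℕ → M) (a : ℕ) : ℕ → M
  | 0 => 1
  | l + 1 => upP T a l * T (a + l)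

/-- `T (m-1) * T (m-2) * ... * T (m-j)` -/
def dnP (T : ℕ → M) (m : ℕ) : ℕ → M
  | 0 => 1
  | j + 1 => dnP T m j * T (m - j - 1)

/-- `T (j-1) ... T 0 T 0 ... T (j-1)` -/
def jmL (T : ℕ → M) : ℕ → M
  | 0 => 1
  | j + 1 => T j * jmL T j * T j

/-- braid relations for the generators of index `< m` -/
structure BraidRel (T : ℕ → M) (m : ℕ) : Prop where
  braid : ∀ i, i + 1 < m → T i * T (i + 1) * T i = T (i + 1) * T i * T (i + 1)
  comm : ∀ i j, i < m → j < m → i + 2 ≤ j → T i * T j = T j * T i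

lemma upP_comm {T : ℕ → M} {m : ℕ} (h : BraidRel T m) {l i : ℕ} (hl : l + 1 ≤ i) (hi : i < m) :
    T i * upP T 0 l = upP T 0 l * T i := by
  induction l with
  | zero => simp [upP]
  | succ l ih =>
    rw [upP, ← mul_assoc, ih (by omega), mul_assoc, mul_assoc, zero_add,
      h.comm l i (by omega) hi (by omega)]

lemma upP_shift {T : ℕ → M} {m : ℕ} (h : BraidRel T m) {l i : ℕ} (hl : i + 2 ≤ l) (hm : l ≤ m) :
    T (i + 1) * upP T 0 l = upP T 0 l * T i := by
  induction l with
  | zero => omega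
  | succ l ih =>
    rcases Nat.lt_or_ge (i + 1) l with h1 | h1
    · rw [upP, ← mul_assoc, ih (by omega) (by omega), mul_assoc, mul_assoc, zero_add,
        h.comm i l (by omega) (by omega) (by omega)]
    · obtain rfl : l = i + 1 := by omega
      rw [upP, upP, zero_add, zero_add, ← mul_assoc, ← mul_assoc,
        upP_comm h (l := i) (i := i + 1) le_rfl (by omega)]
      rw [mul_assoc (upP T 0 i), mul_assoc (upP T 0 i), mul_assoc (upP T 0 i),
        mul_assoc (upP T 0 i), h.braid i (by omega)]

lemma dnP_upP {T : ℕ → M} {m l j : ℕ} (h : BraidRel T m) (hl : l ≤ m) (hj : j + 1 ≤ l) :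
    dnP T l j * upP T 0 l = upP T 0 l * dnP T (l - 1) j := by
  induction j with
  | zero => simp [dnP]
  | succ j ih =>
    rw [dnP, mul_assoc]
    have e : l - j - 1 = (l - 1 - j - 1) + 1 := by omega
    rw [e, upP_shift h (by omega) hl, ← mul_assoc, ih (by omega), mul_assoc, dnP]

lemma dnP_succ' {T : ℕ → M} (m j : ℕ) : T m * dnP T m j = dnP T (m + 1) (j + 1) := by
  induction j with
  | zero => simp [dnP]
  | succ j ih =>
    rw [dnP, ← mul_assoc, ih, dnP.eq_2 T (m + 1) (j + 1)]
    congr 2; omega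

lemma upP_pow {T : ℕ → M} {m l j : ℕ} (h : BraidRel T m) (hl : l + 1 ≤ m) (hj : j ≤ l + 1) :
    (upP T 0 (l + 1)) ^ j = (upP T 0 l) ^ j * dnP T (l + 1) j := by
  induction j with
  | zero => simp [dnP]
  | succ j ih =>
    rw [pow_succ, ih (by omega), mul_assoc, dnP_upP h hl (by omega), upP, zero_add, Nat.add_sub_cancel,
      ← mul_assoc, ← mul_assoc, ← pow_succ, mul_assoc, dnP_succ']

lemma jmL_eq {T : ℕ → M} (l : ℕ) : jmL T l = dnP T l l * upP T 0 l := by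
  induction l with
  | zero => simp [jmL, dnP, upP]
  | succ l ih =>
    rw [jmL, ih, upP, ← dnP_succ', zero_add]
    simp only [mul_assoc]

/-- The full twist is the product of Jucys–Murphy elements. -/
lemma full_twist {T : ℕ → M} {m : ℕ} (h : BraidRel T m) (l : ℕ) (hl : l ≤ m) :
    (upP T 0 l) ^ (l + 1) = ((List.range (l + 1)).map (jmL T)).prod := by
  induction l with
  | zero => simp [upP, jmL]
  | succ l ih =>
    rw [pow_succ, upP_pow h hl le_rfl, ih (by omega), mul_assoc, ← jmL_eq,
      List.range_succ (n := l + 1), List.map_append, List.prod_append]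
    simp

end twist

/-! Operators on functions of words -/

/-- swap of adjacent letters -/
def wsw (j : ℕ) (w : ℕ → ℤ) : ℕ → ℤ := fun i => w (Equiv.swap j (j + 1) i)

lemma wsw_left (j : ℕ) (w : ℕ → ℤ) : wsw j w j = w (j + 1) := by simp [wsw]
lemma wsw_right (j : ℕ) (w : ℕ → ℤ) : wsw j w (j + 1) = w j := by simp [wsw]
lemma wsw_other {j i : ℕ} (w : ℕ → ℤ) (h1 : i ≠ j) (h2 : i ≠ j + 1) : wsw j w i = w i := by
  simp [wsw, Equiv.swap_apply_of_ne_of_ne h1 h2]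
lemma wsw_wsw (j : ℕ) (w : ℕ → ℤ) : wsw j (wsw j w) = w := by
  funext i; simp [wsw]

lemma wsw_comm {i j : ℕ} (h : i + 2 ≤ j) (w : ℕ → ℤ) : wsw i (wsw j w) = wsw j (wsw i w) := by
  funext k
  simp only [wsw, Equiv.swap_apply_def]
  congr 1
  split_ifs <;> omega

lemma wsw_braid (j : ℕ) (w : ℕ → ℤ) :
    wsw j (wsw (j + 1) (wsw j w)) = wsw (j + 1) (wsw j (wsw (j + 1) w)) := by
  funext k
  simp only [wsw, Equiv.swap_apply_def]
  congr 1
  split_ifs <;> omega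

/-- coefficient data -/
structure HData where
  d : ℤ → ℝ
  β : ℤ → ℝ
  κ : ℝ
  hκ : ∀ r, r ≠ 0 → d r + d (-r) = κ
  three : ∀ r s, r ≠ 0 → s ≠ 0 → r + s ≠ 0 →
    d r * d s + d (r + s) * d (-r) = d s * d (r + s)
  βsq : ∀ r, r ≠ 0 → β r * β r = 1 + d r * d (-r)
  βneg : ∀ r, β (-r) = β r

/-- the operator -/
def opT (d β : ℤ → ℝ) (j : ℕ) (F : (ℕ → ℤ) → ℝ) : (ℕ → ℤ) → ℝ := fun w =>
  d (w (j + 1) - w j) * F w + β (w (j + 1) - w j) * F (wsw j w)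

lemma opT_braid (D : HData) (j : ℕ) (F : (ℕ → ℤ) → ℝ) (w : ℕ → ℤ)
    (h1 : w j ≠ w (j + 1)) (h2 : w (j + 1) ≠ w (j + 2)) (h3 : w j ≠ w (j + 2)) :
    opT D.d D.β j (opT D.d D.β (j + 1) (opT D.d D.β j F)) w =
    opT D.d D.β (j + 1) (opT D.d D.β j (opT D.d D.β (j + 1) F)) w := by
  have o1 : ∀ v : ℕ → ℤ, wsw j v (j + 1 + 1) = v (j + 1 + 1) := fun v => wsw_other v (by omega) (by omega)
  have o2 : ∀ v : ℕ → ℤ, wsw (j + 1) v j = v j := fun v => wsw_other v (by omega) (by omega)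
  simp only [opT, wsw_left, wsw_right, wsw_wsw, o1, o2, wsw_braid]
  set a := w j
  set b := w (j + 1)
  have e : w (j + 2) = w (j + 1 + 1) := rfl
  rw [e] at h2 h3
  set c := w (j + 1 + 1)
  have n1 : b - a ≠ 0 := by omega
  have n2 : c - b ≠ 0 := by omega
  have n3 : c - a ≠ 0 := by omega
  have k1 := D.hκ (b - a) n1
  have k2 := D.hκ (c - b) n2
  have b1 := D.βsq (b - a) n1
  have b2 := D.βsq (c - b) n2
  have t1 := D.three (b - a) (c - b) n1 n2 (by omega)
  have m1 := D.βneg (b - a)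
  have m2 := D.βneg (c - b)
  have e1 : b - a + (c - b) = c - a := by ring
  have e2 : -(b - a) = a - b := by ring
  have e3 : -(c - b) = b - c := by ring
  rw [e1] at t1
  rw [e2] at k1 b1 t1 m1
  rw [e3] at k2 b2 m2
  have t2 : D.d (b - a) * D.d (c - b) + D.d (c - a) * D.d (b - c) = D.d (b - a) * D.d (c - a) := by
    linear_combination t1 + D.d (c - a) * (k2 - k1)
  rw [m1, m2]
  linear_combination (D.d (b - a) * t1 + D.d (c - a) * b1 - D.d (c - b) * t2
    - D.d (c - a) * b2) * F w + (D.β (b - a)) * t1 * F (wsw j w) - D.β (c - b) * t2 * F (wsw (j + 1) w)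

lemma opT_quad (D : HData) (j : ℕ) (F : (ℕ → ℤ) → ℝ) (w : ℕ → ℤ) (h1 : w j ≠ w (j + 1)) :
    opT D.d D.β j (opT D.d D.β j F) w = D.κ * opT D.d D.β j F w + F w := by
  simp only [opT, wsw_left, wsw_right, wsw_wsw]
  have n1 : w (j + 1) - w j ≠ 0 := by omega
  have k1 := D.hκ _ n1
  have b1 := D.βsq _ n1
  have m1 := D.βneg (w (j + 1) - w j)
  have e2 : -(w (j + 1) - w j) = w j - w (j + 1) := by ring
  rw [e2] at k1 b1 m1
  rw [m1, ← k1]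
  linear_combination b1 * F w

lemma opT_comm {d β : ℤ → ℝ} {i j : ℕ} (h : i + 2 ≤ j) (F : (ℕ → ℤ) → ℝ) :
    opT d β i (opT d β j F) = opT d β j (opT d β i F) := by
  funext w
  have o1 : ∀ v : ℕ → ℤ, wsw i v j = v j := fun v => wsw_other v (by omega) (by omega)
  have o2 : ∀ v : ℕ → ℤ, wsw i v (j + 1) = v (j + 1) := fun v => wsw_other v (by omega) (by omega)
  have o3 : ∀ v : ℕ → ℤ, wsw j v i = v i := fun v => wsw_other v (by omega) (by omega)
  have o4 : ∀ v : ℕ → ℤ, wsw j v (i + 1) = v (i + 1) := fun v => wsw_other v (by omega) (by omega)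
  simp only [opT, o1, o2, o3, o4, wsw_comm h]
  ring

/-- closed sets of words -/
structure WSet (N : ℕ) (W : Set (ℕ → ℤ)) : Prop where
  ne : ∀ w ∈ W, ∀ j, j + 1 < N → w j ≠ w (j + 1)
  ne2 : ∀ w ∈ W, ∀ j, j + 2 < N → w j ≠ w (j + 2)
  closed : ∀ w ∈ W, ∀ j, j + 1 < N → Far (w j) (w (j + 1)) → wsw j w ∈ W

/-- extension by zero -/
noncomputable def ext0 (W : Set (ℕ → ℤ)) (F : W → ℝ) : (ℕ → ℤ) → ℝ :=
  open Classical in fun w => if h : w ∈ W then F ⟨w, h⟩ else 0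

lemma ext0_mem {W : Set (ℕ → ℤ)} (F : W → ℝ) (w : W) : ext0 W F w = F w := by
  simp [ext0]

lemma opT_local {N : ℕ} {W : Set (ℕ → ℤ)} (hW : WSet N W) {d β : ℤ → ℝ}
    (h1 : β 1 = 0) (h2 : β (-1) = 0) {j : ℕ} (hj : j + 1 < N)
    {F G : (ℕ → ℤ) → ℝ} (h : ∀ w ∈ W, F w = G w) : ∀ w ∈ W, opT d β j F w = opT d β j G w := by
  intro w hw
  simp only [opT]
  rw [h w hw]
  by_cases hf : Far (w j) (w (j + 1))
  · rw [h _ (hW.closed w hw j hj hf)]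
  · have hne := hW.ne w hw j hj
    have : w (j + 1) - w j = 1 ∨ w (j + 1) - w j = -1 := by unfold Far at hf; omega
    have hb : β (w (j + 1) - w j) = 0 := by rcases this with h | h <;> rw [h] <;> assumption
    rw [hb]; ring

/-- the operator on functions on `W` -/
noncomputable def rT (W : Set (ℕ → ℤ)) (d β : ℤ → ℝ) (j : ℕ) : Module.End ℝ (W → ℝ) where
  toFun F := fun w => opT d β j (ext0 W F) w
  map_add' F G := by
    funext w
    simp only [opT, Pi.add_apply, ext0]
    split_ifs <;> simp <;> ring
  map_smul' c F := by
    funext w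
    simp only [opT, Pi.smul_apply, ext0, smul_eq_mul, RingHom.id_apply]
    split_ifs <;> simp <;> ring

lemma rT_apply (W : Set (ℕ → ℤ)) (d β : ℤ → ℝ) (j : ℕ) (F : W → ℝ) (w : W) :
    rT W d β j F w = opT d β j (ext0 W F) w := rfl

/-- Action of a list of operators on all functions. -/
def opTL (d β : ℤ → ℝ) : List ℕ → ((ℕ → ℤ) → ℝ) → ((ℕ → ℤ) → ℝ)
  | [], F => F
  | j :: l, F => opT d β j (opTL d β l F)

lemma rT_list {N : ℕ} {W : Set (ℕ → ℤ)} (hW : WSet N W) {d β : ℤ → ℝ}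
    (h1 : β 1 = 0) (h2 : β (-1) = 0) (l : List ℕ) (hl : ∀ j ∈ l, j + 1 < N) (F : W → ℝ) (w : W) :
    (l.map (rT W d β)).prod F w = opTL d β l (ext0 W F) w := by
  induction l generalizing w with
  | nil => simp [opTL, ext0_mem]
  | cons j l ih =>
    rw [List.map_cons, List.prod_cons, Module.End.mul_apply, rT_apply, opTL]
    refine opT_local hW h1 h2 (hl j (by simp)) ?_ w w.2
    intro v hv
    rw [← ih (fun i hi => hl i (by simp [hi])) ⟨v, hv⟩]
    exact ext0_mem _ ⟨v, hv⟩

lemma rT_braidRel {N : ℕ} {W : Set (ℕ → ℤ)} (hW : WSet N W) (D : HData)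
    (h1 : D.β 1 = 0) : BraidRel (rT W D.d D.β) (N - 1) := by
  have h2 : D.β (-1) = 0 := by rw [D.βneg, h1]
  constructor
  · intro i hi
    refine LinearMap.ext fun F => funext fun w => ?_
    have e1 := rT_list hW (d := D.d) h1 h2 [i, i + 1, i] (by simp; omega) F w
    have e2 := rT_list hW (d := D.d) h1 h2 [i + 1, i, i + 1] (by simp; omega) F w
    simp only [List.map_cons, List.map_nil, List.prod_cons, List.prod_nil, mul_one] at e1 e2
    rw [mul_assoc, mul_assoc, e1, e2]
    exact opT_braid D i _ w (hW.ne w w.2 i (by omega)) (hW.ne w w.2 (i + 1) (by omega))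
      (hW.ne2 w w.2 i (by omega))
  · intro i j hi hj hij
    refine LinearMap.ext fun F => funext fun w => ?_
    have e1 := rT_list hW (d := D.d) h1 h2 [i, j] (by simp; omega) F w
    have e2 := rT_list hW (d := D.d) h1 h2 [j, i] (by simp; omega) F w
    simp only [List.map_cons, List.map_nil, List.prod_cons, List.prod_nil, mul_one] at e1 e2
    rw [e1, e2]
    simp only [opTL]
    rw [opT_comm hij]

lemma rT_sq {N : ℕ} {W : Set (ℕ → ℤ)} (hW : WSet N W) (D : HData)
    (h1 : D.β 1 = 0) (hκ : D.κ = 0) {j : ℕ} (hj : j + 1 < N) :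
    rT W D.d D.β j * rT W D.d D.β j = 1 := by
  have h2 : D.β (-1) = 0 := by rw [D.βneg, h1]
  refine LinearMap.ext fun F => funext fun w => ?_
  have e1 := rT_list hW (d := D.d) h1 h2 [j, j] (by simp; omega) F w
  simp only [List.map_cons, List.map_nil, List.prod_cons, List.prod_nil, mul_one] at e1
  rw [e1]
  simp only [opTL]
  rw [opT_quad D j _ w (hW.ne w w.2 j hj), hκ, ext0_mem]
  simp

/-- the coefficient `1/[r]_q` -/
noncomputable def aq (q : ℝ) (r : ℤ) : ℝ :=
  (r.sign : ℝ) * q ^ (r.natAbs - 1) / ∑ i ∈ Finset.range r.natAbs, q ^ (2 * i)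

/-- off diagonal coefficient -/
noncomputable def bq (q : ℝ) (r : ℤ) : ℝ := Real.sqrt (1 - aq q r ^ 2)

lemma aq_den_pos (q : ℝ) {m : ℕ} (hm : m ≠ 0) : 1 ≤ ∑ i ∈ Finset.range m, q ^ (2 * i) := by
  obtain ⟨k, rfl⟩ := Nat.exists_eq_succ_of_ne_zero hm
  rw [Nat.succ_eq_add_one, Finset.sum_range_succ']
  have : 0 ≤ ∑ i ∈ Finset.range k, q ^ (2 * (i + 1)) :=
    Finset.sum_nonneg fun i _ => by rw [pow_mul]; positivity
  simp; linarith

lemma aq_continuous (r : ℤ) : Continuous (fun q => aq q r) := by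
  unfold aq
  by_cases h : r.natAbs = 0
  · have : r = 0 := by omega
    subst this; simp; exact continuous_const
  · refine Continuous.div (by fun_prop) (by fun_prop) fun q => ?_
    have := aq_den_pos q h
    linarith

lemma bq_continuous (r : ℤ) : Continuous (fun q => bq q r) := by
  unfold bq
  have := aq_continuous r
  fun_prop

lemma aq_neg (q : ℝ) (r : ℤ) : aq q (-r) = - aq q r := by
  simp [aq, Int.sign_neg]; ring

lemma bq_neg (q : ℝ) (r : ℤ) : bq q (-r) = bq q r := by
  simp [bq, aq_neg]

lemma aq_sq_le {q : ℝ} (h0 : 0 ≤ q) (h1 : q ≤ 1) (r : ℤ) : aq q r ^ 2 ≤ 1 := by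
  by_cases h : r.natAbs = 0
  · have : r = 0 := by omega
    subst this; simp [aq]
  · have h2 := aq_den_pos q h
    rw [sq_le_one_iff_abs_le_one, aq, abs_div, abs_mul, abs_of_pos (by linarith : 0 < ∑ i ∈ Finset.range r.natAbs, q ^ (2 * i)),
      div_le_one (by linarith)]
    refine le_trans ?_ h2
    have h3 : |((r.sign : ℤ) : ℝ)| ≤ 1 := by
      rcases Int.sign_trichotomy r with h | h | h <;> simp [h]
    have h4 : |q ^ (r.natAbs - 1)| ≤ 1 := by
      rw [abs_of_nonneg (by positivity)]; exact pow_le_one₀ h0 h1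
    calc _ ≤ (1 : ℝ) * 1 := mul_le_mul h3 h4 (abs_nonneg _) (by norm_num)
      _ = 1 := by norm_num

lemma bq_sq {q : ℝ} (h0 : 0 ≤ q) (h1 : q ≤ 1) (r : ℤ) : bq q r * bq q r = 1 - aq q r ^ 2 := by
  rw [bq, Real.mul_self_sqrt]; linarith [aq_sq_le h0 h1 r]

lemma aq_one (q : ℝ) : aq q 1 = 1 := by simp [aq]
lemma bq_one (q : ℝ) : bq q 1 = 0 := by simp [bq, aq_one]
lemma bq_neg_one (q : ℝ) : bq q (-1) = 0 := by rw [bq_neg, bq_one]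

lemma aq_at_one (r : ℤ) : aq 1 r = 1 / (r : ℝ) := by
  simp only [aq, one_pow, mul_one, Finset.sum_const, Finset.card_range, nsmul_eq_mul]
  rcases lt_trichotomy r 0 with h | rfl | h
  · rw [Int.sign_eq_neg_one_of_neg h]
    have : ((r.natAbs : ℕ) : ℝ) = -(r : ℝ) := by
      have : ((r.natAbs : ℕ) : ℤ) = -r := by omega
      rw [← Int.cast_natCast, this]; push_cast; rfl
    rw [this]; push_cast
    rw [div_neg, neg_div, neg_neg]
  · simp
  · rw [Int.sign_eq_one_of_pos h]
    have : ((r.natAbs : ℕ) : ℝ) = (r : ℝ) := by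
      have : ((r.natAbs : ℕ) : ℤ) = r := by omega
      rw [← Int.cast_natCast, this]
    rw [this]; simp

lemma aq_at_zero_far {r : ℤ} (h : 2 ≤ r ∨ r ≤ -2) : aq 0 r = 0 := by
  have : r.natAbs - 1 ≠ 0 := by omega
  simp [aq, this]

lemma bq_at_zero_far {r : ℤ} (h : 2 ≤ r ∨ r ≤ -2) : bq 0 r = 1 := by
  simp [bq, aq_at_zero_far h]

lemma aq_formula_pos {q : ℝ} (h0 : 0 < q) (h1 : q < 1) {m : ℕ} (hm : m ≠ 0) :
    aq q m * (1 - q ^ (2 * m)) = q ^ (m - 1) * (1 - q ^ 2) := by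
  have hs := aq_den_pos q hm
  have hg : (∑ i ∈ Finset.range m, q ^ (2 * i)) * (1 - q ^ 2) = 1 - q ^ (2 * m) := by
    have := geom_sum_mul_neg (q ^ 2) m
    simp only [← pow_mul] at this
    exact this
  have hsg : (m : ℤ).sign = 1 := Int.sign_eq_one_of_pos (by omega)
  rw [aq, hsg, ← hg, Int.natAbs_natCast]
  push_cast
  have : (∑ i ∈ Finset.range m, q ^ (2 * i)) ≠ 0 := by linarith
  field_simp

/-- diagonal coefficient of the Hecke generator -/
noncomputable def dq (q : ℝ) (r : ℤ) : ℝ := aq q r * q ^ (-r)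

lemma one_sub_zpow_ne {q : ℝ} (h0 : 0 < q) (h1 : q < 1) {r : ℤ} (hr : r ≠ 0) : 1 - q ^ (2 * r) ≠ 0 := by
  intro h
  have : q ^ (2 * r) = 1 := by linarith
  rw [zpow_eq_one_iff_right₀ h0.le h1.ne] at this
  omega

lemma dq_formula {q : ℝ} (h0 : 0 < q) (h1 : q < 1) {r : ℤ} (hr : r ≠ 0) :
    dq q r = (q⁻¹ - q) / (1 - q ^ (2 * r)) := by
  have hq : q ≠ 0 := h0.ne'
  have key : ∀ m : ℕ, m ≠ 0 → aq q m = q ^ (m : ℤ) * (q⁻¹ - q) / (1 - q ^ (2 * (m : ℤ))) := by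
    intro m hm
    have := aq_formula_pos h0 h1 hm
    have hne := one_sub_zpow_ne h0 h1 (r := m) (by omega)
    rw [eq_div_iff hne]
    have e : q ^ (2 * (m : ℤ)) = q ^ (2 * m) := by
      rw [← zpow_natCast]; push_cast; rfl
    rw [e, this]
    obtain ⟨k, rfl⟩ := Nat.exists_eq_succ_of_ne_zero hm
    rw [zpow_natCast, Nat.succ_eq_add_one, Nat.add_sub_cancel, pow_succ]
    field_simp
    ring
  rw [dq]
  rcases lt_or_gt_of_ne hr with h | h
  · obtain ⟨m, rfl⟩ : ∃ m : ℕ, r = -(m : ℤ) := ⟨r.natAbs, by omega⟩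
    rw [aq_neg, key m (by omega), neg_neg]
    have hne := one_sub_zpow_ne h0 h1 (r := m) (by omega)
    have hne' := one_sub_zpow_ne h0 h1 (r := -(m : ℤ)) hr
    have e : (2 * -(m : ℤ)) = -(2 * m) := by ring
    rw [e] at hne' ⊢
    have e2 : q ^ (2 * (m : ℤ)) = q ^ (m : ℤ) * q ^ (m : ℤ) := by rw [two_mul, zpow_add₀ hq]
    rw [zpow_neg] at hne' ⊢
    rw [e2] at hne hne' ⊢
    have hz : q ^ (m : ℤ) ≠ 0 := zpow_ne_zero _ hq
    generalize q ^ (m : ℤ) = Z at *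
    have h3 : Z * Z - 1 ≠ 0 := fun h => hne (by linarith)
    have h4 : 1 - (Z * Z)⁻¹ = (Z * Z - 1) / (Z * Z) := by field_simp
    rw [h4]
    have h5 : 1 - Z * Z = -(Z * Z - 1) := by ring
    rw [h5]
    field_simp
  · obtain ⟨m, rfl⟩ : ∃ m : ℕ, r = (m : ℤ) := ⟨r.natAbs, by omega⟩
    rw [key m (by omega), zpow_neg]
    have hz : q ^ (m : ℤ) ≠ 0 := zpow_ne_zero _ hq
    field_simp

/-- The Hecke data for `0 < q < 1`. -/
noncomputable def hdq {q : ℝ} (h0 : 0 < q) (h1 : q < 1) : HData where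
  d := dq q
  β := bq q
  κ := q⁻¹ - q
  hκ r hr := by
    have hr' : -r ≠ 0 := by omega
    rw [dq_formula h0 h1 hr, dq_formula h0 h1 hr']
    have n1 := one_sub_zpow_ne h0 h1 hr
    have n2 := one_sub_zpow_ne h0 h1 hr'
    have e : 2 * -r = -(2 * r) := by ring
    rw [e, zpow_neg] at n2 ⊢
    have hz : q ^ (2 * r) ≠ 0 := zpow_ne_zero _ h0.ne'
    generalize q ^ (2 * r) = Z at *
    have h3 : Z - 1 ≠ 0 := fun h => n1 (by linarith)
    have h4 : 1 - Z⁻¹ = (Z - 1) / Z := by field_simp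
    rw [h4]
    have h5 : 1 - Z = -(Z - 1) := by ring
    rw [h5]
    generalize q⁻¹ - q = k
    field_simp
    ring
  three r s hr hs hrs := by
    have hr' : -r ≠ 0 := by omega
    rw [dq_formula h0 h1 hr, dq_formula h0 h1 hr', dq_formula h0 h1 hs, dq_formula h0 h1 hrs]
    have n1 := one_sub_zpow_ne h0 h1 hr
    have n2 := one_sub_zpow_ne h0 h1 hr'
    have n3 := one_sub_zpow_ne h0 h1 hs
    have n4 := one_sub_zpow_ne h0 h1 hrs
    have e : 2 * -r = -(2 * r) := by ring
    have e2 : 2 * (r + s) = 2 * r + 2 * s := by ring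
    rw [e, zpow_neg] at n2 ⊢
    rw [e2, zpow_add₀ h0.ne'] at n4 ⊢
    have hz : q ^ (2 * r) ≠ 0 := zpow_ne_zero _ h0.ne'
    generalize q ^ (2 * r) = Z at *
    generalize q ^ (2 * s) = Y at *
    have h3 : Z - 1 ≠ 0 := fun h => n1 (by linarith)
    have h4 : 1 - Z⁻¹ = (Z - 1) / Z := by field_simp
    rw [h4]
    have h5 : 1 - Z = -(Z - 1) := by ring
    rw [h5]
    generalize q⁻¹ - q = k
    field_simp
    ring
  βsq r hr := by
    rw [bq_sq h0.le h1.le, dq, dq, aq_neg, neg_neg]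
    have : q ^ (-r) * q ^ r = 1 := by rw [← zpow_add₀ h0.ne']; simp
    linear_combination aq q r ^ 2 * this
  βneg r := bq_neg q r

/-- The data at `q = 1`. -/
noncomputable def hd1 : HData where
  d := aq 1
  β := bq 1
  κ := 0
  hκ r hr := by rw [aq_neg]; ring
  three r s hr hs hrs := by
    simp only [aq_at_one]
    have a1 : (r : ℝ) ≠ 0 := by exact_mod_cast hr
    have a2 : (s : ℝ) ≠ 0 := by exact_mod_cast hs
    have a3 : (r : ℝ) + s ≠ 0 := by exact_mod_cast hrs
    push_cast
    field_simp
    ring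
  βsq r hr := by rw [bq_sq (by norm_num) le_rfl, aq_neg]; ring
  βneg r := bq_neg 1 r

/-- multiplication operator -/
def dg (W : Set (ℕ → ℤ)) (g : (ℕ → ℤ) → ℝ) : Module.End ℝ (W → ℝ) where
  toFun F := fun w => g w * F w
  map_add' F G := by funext w; simp; ring
  map_smul' c F := by funext w; simp; ring

lemma dg_apply (W : Set (ℕ → ℤ)) (g : (ℕ → ℤ) → ℝ) (F : W → ℝ) (w : W) :
    dg W g F w = g w * F w := rfl

lemma dg_mul (W : Set (ℕ → ℤ)) (g h : (ℕ → ℤ) → ℝ) : dg W g * dg W h = dg W (fun w => g w * h w) := by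
  refine LinearMap.ext fun F => funext fun w => ?_
  simp only [Module.End.mul_apply, dg_apply]; ring

lemma dg_const {W : Set (ℕ → ℤ)} {g : (ℕ → ℤ) → ℝ} {c : ℝ} (h : ∀ w ∈ W, g w = c) :
    dg W g = c • 1 := by
  refine LinearMap.ext fun F => funext fun w => ?_
  simp [dg_apply, h w w.2]

section
variable {N : ℕ} {W : Set (ℕ → ℤ)} {q : ℝ}

/-- `q^{w_j}` -/
noncomputable def yo (W : Set (ℕ → ℤ)) (q : ℝ) (j : ℕ) : Module.End ℝ (W → ℝ) := dg W (fun w => q ^ (w j))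
/-- `q^{-w_j}` -/
noncomputable def yi (W : Set (ℕ → ℤ)) (q : ℝ) (j : ℕ) : Module.End ℝ (W → ℝ) := dg W (fun w => q ^ (-w j))

lemma yo_yi (h0 : 0 < q) (j : ℕ) : yo W q j * yi W q j = 1 := by
  rw [yo, yi, dg_mul, dg_const (c := 1), one_smul]
  intro w _; rw [← zpow_add₀ h0.ne']; simp

lemma yi_yo (h0 : 0 < q) (j : ℕ) : yi W q j * yo W q j = 1 := by
  rw [yo, yi, dg_mul, dg_const (c := 1), one_smul]
  intro w _; rw [← zpow_add₀ h0.ne']; simp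

lemma T_eq1 (h0 : 0 < q) (j : ℕ) :
    rT W (dq q) (bq q) j = yo W q j * rT W (aq q) (bq q) j * yi W q (j + 1) := by
  refine LinearMap.ext fun F => funext fun w => ?_
  simp only [Module.End.mul_apply, yo, yi, dg_apply, rT_apply, opT]
  have e1 : ext0 W (dg W (fun w => q ^ (-w (j + 1))) F) w = q ^ (-w.1 (j + 1)) * ext0 W F w := by
    rw [ext0_mem, ext0_mem, dg_apply]
  have e2 : ext0 W (dg W (fun w => q ^ (-w (j + 1))) F) (wsw j w) = q ^ (-w.1 j) * ext0 W F (wsw j w) := by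
    unfold ext0
    split_ifs
    · rw [dg_apply]; simp [wsw_right]
    · simp
  rw [e1, e2, dq]
  have f1 : q ^ (-(w.1 (j + 1) - w.1 j)) = q ^ (w.1 j) * q ^ (-w.1 (j + 1)) := by
    rw [← zpow_add₀ h0.ne']; congr 1; ring
  have f2 : q ^ (w.1 j) * q ^ (-w.1 j) = 1 := by
    rw [← zpow_add₀ h0.ne']; simp
  rw [f1]
  linear_combination - bq q (w.1 (j + 1) - w.1 j) * ext0 W F (wsw j w) * f2

lemma T_eq2 (h0 : 0 < q) (j : ℕ) :
    rT W (dq q) (bq q) j = yi W q (j + 1) * rT W (aq q) (bq q) j * yo W q j := by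
  refine LinearMap.ext fun F => funext fun w => ?_
  simp only [Module.End.mul_apply, yo, yi, dg_apply, rT_apply, opT]
  have e1 : ext0 W (dg W (fun w => q ^ (w j)) F) w = q ^ (w.1 j) * ext0 W F w := by
    rw [ext0_mem, ext0_mem, dg_apply]
  have e2 : ext0 W (dg W (fun w => q ^ (w j)) F) (wsw j w) = q ^ (w.1 (j + 1)) * ext0 W F (wsw j w) := by
    unfold ext0
    split_ifs
    · rw [dg_apply]; simp [wsw_left]
    · simp
  rw [e1, e2, dq]
  have f1 : q ^ (-(w.1 (j + 1) - w.1 j)) = q ^ (w.1 j) * q ^ (-w.1 (j + 1)) := by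
    rw [← zpow_add₀ h0.ne']; congr 1; ring
  have f2 : q ^ (-w.1 (j + 1)) * q ^ (w.1 (j + 1)) = 1 := by
    rw [← zpow_add₀ h0.ne']; simp
  rw [f1]
  linear_combination - bq q (w.1 (j + 1) - w.1 j) * ext0 W F (wsw j w) * f2

lemma t_sq (hW : WSet N W) (h0 : 0 < q) (h1 : q < 1) {j : ℕ} (hj : j + 1 < N) : rT W (aq q) (bq q) j * rT W (aq q) (bq q) j = 1 := by
  refine LinearMap.ext fun F => funext fun w => ?_
  have e1 := rT_list hW (d := aq q) (bq_one q) (bq_neg_one q) [j, j] (by simp; omega) F w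
  simp only [List.map_cons, List.map_nil, List.prod_cons, List.prod_nil, mul_one] at e1
  rw [e1]
  simp only [opTL, opT, wsw_left, wsw_right, wsw_wsw, Module.End.one_apply]
  have e2 : w.1 j - w.1 (j + 1) = -(w.1 (j + 1) - w.1 j) := by ring
  rw [e2, aq_neg, bq_neg, ext0_mem]
  linear_combination bq_sq h0.le h1.le (w.1 (j + 1) - w.1 j) * F w

lemma upP_T (h0 : 0 < q) (l : ℕ) : upP (rT W (dq q) (bq q)) 0 l =
    yo W q 0 * upP (rT W (aq q) (bq q)) 0 l * yi W q l := by
  induction l with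
  | zero => simp [upP, yo_yi h0]
  | succ l ih =>
    rw [upP, upP, ih, zero_add, T_eq1 h0 l]
    have := yi_yo (W := W) h0 l
    calc _ = yo W q 0 * upP (rT W (aq q) (bq q)) 0 l * (yi W q l * yo W q l)
        * rT W (aq q) (bq q) l * yi W q (l + 1) := by noncomm_ring
      _ = _ := by rw [this]; noncomm_ring

lemma jmL_T (hW : WSet N W) (h0 : 0 < q) (h1 : q < 1) {c : ℤ} (hc : ∀ w ∈ W, w 0 = c) (j : ℕ) (hj : j < N) : jmL (rT W (dq q) (bq q)) j =
    q ^ (2 * c) • (yi W q j * yi W q j) := by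
  induction j with
  | zero =>
    rw [jmL, yi, dg_mul, dg_const (c := q ^ (-(2 * c))), smul_smul, ← zpow_add₀ h0.ne']
    · simp
    · intro w hw
      rw [hc w hw, ← zpow_add₀ h0.ne']; congr 1; ring
  | succ j ih =>
    rw [jmL, ih (by omega)]
    nth_rewrite 1 [T_eq2 h0 j]
    rw [T_eq1 h0 j, mul_smul_comm, smul_mul_assoc]
    congr 1
    calc _ = yi W q (j + 1) * rT W (aq q) (bq q) j * (yo W q j * yi W q j) * (yi W q j * yo W q j) *
          rT W (aq q) (bq q) j * yi W q (j + 1) := by noncomm_ring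
      _ = yi W q (j + 1) * (rT W (aq q) (bq q) j * rT W (aq q) (bq q) j) * yi W q (j + 1) := by
          rw [yo_yi h0, yi_yo h0]; noncomm_ring
      _ = _ := by rw [t_sq hW h0 h1 hj]; noncomm_ring

lemma jm_prod (h0 : 0 < q) (c : ℤ) (m : ℕ) :
    ((List.range m).map (fun j => q ^ (2 * c) • (yi W q j * yi W q j))).prod =
    dg W (fun w => q ^ (2 * c * m - 2 * ∑ j ∈ Finset.range m, w j)) := by
  induction m with
  | zero => simp only [List.range_zero, List.map_nil, List.prod_nil]
            rw [dg_const (c := 1)]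
            · simp
            · simp
  | succ m ih =>
    rw [List.range_succ, List.map_append, List.prod_append, ih]
    simp only [List.map_cons, List.map_nil, List.prod_cons, List.prod_nil, mul_one]
    rw [mul_smul_comm, yi, dg_mul, dg_mul]
    refine LinearMap.ext fun F => funext fun w => ?_
    simp only [LinearMap.smul_apply, Pi.smul_apply, dg_apply, smul_eq_mul]
    rw [← mul_assoc, ← zpow_add₀ h0.ne', ← zpow_add₀ h0.ne', ← zpow_add₀ h0.ne']
    congr 2
    rw [Finset.sum_range_succ]; push_cast; ring

end

/-- Periodicity of the deformed promotion operator. -/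
theorem promo_period {l : ℕ} {W : Set (ℕ → ℤ)} (hW : WSet (l + 1) W) {q : ℝ} (h0 : 0 < q) (h1 : q < 1)
    {c : ℤ} (hc : ∀ w ∈ W, w 0 = c) (hc' : ∀ w ∈ W, w l = c)
    (hs : ∀ w ∈ W, ∑ j ∈ Finset.range (l + 1), w j = c * (l + 1)) :
    (upP (rT W (aq q) (bq q)) 0 l) ^ (l + 1) = 1 := by
  have hb := rT_braidRel hW (hdq h0 h1) (bq_one q)
  have ft := full_twist hb l (by simp)
  have e : (List.range (l + 1)).map (jmL (rT W (hdq h0 h1).d (hdq h0 h1).β)) =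
      (List.range (l + 1)).map (fun j => q ^ (2 * c) • (yi W q j * yi W q j)) := by
    apply List.map_congr_left
    intro j hj
    exact jmL_T hW h0 h1 hc j (List.mem_range.1 hj)
  rw [e, jm_prod h0] at ft
  have e2 : upP (rT W (hdq h0 h1).d (hdq h0 h1).β) 0 l = upP (rT W (aq q) (bq q)) 0 l := by
    have := upP_T (W := W) h0 l
    have a1 : yo W q 0 = q ^ c • 1 := dg_const (fun w hw => by rw [hc w hw])
    have a2 : yi W q l = q ^ (-c) • 1 := dg_const (fun w hw => by rw [hc' w hw])
    rw [a1, a2] at this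
    refine this.trans ?_
    rw [smul_mul_assoc, mul_smul_comm, smul_mul_assoc, smul_smul, ← zpow_add₀ h0.ne']
    simp
  rw [e2] at ft
  rw [ft, dg_const (c := 1), one_smul]
  intro w hw
  rw [hs w hw]
  have : 2 * c * ((l + 1 : ℕ) : ℤ) - 2 * (c * (l + 1)) = 0 := by push_cast; ring
  rw [this, zpow_zero]

/-! Constancy of traces -/

lemma trace_mem_finite (ι : Type*) [Fintype ι] [DecidableEq ι] (N : ℕ) (hN : N ≠ 0) :
    {x : ℝ | ∃ M : Matrix ι ι ℝ, M ^ N = 1 ∧ M.trace = x}.Finite := by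
  classical
  set R : Set ℂ := {z | z ^ N = 1} with hR
  have hRf : R.Finite := by
    have : R = ↑((Polynomial.nthRoots N (1:ℂ)).toFinset) := by
      ext z
      simp [hR, Polynomial.mem_nthRoots (Nat.pos_of_ne_zero hN)]
    rw [this]; exact Finset.finite_toSet _
  have : Finite R := hRf
  have hfin : (Set.range (fun f : Fin (Fintype.card ι) → R => ∑ i, (f i : ℂ))).Finite :=
    Set.finite_range _
  refine (hfin.image Complex.re).subset ?_
  rintro x ⟨M, hM, rfl⟩
  set MC : Matrix ι ι ℂ := M.map (algebraMap ℝ ℂ) with hMC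
  have hMCN : MC ^ N = 1 := by
    have e1 := map_pow ((algebraMap ℝ ℂ).mapMatrix (m := ι)) M N
    simp only [RingHom.mapMatrix_apply] at e1
    rw [hMC, ← e1, hM]
    simp
  have htr : MC.trace = (M.trace : ℂ) := by
    simp [hMC, Matrix.trace, Matrix.diag]
  have hroots := Matrix.trace_eq_sum_roots_charpoly MC
  have hmem : ∀ z ∈ MC.charpoly.roots, z ∈ R := by
    intro z hz
    have h1 : MC.charpoly.IsRoot z := (Polynomial.mem_roots'.1 hz).2
    have h2 := Matrix.mem_spectrum_of_isRoot_charpoly h1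
    have h3 := spectrum.pow_mem_pow (a := MC) N h2
    rw [hMCN] at h3
    rw [hR, Set.mem_ofPred_eq]
    by_contra hne
    rw [spectrum.mem_iff] at h3
    apply h3
    have : (algebraMap ℂ (Matrix ι ι ℂ)) (z ^ N) - 1 = algebraMap ℂ (Matrix ι ι ℂ) (z ^ N - 1) := by simp
    rw [this]
    exact (IsUnit.mk0 _ (sub_ne_zero.2 hne)).map _
  have hcard : MC.charpoly.roots.card = Fintype.card ι := by
    rw [← Matrix.charpoly_natDegree_eq_dim MC]
    exact IsAlgClosed.card_roots_eq_natDegree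
  refine ⟨M.trace, ?_, by simp⟩
  rw [← htr, hroots]
  set l := MC.charpoly.roots.toList with hl
  have hlen : l.length = Fintype.card ι := by rw [hl, Multiset.length_toList, hcard]
  refine ⟨fun i => ⟨l.get (i.cast hlen.symm), hmem _ (by rw [← Multiset.mem_toList]; exact List.get_mem _ _)⟩, ?_⟩
  simp only
  rw [← Multiset.coe_toList MC.charpoly.roots, ← hl, Multiset.sum_coe]
  have : ∑ i : Fin l.length, l.get i = l.sum := by simp
  rw [← this]
  exact Fintype.sum_equiv (finCongr hlen.symm) _ _ (fun i => rfl)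

lemma pow_eq_one_closure {ι : Type*} [Fintype ι] [DecidableEq ι] {N : ℕ}
    {M : ℝ → Matrix ι ι ℝ} (hc : Continuous M) (h : ∀ q, 0 < q → q < 1 → M q ^ N = 1) :
    ∀ q ∈ Set.Icc (0:ℝ) 1, M q ^ N = 1 := by
  have hcl : IsClosed {q | M q ^ N = 1} := isClosed_eq (hc.pow N) continuous_const
  have : closure (Set.Ioo (0:ℝ) 1) ⊆ {q | M q ^ N = 1} :=
    hcl.closure_subset_iff.2 (fun q hq => h q hq.1 hq.2)
  rw [closure_Ioo (by norm_num)] at this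
  exact this

lemma trace_const {ι : Type*} [Fintype ι] [DecidableEq ι] {N : ℕ} (hN : N ≠ 0)
    {M : ℝ → Matrix ι ι ℝ} (hc : Continuous M) (h : ∀ q ∈ Set.Icc (0:ℝ) 1, M q ^ N = 1) :
    (M 0).trace = (M 1).trace := by
  have hf := trace_mem_finite ι N hN
  exact isPreconnected_Icc.constant_of_mapsTo hf.isDiscrete
    (f := fun q => (M q).trace) (S := Set.Icc (0:ℝ) 1) (hc.matrix_trace.continuousOn)
    (fun q hq => ⟨M q, h q hq, rfl⟩) (by simp) (by simp)

section
variable {W : Set (ℕ → ℤ)} [Fintype W] [DecidableEq W]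

lemma rT_continuous (j : ℕ) :
    Continuous (fun q => LinearMap.toMatrix' (rT W (aq q) (bq q) j)) := by
  refine continuous_matrix fun a b => ?_
  simp only [LinearMap.toMatrix'_apply, rT_apply, opT]
  have := aq_continuous ((a : ℕ → ℤ) (j + 1) - (a : ℕ → ℤ) j)
  have := bq_continuous ((a : ℕ → ℤ) (j + 1) - (a : ℕ → ℤ) j)
  fun_prop

lemma upP_continuous (l : ℕ) :
    Continuous (fun q => LinearMap.toMatrix' (upP (rT W (aq q) (bq q)) 0 l)) := by
  induction l with
  | zero => simp only [upP]; exact continuous_const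
  | succ l ih =>
    simp only [upP, LinearMap.toMatrix'_mul]
    exact ih.mul (rT_continuous _)

lemma toMatrix'_pow (f : Module.End ℝ (W → ℝ)) (d : ℕ) :
    LinearMap.toMatrix' (f ^ d) = LinearMap.toMatrix' f ^ d := by
  induction d with
  | zero => simp [LinearMap.toMatrix'_one]
  | succ d ih => rw [pow_succ, pow_succ, LinearMap.toMatrix'_mul, ih]

/-- All promotion operators have the same order and traces. -/
theorem promo_trace {l : ℕ} (hW : WSet (l + 1) W)
    {c : ℤ} (hc : ∀ w ∈ W, w 0 = c) (hc' : ∀ w ∈ W, w l = c)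
    (hs : ∀ w ∈ W, ∑ j ∈ Finset.range (l + 1), w j = c * (l + 1)) :
    (upP (rT W (aq 0) (bq 0)) 0 l) ^ (l + 1) = 1 ∧
    ∀ d : ℕ, (LinearMap.toMatrix' ((upP (rT W (aq 0) (bq 0)) 0 l) ^ d)).trace =
      (LinearMap.toMatrix' ((upP (rT W (aq 1) (bq 1)) 0 l) ^ d)).trace := by
  have key : ∀ q ∈ Set.Icc (0:ℝ) 1,
      LinearMap.toMatrix' (upP (rT W (aq q) (bq q)) 0 l) ^ (l + 1) = 1 := by
    apply pow_eq_one_closure (upP_continuous l)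
    intro q h0 h1
    rw [← toMatrix'_pow, promo_period hW h0 h1 hc hc' hs, LinearMap.toMatrix'_one]
  constructor
  · apply LinearMap.toMatrix'.injective
    rw [toMatrix'_pow, key 0 (by simp), LinearMap.toMatrix'_one]
  · intro d
    rw [toMatrix'_pow, toMatrix'_pow]
    apply trace_const (N := l + 1) (by omega)
      (M := fun q => LinearMap.toMatrix' (upP (rT W (aq q) (bq q)) 0 l) ^ d)
    · exact (upP_continuous l).pow d
    · intro q hq
      rw [← pow_mul, mul_comm, pow_mul, key q hq, one_pow]
end

/-! The set of words as functions -/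

/-- a word as a function -/
def wfun (T : List ℤ) : ℕ → ℤ := fun i => T.getD i 0

lemma wfun_inj {T T' : List ℤ} (hl : T.length = T'.length) (h : wfun T = wfun T') : T = T' := by
  apply List.ext_getElem hl
  intro i h1 h2
  have := congrFun h i
  simpa [wfun, h1, h2] using this

lemma wfun_append_left (u v : List ℤ) {i : ℕ} (h : i < u.length) : wfun (u ++ v) i = wfun u i := by
  unfold wfun; exact List.getD_append _ _ _ _ h

lemma wfun_append_right (u v : List ℤ) (i : ℕ) : wfun (u ++ v) (u.length + i) = wfun v i := by
  unfold wfun; rw [List.getD_append_right _ _ _ _ (by omega)]; congr 1; omega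

lemma wfun_mid (u : List ℤ) (x : ℤ) (v : List ℤ) : wfun (u ++ x :: v) u.length = x := by
  simpa [wfun] using wfun_append_right u (x :: v) 0

lemma wfun_mid1 (u : List ℤ) (x y : ℤ) (v : List ℤ) : wfun (u ++ x :: y :: v) (u.length + 1) = y := by
  simpa [wfun] using wfun_append_right u (x :: y :: v) 1

lemma wfun_mid2 (u : List ℤ) (x y z : ℤ) (v : List ℤ) :
    wfun (u ++ x :: y :: z :: v) (u.length + 2) = z := by
  simpa [wfun] using wfun_append_right u (x :: y :: z :: v) 2

lemma wsw_wfun (u : List ℤ) (x y : ℤ) (v : List ℤ) :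
    wsw u.length (wfun (u ++ x :: y :: v)) = wfun (u ++ y :: x :: v) := by
  funext i
  by_cases h1 : i = u.length
  · subst h1; rw [wsw_left, wfun_mid1, wfun_mid]
  by_cases h2 : i = u.length + 1
  · subst h2; rw [wsw_right, wfun_mid1, wfun_mid]
  rw [wsw_other _ h1 h2]
  rcases Nat.lt_or_ge i u.length with h | h
  · rw [wfun_append_left _ _ h, wfun_append_left _ _ h]
  · obtain ⟨k, rfl⟩ : ∃ k, i = u.length + (k + 2) := ⟨i - u.length - 2, by omega⟩
    rw [wfun_append_right, wfun_append_right]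
    simp [wfun]

lemma split_two {T : List ℤ} {j : ℕ} (h : j + 1 < T.length) :
    ∃ u x y v, T = u ++ x :: y :: v ∧ u.length = j := by
  refine ⟨T.take j, T[j], T[j+1], T.drop (j + 2), ?_, by simp; omega⟩
  rw [List.getElem_cons_drop, List.getElem_cons_drop, List.take_append_drop]

lemma split_three {T : List ℤ} {j : ℕ} (h : j + 2 < T.length) :
    ∃ u x y z v, T = u ++ x :: y :: z :: v ∧ u.length = j := by
  refine ⟨T.take j, T[j], T[j+1], T[j+2], T.drop (j + 3), ?_, by simp; omega⟩
  rw [List.getElem_cons_drop, List.getElem_cons_drop, List.getElem_cons_drop, List.take_append_drop]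

/-- the set of words of `WA` as functions -/
def WW (n : ℕ) : Set (ℕ → ℤ) := {w | ∃ T, WA n T ∧ w = wfun T}

lemma WW_wset (n : ℕ) : WSet (n * n) (WW n) := by
  constructor
  · rintro w ⟨T, ⟨hT, hl⟩, rfl⟩ j hj
    obtain ⟨u, x, y, v, rfl, rfl⟩ := split_two (hl ▸ hj)
    rw [wfun_mid, wfun_mid1]
    obtain ⟨s, h1, h2⟩ := HPath_append'.1 hT
    rw [HPath_cons, HPath_cons] at h2
    intro e
    subst e
    have := h2.2.1.1
    simp only [mem_hop] at this
    rcases this with h | ⟨_, h | h⟩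
    · omega
    · exact h rfl
    · simp at h
  · rintro w ⟨T, ⟨hT, hl⟩, rfl⟩ j hj
    obtain ⟨u, x, y, z, v, rfl, rfl⟩ := split_three (hl ▸ hj)
    rw [wfun_mid, wfun_mid2]
    obtain ⟨s, h1, h2⟩ := HPath_append'.1 hT
    rw [HPath_cons, HPath_cons, HPath_cons] at h2
    rintro rfl
    have a := h2.2.2.1.1
    have b := h2.2.2.1.2
    simp only [mem_hop] at a b
    simp at a b
    omega
  · rintro w ⟨T, ⟨hT, hl⟩, rfl⟩ j hj hf
    obtain ⟨u, x, y, v, rfl, rfl⟩ := split_two (hl ▸ hj)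
    rw [wfun_mid, wfun_mid1] at hf
    obtain ⟨s, h1, h2⟩ := HPath_append'.1 hT
    rw [HPath_cons, HPath_cons] at h2
    rw [wsw_wfun]
    refine ⟨_, ⟨HPath_append'.2 ⟨s, h1, ?_⟩, by simpa using hl⟩, rfl⟩
    rw [HPath_cons, HPath_cons, hop_comm false s hf.symm]
    exact ⟨(Hvalid_comm hf).1 h2.2.1, (Hvalid_comm hf.symm).2 h2.1, h2.2.2⟩

lemma path_moves_right {s t : Set ℤ} {w : List ℤ} (h : HPath false s w t) {x : ℤ} (hx : x ∈ s) :
    ∃ y ∈ t, x ≤ y := by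
  induction w generalizing s x with
  | nil => rw [HPath_nil] at h; subst h; exact ⟨x, hx, le_rfl⟩
  | cons a w ih =>
    rw [HPath_cons] at h
    by_cases e : x = a
    · subst e
      obtain ⟨y, hy, hl⟩ := ih h.2 (x := x + 1) (mem_hop.2 (Or.inl rfl))
      exact ⟨y, hy, by omega⟩
    · exact ih h.2 (mem_hop.2 (Or.inr ⟨hx, Or.inl e⟩))

lemma path_letters {s t : Set ℤ} {w : List ℤ} (h : HPath false s w t) {a b : ℤ}
    (ha : ∀ x ∈ s, a ≤ x) (hb : ∀ x ∈ t, x ≤ b) : ∀ x ∈ w, a ≤ x ∧ x < b := by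
  induction w generalizing s with
  | nil => simp
  | cons y w ih =>
    rw [HPath_cons] at h
    intro x hx
    rcases List.mem_cons.1 hx with rfl | hx
    · refine ⟨ha _ h.1.1, ?_⟩
      obtain ⟨z, hz, hl⟩ := path_moves_right h.2 (x := x + 1) (mem_hop.2 (Or.inl rfl))
      have := hb z hz
      omega
    · refine ih h.2 ?_ x hx
      intro z hz
      rcases mem_hop.1 hz with e | e
      · have := ha _ h.1.1; omega
      · exact ha _ e.1

lemma WA_letters {n : ℕ} {T : List ℤ} (h : WA n T) : ∀ x ∈ T, 1 ≤ x ∧ x < 2 * n :=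
  path_letters h.1 (fun x hx => hx.1) (fun x hx => hx.2)

lemma WA_finite (n : ℕ) : {T | WA n T}.Finite := by
  have : ({T | WA n T} : Set (List ℤ)) ⊆
      (List.map (fun x : Set.Icc (1:ℤ) (2 * n) => (x : ℤ))) '' {l | l.length = n * n} := by
    intro T hT
    refine ⟨T.attach.map (fun x => ⟨x.1, (WA_letters hT x.1 x.2).1, (WA_letters hT x.1 x.2).2.le⟩), ?_, ?_⟩
    · simpa using hT.2
    · rw [List.map_map]
      simp [Function.comp_def]
  exact ((List.finite_length_eq _ _).image _).subset this

lemma WW_finite (n : ℕ) : (WW n).Finite := by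
  refine ((WA_finite n).image wfun).subset ?_
  rintro w ⟨T, h, rfl⟩
  exact ⟨T, h, rfl⟩

lemma WA_first {n : ℕ} {x : ℤ} {T : List ℤ} (h : WA n (x :: T)) : x = n := by
  have h1 := (HPath_cons.1 h.1).1
  have a := h1.1
  have b := h1.2
  simp only [sqA, Set.mem_ofPred_eq] at a b
  omega

lemma WA_last {n : ℕ} {x : ℤ} {T : List ℤ} (h : WA n (T ++ [x])) : x = n := by
  obtain ⟨s, h1, h2⟩ := HPath_append'.1 h.1
  rw [HPath_cons, HPath_nil] at h2
  have a : x + 1 ∈ sqB n := h2.2 ▸ mem_hop.2 (Or.inl rfl)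
  have b : x ∉ sqB n := by
    rw [← h2.2, mem_hop]
    simp
  simp only [sqB, Set.mem_ofPred_eq] at a b
  omega

/-- sum of squares of positions -/
noncomputable def sqsum (s : Set ℤ) : ℤ := ∑ᶠ p ∈ s, p ^ 2

lemma hop_false_eq {s : Set ℤ} {x : ℤ} : hop false s x = insert (x + 1) (s \ {x}) := by
  ext y; simp [mem_hop]

lemma hop_finite {s : Set ℤ} (hs : s.Finite) (x : ℤ) : (hop false s x).Finite := by
  rw [hop_false_eq]; exact (hs.subset Set.sdiff_subset).insert _

lemma sqsum_hop {s : Set ℤ} (hs : s.Finite) {x : ℤ} (h : Hvalid s x) :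
    sqsum (hop false s x) = sqsum s + (2 * x + 1) := by
  have hf : (s \ {x}).Finite := hs.subset Set.sdiff_subset
  have e : s = insert x (s \ {x}) := by
    ext y; simp only [Set.mem_insert_iff, Set.mem_sdiff, Set.mem_singleton_iff]
    constructor
    · intro hy; tauto
    · rintro (rfl | hy)
      · exact h.1
      · exact hy.1
  rw [hop_false_eq]
  unfold sqsum
  rw [finsum_mem_insert _ (fun hc => h.2 hc.1) hf]
  conv_rhs => rw [e]
  rw [finsum_mem_insert _ (fun hc => hc.2 rfl) hf]
  ring

lemma sqsum_path {s t : Set ℤ} (hs : s.Finite) {w : List ℤ} (h : HPath false s w t) :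
    sqsum t = sqsum s + (2 * w.sum + w.length) := by
  induction w generalizing s with
  | nil => rw [HPath_nil] at h; subst h; simp
  | cons x w ih =>
    rw [HPath_cons] at h
    rw [ih (hop_finite hs x) h.2, sqsum_hop hs h.1]
    simp; ring

lemma sqsum_interval (a : ℤ) (m : ℕ) :
    sqsum {y | a + 1 ≤ y ∧ y ≤ a + m} * 6 = (6 * a ^ 2 * m + 6 * a * (m * (m + 1)) + m * (m + 1) * (2 * m + 1)) := by
  induction m with
  | zero =>
    have : ({y | a + 1 ≤ y ∧ y ≤ a + (0:ℕ)} : Set ℤ) = ∅ := by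
      ext y; simp only [Set.mem_ofPred_eq, Set.mem_empty_iff_false, iff_false]; push_cast; omega
    rw [this]; simp [sqsum]
  | succ m ih =>
    have : ({y | a + 1 ≤ y ∧ y ≤ a + (m+1:ℕ)} : Set ℤ) =
        insert (a + m + 1) {y | a + 1 ≤ y ∧ y ≤ a + m} := by
      ext y; simp only [Set.mem_ofPred_eq, Set.mem_insert_iff]; push_cast; omega
    rw [this]
    unfold sqsum at *
    have hfi : ({y | a + 1 ≤ y ∧ y ≤ a + m} : Set ℤ).Finite := Set.finite_Icc (a + 1) (a + m)
    rw [finsum_mem_insert _ _ hfi, add_mul, ih]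
    · push_cast; ring
    · simp only [Set.mem_ofPred_eq]; omega

lemma sqA_finite (n : ℕ) : (sqA n).Finite := Set.finite_Icc _ _

lemma WA_sum {n : ℕ} {T : List ℤ} (h : WA n T) : T.sum = n * (n * n) := by
  have := sqsum_path (sqA_finite n) h.1
  have e1 := sqsum_interval 0 n
  have e2 := sqsum_interval n n
  have s1 : ({y | (0:ℤ) + 1 ≤ y ∧ y ≤ 0 + n} : Set ℤ) = sqA n := by
    ext y; simp [sqA]
  have s2 : ({y | (n:ℤ) + 1 ≤ y ∧ y ≤ n + n} : Set ℤ) = sqB n := by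
    ext y; simp only [sqB, Set.mem_ofPred_eq]; omega
  rw [s1] at e1
  rw [s2] at e2
  rw [h.2] at this
  push_cast at this
  nlinarith

lemma wfun_sum (T : List ℤ) : ∑ j ∈ Finset.range T.length, wfun T j = T.sum := by
  induction T with
  | nil => simp
  | cons x T ih =>
    rw [List.length_cons, Finset.sum_range_succ']
    simp [wfun] at ih ⊢
    rw [ih]; ring

lemma WW_sum {n : ℕ} : ∀ w ∈ WW n, ∑ j ∈ Finset.range (n * n), w j = n * (n * n) := by
  rintro w ⟨T, h, rfl⟩
  have := wfun_sum T
  rw [h.2] at this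
  rw [this, WA_sum h]

lemma WW_first {n : ℕ} (hn : n ≠ 0) : ∀ w ∈ WW n, w 0 = n := by
  rintro w ⟨T, h, rfl⟩
  cases T with
  | nil => have := h.2; simp at this; omega
  | cons x T => have := WA_first h; simpa [wfun] using this

lemma WW_last {n l : ℕ} (hl : n * n = l + 1) : ∀ w ∈ WW n, w l = n := by
  rintro w ⟨T, h, rfl⟩
  rcases List.eq_nil_or_concat T with rfl | ⟨T', x, rfl⟩
  · have := h.2; simp only [List.length_nil] at this; omega
  · rw [List.concat_eq_append] at *
    have h2 := h.2
    simp at h2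
    have : l = T'.length := by omega
    rw [this, wfun_mid]
    exact WA_last h

/-! The operator at `q = 0` -/

/-- number of descending steps -/
def dnc : ℤ → List ℤ → ℕ
  | _, [] => 0
  | x, y :: l => if Far x y then dnc x l else (if y = x - 1 then dnc y l + 1 else dnc y l)

lemma zero_op (F : (ℕ → ℤ) → ℝ) {s t : Set ℤ} (u : List ℤ) (x : ℤ) (r : List ℤ)
    (h : HPath false s (x :: r) t) :
    opTL (aq 0) (bq 0) (List.range' u.length r.length) F (wfun (u ++ x :: r)) =
    (-1) ^ dnc x r * F (wfun (u ++ ((thru x r).1 ++ [(thru x r).2]))) := by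
  induction r generalizing u x s with
  | nil => simp [opTL, thru, dnc]
  | cons y r ih =>
    rw [HPath_cons, HPath_cons] at h
    rw [List.length_cons, List.range'_succ, opTL, opT, wfun_mid, wfun_mid1, wsw_wfun]
    by_cases hf : Far x y
    · have hv : Hvalid s y ∧ Hvalid (hop false s y) x :=
        ⟨(Hvalid_comm hf).1 h.2.1, (Hvalid_comm hf.symm).2 h.1⟩
      have e := ih (s := hop false s y) (u ++ [y]) x (by
        rw [HPath_cons, ← hop_comm false s hf]
        exact ⟨hv.2, h.2.2⟩)
      have hf' : 2 ≤ y - x ∨ y - x ≤ -2 := by unfold Far at hf; omega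
      rw [aq_at_zero_far hf', bq_at_zero_far hf']
      simp only [List.length_append, List.length_cons, List.length_nil, zero_add, List.append_assoc,
        List.cons_append, List.nil_append] at e
      rw [e]
      simp only [thru, dnc, hf, if_true]
      simp
    · have e := ih (s := hop false s x) (u ++ [x]) y (by
        rw [HPath_cons]
        exact ⟨h.2.1, h.2.2⟩)
      simp only [List.length_append, List.length_cons, List.length_nil, zero_add, List.append_assoc,
        List.cons_append, List.nil_append] at e
      rw [e]
      have hne : x ≠ y := Hvalid_ne h.2.1
      simp only [thru, dnc, hf, if_false]
      by_cases hy : y = x - 1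
      · rw [if_pos hy]
        have e1 : y - x = -1 := by omega
        rw [e1, bq_neg_one, aq_neg, aq_one]
        simp [pow_succ]
      · rw [if_neg hy]
        have e1 : y - x = 1 := by unfold Far at hf; omega
        rw [e1, bq_one, aq_one]
        simp

/-- number of particles to the right -/
noncomputable def rho (s : Set ℤ) (x : ℤ) : ℕ := {p | p ∈ s ∧ x < p}.ncard

lemma dnc_rho {s t : Set ℤ} (hs : s.Finite) {x : ℤ} {r : List ℤ}
    (h : HPath false s (x :: r) t) : dnc x r + rho s x + 1 = rho t (thru x r).2 := by
  induction r generalizing x s with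
  | nil =>
    rw [HPath_cons, HPath_nil] at h
    obtain ⟨h, rfl⟩ := h
    simp only [dnc, thru, rho]
    have e : {p | p ∈ hop false s x ∧ x < p} = insert (x + 1) {p | p ∈ s ∧ x < p} := by
      ext p; simp [mem_hop]
      constructor
      · rintro ⟨h | h, h2⟩ <;> tauto
      · rintro (rfl | h)
        · constructor <;> simp
        · exact ⟨Or.inr ⟨h.1, by omega⟩, h.2⟩
    rw [e, Set.ncard_insert_of_notMem (fun hc => h.2 hc.1) (hs.subset fun p hp => hp.1)]
    omega
  | cons y r ih =>
    rw [HPath_cons, HPath_cons] at h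
    by_cases hf : Far x y
    · have hv : Hvalid s y ∧ Hvalid (hop false s y) x :=
        ⟨(Hvalid_comm hf).1 h.2.1, (Hvalid_comm hf.symm).2 h.1⟩
      have e := ih (s := hop false s y) (hop_finite hs y) (x := x) (by
        rw [HPath_cons, ← hop_comm false s hf]
        exact ⟨hv.2, h.2.2⟩)
      simp only [thru, dnc, hf, if_true]
      rw [← e]
      congr 2
      have hys := hv.1
      unfold Far at hf
      rcases hf with hf | hf
      · unfold rho
        have e1 : {p | p ∈ s ∧ x < p} = insert y ({p | p ∈ s ∧ x < p} \ {y}) := by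
          rw [Set.insert_sdiff_singleton, Set.insert_eq_of_mem]
          exact ⟨hys.1, by omega⟩
        have e2 : {p | p ∈ hop false s y ∧ x < p} = insert (y + 1) ({p | p ∈ s ∧ x < p} \ {y}) := by
          ext p; simp only [mem_hop, Set.mem_ofPred_eq, Set.mem_insert_iff, Set.mem_sdiff, Set.mem_singleton_iff]
          constructor
          · rintro ⟨h | h, h2⟩
            · exact Or.inl h
            · simp at h; tauto
          · rintro (rfl | h)
            · exact ⟨Or.inl rfl, by omega⟩
            · exact ⟨Or.inr ⟨h.1.1, Or.inl h.2⟩, h.1.2⟩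
        have hfi : ({p | p ∈ s ∧ x < p} \ {y}).Finite := hs.subset fun p hp => hp.1.1
        rw [e1, e2, Set.ncard_insert_of_notMem (fun hc => hc.2 rfl) hfi,
          Set.ncard_insert_of_notMem (fun hc => hys.2 hc.1.1) hfi]
      · unfold rho
        congr 1
        ext p
        simp only [mem_hop, Set.mem_ofPred_eq]
        constructor
        · rintro ⟨h1, h2⟩; exact ⟨Or.inr ⟨h1, Or.inl (by omega)⟩, h2⟩
        · rintro ⟨h1 | h1, h2⟩
          · omega
          · exact ⟨h1.1, h2⟩
    · have e := ih (s := hop false s x) (hop_finite hs x) (x := y) (by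
        rw [HPath_cons]
        exact ⟨h.2.1, h.2.2⟩)
      have hne : x ≠ y := Hvalid_ne h.2.1
      simp only [thru, dnc, hf, if_false]
      rw [← e]
      by_cases hy : y = x - 1
      · rw [if_pos hy]
        have : rho (hop false s x) y = rho s x + 1 := by
          unfold rho
          rw [← Set.ncard_insert_of_notMem (a := x + 1) (s := {p | p ∈ s ∧ x < p})
            (fun hc => h.1.2 hc.1) (hs.subset fun p hp => hp.1)]
          congr 1
          ext p
          simp only [mem_hop, Set.mem_ofPred_eq, Set.mem_insert_iff]
          constructor
          · rintro ⟨h1 | h1, h2⟩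
            · exact Or.inl h1
            · refine Or.inr ⟨h1.1, ?_⟩
              have : p ≠ x := by simpa using h1.2
              omega
          · rintro (rfl | h1)
            · exact ⟨Or.inl rfl, by omega⟩
            · exact ⟨Or.inr ⟨h1.1, Or.inl (by omega)⟩, by omega⟩
        omega
      · rw [if_neg hy]
        have e1 : y = x + 1 := by unfold Far at hf; omega
        have : rho (hop false s x) y = rho s x := by
          unfold rho
          congr 1
          ext p
          simp only [mem_hop, Set.mem_ofPred_eq]
          constructor
          · rintro ⟨h1 | h1, h2⟩
            · omega
            · exact ⟨h1.1, by omega⟩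
          · rintro ⟨h1, h2⟩
            have : p ≠ x + 1 := fun hc => h.1.2 (hc ▸ h1)
            exact ⟨Or.inr ⟨h1, Or.inl (by omega)⟩, by omega⟩
        omega

lemma WA_dnc {n : ℕ} {x : ℤ} {r : List ℤ} (h : WA n (x :: r)) : dnc x r + 1 = n := by
  have e := dnc_rho (sqA_finite n) h.1
  have h1 := WA_first h
  have h2 : (thru x r).2 = n := WA_last (wprom_WA h)
  rw [h2, h1] at e
  have e1 : rho (sqA n) n = 0 := by
    unfold rho
    have : {p | p ∈ sqA n ∧ (n:ℤ) < p} = ∅ := by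
      ext p; simp only [sqA, Set.mem_ofPred_eq, Set.mem_empty_iff_false, iff_false]; omega
    rw [this, Set.ncard_empty]
  have e2 : rho (sqB n) n = n := by
    unfold rho
    have : {p | p ∈ sqB n ∧ (n:ℤ) < p} = Set.Icc ((n:ℤ) + 1) (2 * n) := by
      ext p; simp only [sqB, Set.mem_ofPred_eq, Set.mem_Icc]; omega
    rw [this, ncard_Icc_int]
    omega
  rw [e1, e2] at e
  rw [h1]
  omega

lemma upP_eq_list {M : Type*} [Monoid M] (T : ℕ → M) (a l : ℕ) :
    upP T a l = ((List.range' a l).map T).prod := by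
  induction l with
  | zero => simp [upP]
  | succ l ih => rw [upP, ih, List.range'_concat]; simp

lemma wprom_iter_WA {n : ℕ} {T : List ℤ} (h : WA n T) (d : ℕ) : WA n (wprom^[d] T) := by
  induction d with
  | zero => exact h
  | succ d ih => rw [Function.iterate_succ_apply']; exact wprom_WA ih

section
variable {n l : ℕ}

lemma promo_zero (hl : n * n = l + 1) (F : WW n → ℝ) {T : List ℤ} (h : WA n T) :
    upP (rT (WW n) (aq 0) (bq 0)) 0 l F ⟨wfun T, T, h, rfl⟩ =
      (-1) ^ (n - 1) * F ⟨wfun (wprom T), wprom T, wprom_WA h, rfl⟩ := by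
  rw [upP_eq_list, rT_list (hl ▸ WW_wset n) (bq_one 0) (bq_neg_one 0) _ (by simp)]
  cases T with
  | nil => have := h.2; simp only [List.length_nil] at this; omega
  | cons x r =>
    have hr : r.length = l := by have := h.2; simp only [List.length_cons] at this; omega
    have e := zero_op (ext0 (WW n) F) [] x r h.1
    simp only [List.length_nil, hr, List.nil_append] at e
    rw [e]
    have hd := WA_dnc h
    rw [show dnc x r = n - 1 by omega]
    congr 1
    exact ext0_mem F ⟨wfun (wprom (x :: r)), _, wprom_WA h, rfl⟩

lemma promo_zero_pow (hl : n * n = l + 1) (d : ℕ) (F : WW n → ℝ) {T : List ℤ} (h : WA n T) :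
    (upP (rT (WW n) (aq 0) (bq 0)) 0 l ^ d) F ⟨wfun T, T, h, rfl⟩ =
      (-1) ^ ((n - 1) * d) * F ⟨wfun (wprom^[d] T), _, wprom_iter_WA h d, rfl⟩ := by
  induction d generalizing T with
  | zero => simp
  | succ d ih =>
    rw [pow_succ', Module.End.mul_apply, promo_zero hl _ h, ih (wprom_WA h)]
    simp only [Function.iterate_succ_apply]
    rw [← mul_assoc, ← pow_add]
    congr 2; ring

lemma WA_period (hn : n ≠ 0) {T : List ℤ} (h : WA n T) : wprom^[n * n] T = T := by
  classical
  obtain ⟨l, hl⟩ : ∃ l, n * n = l + 1 := ⟨n * n - 1, by have := Nat.mul_pos (Nat.pos_of_ne_zero hn) (Nat.pos_of_ne_zero hn); omega⟩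
  let : Fintype (WW n) := (WW_finite n).fintype
  have hp := (promo_trace (W := WW n) (l := l) (hl ▸ WW_wset n) (c := n) (WW_first hn) (WW_last hl)
    (fun w hw => by have := WW_sum w hw; rw [hl] at this; rw [this]; have : ((n * n : ℕ) : ℤ) = ((l + 1 : ℕ) : ℤ) := by rw [hl]
                    push_cast at this; rw [this])).1
  have e := promo_zero_pow hl (l + 1) (Pi.single ⟨wfun T, T, h, rfl⟩ 1) h
  rw [hp] at e
  rw [Module.End.one_apply, Pi.single_eq_same, Pi.single_apply] at e
  by_contra hne
  rw [if_neg] at e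
  · simp at e
  · intro hc
    apply hne
    have := congrArg Subtype.val hc
    rw [hl]
    refine wfun_inj ?_ this
    rw [(wprom_iter_WA h _).2, h.2]

open Classical in
/-- fixed points of promotion as a trace at `q = 1` -/
theorem fix_eq_trace (hn : n ≠ 0) (hl : n * n = l + 1) [Fintype (WW n)] (d : ℕ) :
    (LinearMap.toMatrix' ((upP (rT (WW n) (aq 1) (bq 1)) 0 l) ^ d)).trace =
    (-1) ^ ((n - 1) * d) * ({T | WA n T ∧ wprom^[d] T = T}.ncard : ℝ) := by
  have hp := (promo_trace (W := WW n) (l := l) (hl ▸ WW_wset n) (c := n) (WW_first hn) (WW_last hl)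
    (fun w hw => by have := WW_sum w hw; rw [hl] at this; rw [this]; have : ((n * n : ℕ) : ℤ) = ((l + 1 : ℕ) : ℤ) := by rw [hl]
                    push_cast at this; rw [this])).2 d
  rw [← hp, Matrix.trace]
  have : ∀ w : WW n, (LinearMap.toMatrix' ((upP (rT (WW n) (aq 0) (bq 0)) 0 l) ^ d)).diag w =
      (-1) ^ ((n - 1) * d) * (if (w : ℕ → ℤ) ∈ wfun '' {T | WA n T ∧ wprom^[d] T = T} then 1 else 0) := by
    rintro ⟨w, T, h, rfl⟩
    rw [Matrix.diag, LinearMap.toMatrix'_apply]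
    simp only [← Pi.single_apply]
    have e := promo_zero_pow hl d (Pi.single ⟨wfun T, T, h, rfl⟩ 1) h
    refine e.trans ?_
    congr 1
    rw [Pi.single_apply]
    refine if_congr ?_ rfl rfl
    refine (Subtype.ext_iff).trans ?_
    constructor
    · intro hc
      exact ⟨T, ⟨h, wfun_inj (by rw [(wprom_iter_WA h _).2, h.2]) hc⟩, rfl⟩
    · rintro ⟨T', ⟨h', h2⟩, h3⟩
      have := wfun_inj (by rw [h.2, h'.2]) h3
      subst this
      exact congrArg wfun h2
  rw [Finset.sum_congr rfl (fun w _ => this w), ← Finset.mul_sum, Finset.sum_boole]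
  congr 2
  rw [← Set.ncard_image_of_injOn (f := wfun) (s := {T | WA n T ∧ wprom^[d] T = T})
    (fun a ha b hb hab => wfun_inj (by rw [ha.1.2, hb.1.2]) hab)]
  rw [← Set.ncard_coe_finset, ← Set.ncard_image_of_injective _ Subtype.val_injective]
  congr 1
  ext w
  simp only [Set.mem_image, Finset.coe_filter, Finset.mem_univ, true_and, Set.mem_ofPred_eq]
  constructor
  · rintro ⟨v, h, rfl⟩; exact h
  · rintro ⟨T, h, rfl⟩; exact ⟨⟨wfun T, T, h.1, rfl⟩, ⟨T, h, rfl⟩, rfl⟩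
end

/-! Words in the symmetric group -/

section cox
variable {M : Type*} [Monoid M]

/-- product over a word -/
def wpr (T : ℕ → M) (u : List ℕ) : M := (u.map T).prod

lemma wpr_append (T : ℕ → M) (u v : List ℕ) : wpr T (u ++ v) = wpr T u * wpr T v := by
  simp [wpr]
lemma wpr_nil (T : ℕ → M) : wpr T [] = 1 := rfl
lemma wpr_single (T : ℕ → M) (i : ℕ) : wpr T [i] = T i := by simp [wpr]

/-- letters `m, m-1, ..., m+1-c` -/
def dnl (m : ℕ) : ℕ → List ℕ
  | 0 => []
  | c + 1 => dnl m c ++ [m - c]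

lemma dnl_comm {T : ℕ → M} {m : ℕ} (h : BraidRel T (m + 1)) {c i : ℕ} (hc : i + c + 1 ≤ m) :
    wpr T (dnl m c) * T i = T i * wpr T (dnl m c) := by
  induction c with
  | zero => simp [dnl, wpr]
  | succ c ih =>
    rw [dnl, wpr_append, wpr_single, mul_assoc, ← h.comm i (m - c) (by omega) (by omega) (by omega),
      ← mul_assoc, ih (by omega), mul_assoc]

lemma dnl_shift {T : ℕ → M} {m : ℕ} (h : BraidRel T (m + 1)) {c i : ℕ} (hc : c ≤ m + 1)
    (hi : i < m) (hi2 : m + 1 ≤ i + c) :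
    wpr T (dnl m c) * T (i + 1) = T i * wpr T (dnl m c) := by
  induction c with
  | zero => omega
  | succ c ih =>
    rcases Nat.lt_or_ge m (i + c) with h1 | h1
    · rw [dnl, wpr_append, wpr_single, mul_assoc, h.comm (m - c) (i + 1) (by omega) (by omega) (by omega),
        ← mul_assoc, ih (by omega) (by omega), mul_assoc]
    · have hm : m = i + c := by omega
      obtain ⟨c', rfl⟩ : ∃ c', c = c' + 1 := ⟨c - 1, by omega⟩
      rw [dnl, dnl, wpr_append, wpr_append, wpr_single, wpr_single]
      have e1 : m - (c' + 1) = i := by omega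
      have e2 : m - c' = i + 1 := by omega
      rw [e1, e2]
      have b := h.braid i (by omega)
      calc wpr T (dnl m c') * T (i + 1) * T i * T (i + 1)
          = wpr T (dnl m c') * (T (i + 1) * T i * T (i + 1)) := by simp only [mul_assoc]
        _ = (wpr T (dnl m c') * T i) * (T (i + 1) * T i) := by rw [← b]; simp only [mul_assoc]
        _ = _ := by rw [dnl_comm h (by omega)]; simp only [mul_assoc]

lemma normal_form {T : ℕ → M} {m : ℕ} (h : BraidRel T (m + 1)) (hsq : ∀ i, i < m + 1 → T i * T i = 1)
    (u : List ℕ) (hu : ∀ i ∈ u, i < m + 1) :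
    ∃ v c, (∀ i ∈ v, i < m) ∧ c ≤ m + 1 ∧ wpr T u = wpr T v * wpr T (dnl m c) := by
  induction u using List.reverseRecOn with
  | nil => exact ⟨[], 0, by simp, by omega, by simp [wpr, dnl]⟩
  | append_singleton u i ih =>
    obtain ⟨v, c, hv, hc, e⟩ := ih (fun i hi => hu i (by simp [hi]))
    have him : i < m + 1 := hu i (by simp)
    rw [wpr_append, e, wpr_single, mul_assoc]
    by_cases h1 : i + c + 1 ≤ m
    · refine ⟨v ++ [i], c, ?_, hc, ?_⟩
      · intro j hj
        rcases List.mem_append.1 hj with hj | hj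
        · exact hv j hj
        · simp at hj; omega
      · rw [dnl_comm h h1, wpr_append, wpr_single, mul_assoc]
    by_cases h2 : i + c = m
    · refine ⟨v, c + 1, hv, by omega, ?_⟩
      rw [dnl, wpr_append, wpr_single, show m - c = i by omega]
    by_cases h3 : i + c = m + 1
    · obtain ⟨c', rfl⟩ : ∃ c', c = c' + 1 := ⟨c - 1, by omega⟩
      refine ⟨v, c', hv, by omega, ?_⟩
      rw [dnl, wpr_append, wpr_single, show m - c' = i by omega, mul_assoc, hsq i him, mul_one]
    · obtain ⟨i', rfl⟩ : ∃ i', i = i' + 1 := ⟨i - 1, by omega⟩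
      refine ⟨v ++ [i'], c, ?_, hc, ?_⟩
      · intro j hj
        rcases List.mem_append.1 hj with hj | hj
        · exact hv j hj
        · simp at hj; omega
      · rw [dnl_shift h hc (by omega) (by omega), wpr_append, wpr_single, mul_assoc]

/-- adjacent transpositions -/
def sT (i : ℕ) : Equiv.Perm ℕ := Equiv.swap i (i + 1)

lemma sT_braidRel (m : ℕ) : BraidRel sT m := by
  constructor
  · intro i _
    ext k
    simp only [sT, Equiv.Perm.mul_apply, Equiv.swap_apply_def]
    split_ifs <;> omega
  · intro i j _ _ h
    ext k
    simp only [sT, Equiv.Perm.mul_apply, Equiv.swap_apply_def]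
    split_ifs <;> omega

lemma sT_fix {m : ℕ} {u : List ℕ} (hu : ∀ i ∈ u, i < m) {x : ℕ} (hx : m < x) :
    wpr sT u x = x := by
  induction u with
  | nil => simp [wpr]
  | cons i u ih =>
    rw [show i :: u = [i] ++ u by rfl, wpr_append, wpr_single, Equiv.Perm.mul_apply,
      ih (fun i hi => hu i (by simp [hi]))]
    have := hu i (by simp)
    rw [sT, Equiv.swap_apply_of_ne_of_ne] <;> omega

lemma sT_dnl {m c : ℕ} (hc : c ≤ m + 1) : wpr sT (dnl m c) (m + 1 - c) = m + 1 := by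
  induction c with
  | zero => simp [dnl, wpr]
  | succ c ih =>
    rw [dnl, wpr_append, wpr_single, Equiv.Perm.mul_apply, sT,
      show m + 1 - (c + 1) = m - c by omega, Equiv.swap_apply_left,
      show m - c + 1 = m + 1 - c by omega, ih (by omega)]

lemma wpr_prod (T : ℕ → M) (u : List ℕ) :
    wpr (fun i => ((T i, sT i) : M × Equiv.Perm ℕ)) u = (wpr T u, wpr sT u) := by
  induction u with
  | nil => rfl
  | cons i u ih =>
    rw [show i :: u = [i] ++ u by rfl]
    simp only [wpr_append, ih, wpr_single, Prod.mk_mul_mk]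

lemma cox_trivial {T : ℕ → M} {m : ℕ} (h : BraidRel T m) (hsq : ∀ i, i < m → T i * T i = 1)
    (u : List ℕ) (hu : ∀ i ∈ u, i < m) (he : wpr sT u = 1) : wpr T u = 1 := by
  induction m generalizing u with
  | zero =>
    cases u with
    | nil => rfl
    | cons i u => have := hu i (by simp); omega
  | succ m ih =>
    have hb := sT_braidRel (m + 1)
    have h' : BraidRel (fun i => ((T i, sT i) : M × Equiv.Perm ℕ)) (m + 1) := by
      constructor
      · intro i hi
        exact Prod.ext (h.braid i hi) (hb.braid i hi)
      · intro i j hi hj hij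
        exact Prod.ext (h.comm i j hi hj hij) (hb.comm i j hi hj hij)
    obtain ⟨v, c, hv, hc, e⟩ := normal_form h' (fun i hi => Prod.ext (hsq i hi) (by simp [sT])) u hu
    simp only [wpr_prod, Prod.mk_mul_mk, Prod.mk.injEq] at e
    have hc0 : c = 0 := by
      have e2 := e.2
      rw [he] at e2
      have e3 := congrArg (fun σ : Equiv.Perm ℕ => σ (m + 1 - c)) e2
      simp only [Equiv.Perm.mul_apply, Equiv.Perm.one_apply] at e3
      rw [sT_dnl hc, sT_fix hv (by omega)] at e3
      omega
    subst hc0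
    simp only [dnl, wpr_nil, mul_one] at e
    rw [e.1]
    refine ih ⟨fun i hi => h.braid i (by omega), fun i j hi hj => h.comm i j (by omega) (by omega)⟩
      (fun i hi => hsq i (by omega)) v hv ?_
    rw [← e.2, he]

lemma wpr_reverse {T : ℕ → M} {m : ℕ} (hsq : ∀ i, i < m → T i * T i = 1)
    (u : List ℕ) (hu : ∀ i ∈ u, i < m) : wpr T u.reverse * wpr T u = 1 := by
  induction u with
  | nil => simp [wpr]
  | cons i u ih =>
    rw [List.reverse_cons, show i :: u = [i] ++ u by rfl, wpr_append, wpr_append, wpr_single]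
    calc _ = wpr T u.reverse * (T i * T i) * wpr T u := by simp only [mul_assoc]
      _ = _ := by rw [hsq i (hu i (by simp)), mul_one, ih (fun i hi => hu i (by simp [hi]))]

/-- Words with the same permutation have the same product. -/
lemma cox_eq {T : ℕ → M} {m : ℕ} (h : BraidRel T m) (hsq : ∀ i, i < m → T i * T i = 1)
    (u v : List ℕ) (hu : ∀ i ∈ u, i < m) (hv : ∀ i ∈ v, i < m) (he : wpr sT u = wpr sT v) :
    wpr T u = wpr T v := by
  have hvr : ∀ i ∈ v.reverse, i < m := fun i hi => hv i (by simpa using hi)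
  have s2 : ∀ i, i < m → sT i * sT i = 1 := fun i _ => by simp [sT]
  have e1 : wpr T (u ++ v.reverse) = 1 := by
    refine cox_trivial h hsq _ ?_ ?_
    · intro i hi
      rcases List.mem_append.1 hi with hi | hi
      · exact hu i hi
      · exact hvr i hi
    · rw [wpr_append, he]
      have := wpr_reverse s2 v.reverse hvr
      rwa [List.reverse_reverse] at this
  rw [wpr_append] at e1
  calc wpr T u = wpr T u * (wpr T v.reverse * wpr T v) := by rw [wpr_reverse hsq v hv, mul_one]
    _ = _ := by rw [← mul_assoc, e1, one_mul]

lemma sT_surj (m : ℕ) (σ : Equiv.Perm ℕ) (hσ : ∀ x, m < x → σ x = x) :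
    ∃ u : List ℕ, (∀ i ∈ u, i < m) ∧ wpr sT u = σ := by
  induction m generalizing σ with
  | zero =>
    refine ⟨[], by simp, ?_⟩
    rw [wpr_nil]
    ext x
    rcases Nat.eq_zero_or_pos x with rfl | hx
    · by_contra hne
      have h1 : 0 < σ 0 := by
        simp only [Equiv.Perm.one_apply] at hne; omega
      have h2 := σ.injective (hσ _ h1)
      omega
    · rw [hσ x hx]; rfl
  | succ m ih =>
    set j := σ.symm (m + 1) with hj
    have hj1 : j ≤ m + 1 := by
      by_contra hc
      have := hσ j (by omega)
      rw [hj, Equiv.apply_symm_apply] at this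
      omega
    have s2 : ∀ i, i < m + 1 → sT i * sT i = 1 := fun i _ => by simp [sT]
    set D := dnl m (m + 1 - j) with hD
    have hDm : ∀ i ∈ D, i < m + 1 := by
      have : ∀ c, ∀ i ∈ dnl m c, i < m + 1 := by
        intro c
        induction c with
        | zero => simp [dnl]
        | succ c ih =>
          intro i hi
          rw [dnl] at hi
          rcases List.mem_append.1 hi with hi | hi
          · exact ih i hi
          · simp at hi; omega
      exact this _
    have hDj : wpr sT D j = m + 1 := by
      have := sT_dnl (m := m) (c := m + 1 - j) (by omega)
      rwa [show m + 1 - (m + 1 - j) = j by omega] at this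
    obtain ⟨v, hv, hve⟩ := ih (σ * wpr sT D.reverse) (by
      intro x hx
      rw [Equiv.Perm.mul_apply]
      rcases Nat.lt_or_ge (m + 1) x with h1 | h1
      · rw [sT_fix (m := m + 1) (fun i hi => hDm i (by simpa using hi)) h1, hσ x h1]
      · have : x = m + 1 := by omega
        subst this
        have := congrArg (fun τ : Equiv.Perm ℕ => τ j) (wpr_reverse s2 D hDm)
        simp only [Equiv.Perm.mul_apply, Equiv.Perm.one_apply, hDj] at this
        rw [this, hj, Equiv.apply_symm_apply])
    refine ⟨v ++ D, ?_, ?_⟩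
    · intro i hi
      rcases List.mem_append.1 hi with hi | hi
      · have := hv i hi; omega
      · exact hDm i hi
    · rw [wpr_append, hve, mul_assoc, wpr_reverse s2 D hDm, mul_one]

/-! The block word -/

lemma upP_eq_wpr (T : ℕ → M) (a l : ℕ) : upP T a l = wpr T (List.range' a l) := upP_eq_list T a l

/-- word of `d` blocks of size `k` -/
def blk (k : ℕ) : ℕ → List ℕ
  | 0 => []
  | d + 1 => blk k d ++ List.range' (d * k) (k - 1)

lemma sT_up (a l i : ℕ) : wpr sT (List.range' a l) i =
    if a ≤ i ∧ i < a + l then i + 1 else if i = a + l then a else i := by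
  induction l generalizing i with
  | zero => simp only [List.range'_zero, wpr_nil, Equiv.Perm.one_apply]; split_ifs <;> omega
  | succ l ih =>
    rw [List.range'_concat, wpr_append, wpr_single, Equiv.Perm.mul_apply, mul_comm, mul_one, ih, sT,
      Equiv.swap_apply_def]
    split_ifs <;> omega

lemma sT_blk {k : ℕ} (hk : k ≠ 0) (m i : ℕ) : wpr sT (blk k m) i =
    if i < m * k then i / k * k + (i % k + 1) % k else i := by
  have hk' : 0 < k := Nat.pos_of_ne_zero hk
  induction m generalizing i with
  | zero => simp [blk, wpr]
  | succ m ih =>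
    rw [blk, wpr_append, Equiv.Perm.mul_apply, sT_up]
    have e : (m + 1) * k = m * k + k := by ring
    by_cases h1 : i < m * k
    · rw [if_neg (by omega), if_neg (by omega), ih, if_pos h1, if_pos (by omega)]
    · by_cases h2 : i < (m + 1) * k
      · obtain ⟨r, rfl⟩ : ∃ r, i = m * k + r := ⟨i - m * k, by omega⟩
        have hr : r < k := by omega
        have e1 : (m * k + r) / k = m := by
          rw [mul_comm, Nat.mul_add_div hk', Nat.div_eq_of_lt hr]; rfl
        have e2 : (m * k + r) % k = r := by
          rw [mul_comm, Nat.mul_add_mod, Nat.mod_eq_of_lt hr]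
        rw [if_pos h2, e1, e2]
        by_cases h3 : r = k - 1
        · rw [if_neg (by omega), if_pos (by omega), ih, if_neg (by omega),
            show r + 1 = k by omega, Nat.mod_self]; rfl
        · rw [if_pos (by omega), ih, if_neg (by omega), Nat.mod_eq_of_lt (by omega)]; rfl
      · rw [if_neg (by omega), if_neg (by omega), ih, if_neg (by omega), if_neg h2]

lemma sT_cyc_pow {N : ℕ} (hN : N ≠ 0) (d i : ℕ) (hi : i < N) :
    (wpr sT (List.range' 0 (N - 1)) ^ d) i = (i + d) % N := by
  induction d with
  | zero => simp [Nat.mod_eq_of_lt hi]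
  | succ d ih =>
    rw [pow_succ', Equiv.Perm.mul_apply, ih, sT_up]
    have hlt := Nat.mod_lt (i + d) (Nat.pos_of_ne_zero hN)
    rw [← add_assoc, Nat.add_mod (i + d) 1 N]
    rcases Nat.lt_or_ge 1 N with h1 | h1
    · rw [Nat.mod_eq_of_lt h1]
      by_cases h2 : (i + d) % N = N - 1
      · rw [if_neg (by omega), if_pos (by omega), h2, show N - 1 + 1 = N by omega, Nat.mod_self]
      · have h3 : (i + d) % N + 1 < N := by omega
        rw [if_pos (by omega), Nat.mod_eq_of_lt h3]
    · have : N = 1 := by omega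
      subst this
      simp [Nat.mod_one]

/-- the conjugating permutation -/
def cjp (k d : ℕ) (hk : 0 < k) (hd : 0 < d) : Equiv.Perm ℕ where
  toFun i := if i < d * k then i / k + (i % k) * d else i
  invFun i := if i < d * k then (i % d) * k + i / d else i
  left_inv i := by
    by_cases h : i < d * k
    · have a : i / k < d := (Nat.div_lt_iff_lt_mul hk).2 h
      have b := Nat.mod_lt i hk
      have c : i / k + i % k * d < d * k := by nlinarith
      simp only [h, if_true, c]
      rw [Nat.add_mul_mod_self_right, Nat.mod_eq_of_lt a, Nat.add_mul_div_right _ _ hd,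
        Nat.div_eq_of_lt a, zero_add, mul_comm, Nat.div_add_mod]
    · simp [h]
  right_inv i := by
    by_cases h : i < d * k
    · have a : i / d < k := (Nat.div_lt_iff_lt_mul hd).2 (by rwa [mul_comm])
      have b := Nat.mod_lt i hd
      have c : i % d * k + i / d < d * k := by nlinarith
      simp only [h, if_true, c]
      rw [add_comm (i % d * k), Nat.add_mul_mod_self_right, Nat.mod_eq_of_lt a,
        Nat.add_mul_div_right _ _ hk,
        Nat.div_eq_of_lt a, zero_add, mul_comm, Nat.mod_add_div]
    · simp [h]

lemma blk_lt {k : ℕ} (hk : 0 < k) (m : ℕ) : ∀ i ∈ blk k m, i + 1 < m * k := by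
  induction m with
  | zero => simp [blk]
  | succ m ih =>
    intro i hi
    have e : (m + 1) * k = m * k + k := by ring
    rw [blk] at hi
    rcases List.mem_append.1 hi with hi | hi
    · have := ih i hi; omega
    · rw [List.mem_range'_1] at hi; omega

/-- The power of the cyclic word is conjugate to the block word. -/
theorem cox_conj {T : ℕ → M} {k d : ℕ} (hk : 0 < k) (hd : 0 < d) (h : BraidRel T (d * k - 1))
    (hsq : ∀ i, i < d * k - 1 → T i * T i = 1) :
    ∃ g g' : M, g' * g = 1 ∧ (upP T 0 (d * k - 1)) ^ d * g = g * wpr T (blk k d) := by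
  have hN : 0 < d * k := Nat.mul_pos hd hk
  obtain ⟨u, hu, hue⟩ := sT_surj (d * k - 1) (cjp k d hk hd) (by
    intro x hx
    simp only [cjp, Equiv.coe_fn_mk]
    rw [if_neg (by omega)])
  refine ⟨wpr T u, wpr T u.reverse, wpr_reverse hsq u hu, ?_⟩
  have hpow : ∀ {M' : Type _} [Monoid M'] (T' : ℕ → M') (v : List ℕ) (e : ℕ),
      wpr T' v ^ e = wpr T' (List.replicate e v).flatten := by
    intro M' _ T' v e
    induction e with
    | zero => simp [wpr]
    | succ e ih => rw [pow_succ', ih, List.replicate_succ, List.flatten_cons, wpr_append]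
  have hb : ∀ i ∈ blk k d, i < d * k - 1 := fun i hi => by have := blk_lt hk d i hi; omega
  rw [upP_eq_wpr, hpow, ← wpr_append, ← wpr_append]
  refine cox_eq h hsq _ _ ?_ ?_ ?_
  · intro i hi
    rcases List.mem_append.1 hi with hi | hi
    · rw [List.mem_flatten] at hi
      obtain ⟨l, hl, hi⟩ := hi
      rw [List.eq_of_mem_replicate hl, List.mem_range'_1] at hi
      omega
    · exact hu i hi
  · intro i hi
    rcases List.mem_append.1 hi with hi | hi
    · exact hu i hi
    · exact hb i hi
  · have hp2 : ∀ (v : List ℕ) (e : ℕ),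
      wpr sT v ^ e = wpr sT (List.replicate e v).flatten := by
      intro v e
      induction e with
      | zero => simp [wpr]
      | succ e ih => rw [pow_succ', ih, List.replicate_succ, List.flatten_cons, wpr_append]
    rw [wpr_append, wpr_append, hue, ← hp2]
    ext i
    rw [Equiv.Perm.mul_apply, Equiv.Perm.mul_apply, sT_blk (by omega)]
    by_cases hi : i < d * k
    · rw [if_pos hi]
      have a : i / k < d := (Nat.div_lt_iff_lt_mul hk).2 hi
      have b := Nat.mod_lt i hk
      have b' := Nat.mod_lt (i % k + 1) hk
      have c : i / k + i % k * d < d * k := by nlinarith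
      have c' : i / k * k + (i % k + 1) % k < d * k := by nlinarith
      simp only [cjp, Equiv.coe_fn_mk, if_pos hi, if_pos c']
      rw [sT_cyc_pow (by omega) d _ c, mul_comm (i / k), Nat.mul_add_div hk, Nat.mul_add_mod,
        Nat.mod_mod, Nat.div_eq_of_lt b', add_zero]
      by_cases hr : i % k + 1 = k
      · rw [hr, Nat.mod_self, zero_mul, add_zero]
        have : i / k + i % k * d + d = i / k + d * k := by
          have : d * k = d * (i % k + 1) := by rw [hr]
          rw [this]
          ring
        rw [this, Nat.add_mod_right, Nat.mod_eq_of_lt (by nlinarith)]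
      · rw [Nat.mod_eq_of_lt (by omega : i % k + 1 < k), Nat.mod_eq_of_lt]
        · ring
        · have : i % k + 2 ≤ k := by omega
          nlinarith
    · rw [if_neg hi]
      simp only [cjp, Equiv.coe_fn_mk, if_neg hi]
      have hfix : wpr sT (List.range' 0 (d * k - 1)) i = i := by
        rw [sT_up, if_neg (by omega), if_neg (by omega)]
      exact Equiv.Perm.pow_apply_eq_self_of_apply_eq_self hfix d
end cox

/-! Abstract Murnaghan-Nakayama computation -/

section mn
variable {R : Type*} [Ring R] [Algebra ℝ R]

/-- weighted sum of words of length `k+1` over `range M` with last letter `c` -/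
noncomputable def qq (E : ℕ → R) (M : ℕ) : ℕ → ℕ → R
  | 0, c => E c
  | k + 1, c' => E c' * ∑ c ∈ Finset.range M, (1 / ((c' : ℝ) - c)) • qq E M k c

/-- sum over the last letter -/
noncomputable def QQ (E : ℕ → R) (M k : ℕ) : R := ∑ c ∈ Finset.range M, qq E M k c

variable {E : ℕ → R}

lemma qq_left (hsq : ∀ c, E c * E c = 0) (hZ2 : ∀ c M, c < M → E c * E M * E c = 0) {c M : ℕ} (h : c < M)
    (N k : ℕ) : E c * E M * qq E N k c = 0 := by
  cases k with
  | zero => rw [qq, hZ2 c M h]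
  | succ k => rw [qq, ← mul_assoc, hZ2 c M h, zero_mul]

lemma comm_x (hcomm : ∀ i j, i + 2 ≤ j → E i * E j = E j * E i) {c M : ℕ} (h : c < M) :
    (1 / ((M : ℝ) - c)) • (E M * E c - E c * E M) = E M * E c - E c * E M := by
  by_cases h1 : c + 2 ≤ M
  · rw [hcomm c M h1]; simp
  · have : M = c + 1 := by omega
    subst this
    simp

lemma qq_step (hcomm : ∀ i j, i + 2 ≤ j → E i * E j = E j * E i) (hsq : ∀ c, E c * E c = 0)
    (hZ2 : ∀ c M, c < M → E c * E M * E c = 0)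
    (hZ1 : ∀ M k c, c < M → E M * qq E M k c * E M = 0) (M k : ℕ) :
    (∀ c, c < M → qq E (M + 1) (k + 1) c = qq E M (k + 1) c + (E M * qq E M k c - qq E M k c * E M)
      - (1 / ((M : ℝ) - c)) • (E M * qq E M k c)) ∧
    qq E (M + 1) (k + 1) M = E M * ∑ c ∈ Finset.range M, (1 / ((M : ℝ) - c)) • qq E M k c := by
  induction k with
  | zero =>
    constructor
    · intro c hc
      rw [qq, qq, Finset.sum_range_succ, mul_add]
      simp only [qq]
      have := comm_x hcomm hc
      have e : (1 / ((c : ℝ) - M)) = - (1 / ((M : ℝ) - c)) := by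
        rw [← neg_sub, one_div, one_div, ← neg_inv]
      rw [add_sub_assoc]
      congr 1
      rw [e, neg_smul, ← this, smul_sub, mul_neg, mul_smul_comm]
      abel
    · rw [qq, Finset.sum_range_succ, mul_add]
      simp [qq]
  | succ k ih =>
    obtain ⟨ih1, ih2⟩ := ih
    constructor
    · intro c' hc'
      have hx : (M : ℝ) - c' ≠ 0 := by
        have : (c' : ℝ) < M := by exact_mod_cast hc'
        linarith
      have e : (1 / ((c' : ℝ) - M)) = - (1 / ((M : ℝ) - c')) := by
        rw [← neg_sub, one_div, one_div, ← neg_inv]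
      set Y := ∑ c ∈ Finset.range M, (1 / ((c' : ℝ) - c)) • qq E M k c with hY
      have hq : qq E M (k + 1) c' = E c' * Y := rfl
      have hL : qq E (M + 1) (k + 2) c' = E c' * (∑ c ∈ Finset.range M, (1 / ((c' : ℝ) - c)) • qq E M (k + 1) c
          + (E M * Y - Y * E M)
          - E M * (∑ c ∈ Finset.range M, ((1 / ((c' : ℝ) - c)) * (1 / ((M : ℝ) - c)) + (1 / ((M : ℝ) - c')) * (1 / ((M : ℝ) - c))) • qq E M k c)) := by
        rw [qq, Finset.sum_range_succ, ih2]
        rw [Finset.sum_congr rfl (fun c hc => by rw [ih1 c (Finset.mem_range.1 hc)])]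
        congr 1
        simp only [smul_sub, smul_add, Finset.sum_add_distrib, Finset.sum_sub_distrib, add_smul, mul_add, hY,
          Finset.mul_sum, Finset.sum_mul, mul_smul_comm, smul_mul_assoc, Finset.smul_sum, smul_smul, e, neg_mul, neg_smul,
          Finset.sum_neg_distrib]
        abel
      have hS : ∑ c ∈ Finset.range M, ((1 / ((c' : ℝ) - c)) * (1 / ((M : ℝ) - c)) + (1 / ((M : ℝ) - c')) * (1 / ((M : ℝ) - c))) • qq E M k c
          = (1 / ((M : ℝ) - c')) • Y + ((1 / ((M : ℝ) - c')) * (1 / ((M : ℝ) - c'))) • qq E M k c' := by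
        rw [hY, Finset.smul_sum]
        rw [← Finset.add_sum_erase _ _ (Finset.mem_range.2 hc'), ← Finset.add_sum_erase _ (fun c : ℕ => (1 / ((M : ℝ) - c')) • (1 / ((c' : ℝ) - c)) • qq E M k c) (Finset.mem_range.2 hc')]
        have : ∀ c ∈ (Finset.range M).erase c', ((1 / ((c' : ℝ) - c)) * (1 / ((M : ℝ) - c)) + (1 / ((M : ℝ) - c')) * (1 / ((M : ℝ) - c))) • qq E M k c
            = (1 / ((M : ℝ) - c')) • (1 / ((c' : ℝ) - c)) • qq E M k c := by
          intro c hc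
          rw [Finset.mem_erase, Finset.mem_range] at hc
          rw [smul_smul]
          congr 1
          have h1 : (c' : ℝ) - c ≠ 0 := sub_ne_zero.2 (by exact_mod_cast hc.1.symm)
          have h2 : (M : ℝ) - c ≠ 0 := by
            have : (c : ℝ) < M := by exact_mod_cast hc.2
            linarith
          field_simp
          ring
        rw [Finset.sum_congr rfl this]
        simp
        abel
      have hz : E c' * E M * qq E M k c' = 0 := qq_left hsq hZ2 hc' M k
      have hz' : E c' * (E M * qq E M k c') = 0 := by rw [← mul_assoc, hz]
      have hcx := comm_x hcomm hc'
      rw [hL, hS, hq]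
      have hq2 : qq E M (k + 2) c' = E c' * ∑ c ∈ Finset.range M, (1 / ((c' : ℝ) - c)) • qq E M (k + 1) c := rfl
      rw [hq2]
      have key : - (1 / ((M : ℝ) - c')) • (E c' * E M * Y) =
          (E M * E c' - E c' * E M) * Y - (1 / ((M : ℝ) - c')) • (E M * E c' * Y) := by
        rw [← hcx, smul_mul_assoc, sub_mul, smul_sub, neg_smul]
        abel
      rw [mul_sub, mul_add, mul_add, mul_add, mul_smul_comm, mul_smul_comm, mul_smul_comm, mul_smul_comm, hz', smul_zero, add_zero]
      rw [sub_eq_add_neg (_ + _) ((1 / ((M : ℝ) - c')) • (E c' * (E M * Y))), ← neg_smul, ← mul_assoc (E c') (E M) Y, key]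
      noncomm_ring
    · rw [qq, Finset.sum_range_succ]
      rw [Finset.sum_congr rfl (fun c hc => by rw [ih1 c (Finset.mem_range.1 hc)])]
      rw [sub_self, div_zero, zero_smul, add_zero, Finset.mul_sum, Finset.mul_sum]
      refine Finset.sum_congr rfl fun c hc => ?_
      rw [mul_smul_comm, mul_smul_comm]
      congr 1
      have h1 := hZ1 M k c (Finset.mem_range.1 hc)
      have h2 : E M * (E M * qq E M k c) = 0 := by rw [← mul_assoc, hsq, zero_mul]
      have h3 : E M * (qq E M k c * E M) = 0 := by rw [← mul_assoc, h1]
      rw [mul_sub, mul_add, mul_sub, mul_smul_comm, h2, h3]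
      simp

lemma QQ_step (hcomm : ∀ i j, i + 2 ≤ j → E i * E j = E j * E i) (hsq : ∀ c, E c * E c = 0)
    (hZ2 : ∀ c M, c < M → E c * E M * E c = 0)
    (hZ1 : ∀ M k c, c < M → E M * qq E M k c * E M = 0) (M k : ℕ) :
    QQ E (M + 1) (k + 1) = QQ E M (k + 1) + (E M * QQ E M k - QQ E M k * E M) := by
  obtain ⟨h1, h2⟩ := qq_step hcomm hsq hZ2 hZ1 M k
  rw [QQ, Finset.sum_range_succ, h2, Finset.sum_congr rfl (fun c hc => h1 c (Finset.mem_range.1 hc))]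
  simp only [QQ, Finset.sum_add_distrib, Finset.sum_sub_distrib, Finset.mul_sum, Finset.sum_mul, mul_smul_comm]
  abel

/-- the Murnaghan-Nakayama rule -/
theorem QQ_eq (hcomm : ∀ i j, i + 2 ≤ j → E i * E j = E j * E i) (hsq : ∀ c, E c * E c = 0)
    (hZ2 : ∀ c M, c < M → E c * E M * E c = 0)
    (hZ1 : ∀ M k c, c < M → E M * qq E M k c * E M = 0)
    (e : ℕ → ℕ → R) (he : ∀ c, e c (c + 1) = E c)
    (hbr : ∀ M v u, v < u → u ≤ M → E M * e v u - e v u * E M = if u = M then e v (M + 1) else 0)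
    (M k : ℕ) : QQ E M k = ∑ v ∈ Finset.range (M - k), e v (v + k + 1) := by
  induction M generalizing k with
  | zero => simp [QQ]
  | succ M ih =>
    cases k with
    | zero => simp [QQ, qq, he]
    | succ k =>
      rw [QQ_step hcomm hsq hZ2 hZ1, ih, ih, Finset.mul_sum, Finset.sum_mul, ← Finset.sum_sub_distrib]
      rw [Finset.sum_congr (s₁ := Finset.range (M - k)) rfl (fun v hv => hbr M v (v + k + 1) (by omega)
        (by have := Finset.mem_range.1 hv; omega))]
      rcases Nat.lt_or_ge k M with h | h
      · obtain ⟨p, rfl⟩ : ∃ p, M = k + 1 + p := ⟨M - k - 1, by omega⟩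
        rw [show k + 1 + p + 1 - (k + 1) = p + 1 by omega, show k + 1 + p - k = p + 1 by omega,
          show k + 1 + p - (k + 1) = p by omega, Finset.sum_range_succ (fun v => if v + k + 1 = k + 1 + p then e v (k + 1 + p + 1) else 0)]
        have hz : ∑ v ∈ Finset.range p, (if v + k + 1 = k + 1 + p then e v (k + 1 + p + 1) else 0) = 0 :=
          Finset.sum_eq_zero (fun v hv => by
            have := Finset.mem_range.1 hv
            rw [if_neg (by omega)])
        rw [hz, if_pos (by omega), zero_add, Finset.sum_range_succ]
        rw [show p + (k + 1) + 1 = k + 1 + p + 1 by omega]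
      · rw [show M - (k + 1) = 0 by omega, show M - k = 0 by omega, show M + 1 - (k + 1) = 0 by omega]
        simp
end mn

lemma opTL_zero {d β : ℤ → ℝ} {v : ℕ → ℤ} {i : ℕ} {F : (ℕ → ℤ) → ℝ}
    (hF : ∀ w, w i ≠ v i → F w = 0) (l : List ℕ) (hl : ∀ j ∈ l, i < j) :
    ∀ w, w i ≠ v i → opTL d β l F w = 0 := by
  induction l with
  | nil => exact hF
  | cons j l ih =>
    intro w hw
    have hij := hl j (by simp)
    have ih := ih (fun j hj => hl j (by simp [hj]))
    rw [opTL, opT, ih w hw, ih (wsw j w) (by rwa [wsw_other w (by omega) (by omega)])]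
    simp

lemma opTL_diag {d β : ℤ → ℝ} {v : ℕ → ℤ} {F : (ℕ → ℤ) → ℝ}
    (hF : ∀ w, w ≠ v → F w = 0) (l : List ℕ) (hl : l.Pairwise (· < ·))
    (hv : ∀ j ∈ l, v j ≠ v (j + 1)) :
    opTL d β l F v = (l.map (fun j => d (v (j + 1) - v j))).prod * F v := by
  induction l with
  | nil => simp [opTL]
  | cons j l ih =>
    rw [List.pairwise_cons] at hl
    rw [opTL, opT, ih hl.2 (fun j hj => hv j (by simp [hj])),
      opTL_zero (v := v) (i := j) (fun w hw => hF w (fun h => hw (by rw [h]))) l hl.1 (wsw j v)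
        (by rw [wsw_left]; exact (hv j (by simp)).symm)]
    simp [mul_assoc]

lemma blk_sorted {k : ℕ} (hk : 0 < k) (m : ℕ) : (blk k m).Pairwise (· < ·) := by
  induction m with
  | zero => simp [blk]
  | succ m ih =>
    rw [blk, List.pairwise_append]
    refine ⟨ih, List.pairwise_lt_range', ?_⟩
    intro a ha b hb
    have h1 := blk_lt hk m a ha
    rw [List.mem_range'] at hb
    obtain ⟨i, hi, rfl⟩ := hb
    omega

/-- block weight of a word -/
noncomputable def bwt (k d : ℕ) (w : ℕ → ℤ) : ℝ := ((blk k d).map fun j => 1 / ((w (j + 1) - w j : ℤ) : ℝ)).prod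

theorem fix_eq_sum {n k d : ℕ} (hn : n ≠ 0) (hk : 0 < k) (hd : 0 < d) (hN : n * n = d * k) :
    (-1) ^ ((n - 1) * d) * ({T | WA n T ∧ wprom^[d] T = T}.ncard : ℝ) =
      ∑ T ∈ (WA_finite n).toFinset, bwt k d (wfun T) := by
  classical
  let _ : Fintype (WW n) := (WW_finite n).fintype
  have hl : n * n = (d * k - 1) + 1 := by
    have := Nat.mul_pos hd hk
    omega
  rw [← fix_eq_trace hn hl d]
  have hW : WSet (d * k) (WW n) := hN ▸ WW_wset n
  obtain ⟨g, g', hg, he⟩ := cox_conj (T := rT (WW n) (aq 1) (bq 1)) hk hd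
    (rT_braidRel hW hd1 (bq_one 1)) (fun i hi => rT_sq hW hd1 (bq_one 1) rfl (by omega))
  have hg2 : g * g' = 1 := by
    have : LinearMap.toMatrix' g' * LinearMap.toMatrix' g = 1 := by
      rw [← LinearMap.toMatrix'_mul, hg, LinearMap.toMatrix'_one]
    have := mul_eq_one_comm.1 this
    rw [← LinearMap.toMatrix'_mul] at this
    exact LinearMap.toMatrix'.injective (by rw [this, LinearMap.toMatrix'_one])
  have hP : upP (rT (WW n) (aq 1) (bq 1)) 0 (d * k - 1) ^ d = g * wpr (rT (WW n) (aq 1) (bq 1)) (blk k d) * g' := by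
    rw [← he, mul_assoc, hg2, mul_one]
  rw [hP, LinearMap.toMatrix'_mul, Matrix.trace_mul_comm, ← LinearMap.toMatrix'_mul, ← mul_assoc, hg, one_mul, Matrix.trace]
  have : ∀ w : WW n, (LinearMap.toMatrix' (wpr (rT (WW n) (aq 1) (bq 1)) (blk k d))).diag w = bwt k d w := by
    intro w
    rw [Matrix.diag, LinearMap.toMatrix'_apply]
    rw [wpr]
    refine Eq.trans (congrFun (congrArg _ (?_ : _ = Pi.single w 1)) w) ?_
    · funext v; rw [Pi.single_apply]
    refine (rT_list hW (bq_one 1) (bq_neg_one 1) (blk k d) (blk_lt hk d) (Pi.single w 1) w).trans ?_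
    rw [opTL_diag (v := (w : ℕ → ℤ)), ext0_mem, Pi.single_eq_same, mul_one, bwt]
    · simp only [aq_at_one]
    · intro v hv
      rw [ext0]
      split_ifs with h
      · rw [Pi.single_eq_of_ne]
        intro h2
        exact hv (by rw [← h2])
      · rfl
    · exact blk_sorted hk d
    · intro j hj
      exact hW.ne w w.2 j (blk_lt hk d j hj)
  rw [Finset.sum_congr rfl (fun w _ => this w)]
  symm
  refine Finset.sum_bij (fun T hT => (⟨wfun T, T, (WA_finite n).mem_toFinset.1 hT, rfl⟩ : WW n)) ?_ ?_ ?_ ?_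
  · intros; simp
  · intro a ha b hb hab
    rw [Set.Finite.mem_toFinset] at ha hb
    exact wfun_inj (by rw [ha.2, hb.2]) (Subtype.ext_iff.1 hab)
  · rintro ⟨w, T, h, rfl⟩ _
    exact ⟨T, (Set.Finite.mem_toFinset _).2 h, rfl⟩
  · intros; rfl

/-! Fermionic operators on antisymmetric functions -/

section fock
variable {n : ℕ}

/-- move one coordinate from `u` to `v` -/
noncomputable def eop (v u : ℤ) (φ : (Fin n → ℤ) → ℝ) (β : Fin n → ℤ) : ℝ :=
  ∑ i, if β i = u then φ (Function.update β i v) else 0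

/-- antisymmetric functions -/
def Anti (n : ℕ) : Submodule ℝ ((Fin n → ℤ) → ℝ) where
  carrier := {φ | ∀ i j, i ≠ j → ∀ β, φ (β ∘ Equiv.swap i j) = - φ β}
  zero_mem' := by intro i j _ β; simp
  add_mem' := by
    intro a b ha hb i j h β
    simp only [Pi.add_apply, ha i j h, hb i j h]; ring
  smul_mem' := by
    intro c a ha i j h β
    simp only [Pi.smul_apply, ha i j h, smul_eq_mul]; ring

lemma anti_zero {φ : (Fin n → ℤ) → ℝ} (hφ : φ ∈ Anti n) {β : Fin n → ℤ} {i j : Fin n} (h : i ≠ j)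
    (hb : β i = β j) : φ β = 0 := by
  have := hφ i j h β
  have e : β ∘ Equiv.swap i j = β := by
    funext l
    simp only [Function.comp_apply]
    rcases eq_or_ne l i with rfl | h1
    · rw [Equiv.swap_apply_left, hb]
    · rcases eq_or_ne l j with rfl | h2
      · rw [Equiv.swap_apply_right, hb]
      · rw [Equiv.swap_apply_of_ne_of_ne h1 h2]
  rw [e] at this
  linarith

lemma update_swap (β : Fin n → ℤ) (i j l : Fin n) (v : ℤ) :
    Function.update (β ∘ Equiv.swap i j) l v = (Function.update β (Equiv.swap i j l) v) ∘ Equiv.swap i j := by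
  funext m
  by_cases h : m = l
  · subst h; simp
  · have : Equiv.swap i j m ≠ Equiv.swap i j l := fun hh => h ((Equiv.swap i j).injective hh)
    simp [h, this]

lemma eop_anti (v u : ℤ) {φ : (Fin n → ℤ) → ℝ} (hφ : φ ∈ Anti n) : eop v u φ ∈ Anti n := by
  intro i j h β
  simp only [eop]
  rw [← Finset.sum_neg_distrib]
  rw [← Equiv.sum_comp (Equiv.swap i j)]
  refine Finset.sum_congr rfl fun l _ => ?_
  rw [update_swap, hφ i j h]
  simp only [Function.comp_apply, Equiv.swap_apply_self]
  split_ifs <;> simp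

/-- the operator on antisymmetric functions -/
noncomputable def eA (n : ℕ) (v u : ℤ) : Module.End ℝ (Anti n) where
  toFun φ := ⟨eop v u φ.1, eop_anti v u φ.2⟩
  map_add' a b := by
    ext β
    simp only [eop, Submodule.coe_add, Pi.add_apply, ← Finset.sum_add_distrib]
    refine Finset.sum_congr rfl fun l _ => ?_
    split_ifs <;> simp
  map_smul' c a := by
    ext β
    simp only [eop, Submodule.coe_smul, Pi.smul_apply, smul_eq_mul, Finset.mul_sum, RingHom.id_apply]
    refine Finset.sum_congr rfl fun l _ => ?_
    split_ifs <;> simp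

lemma eA_apply (v u : ℤ) (φ : Anti n) : (eA n v u φ).1 = eop v u φ.1 := rfl

lemma eop_eop (v' u' v u : ℤ) (φ : (Fin n → ℤ) → ℝ) (β : Fin n → ℤ) :
    eop v' u' (eop v u φ) β = (∑ i, ∑ j, if i ≠ j ∧ β i = u' ∧ β j = u then
        φ (Function.update (Function.update β i v') j v) else 0) + if v' = u then eop v u' φ β else 0 := by
  have : (if v' = u then eop v u' φ β else 0) = ∑ i, if β i = u' then (if v' = u then φ (Function.update β i v) else 0) else 0 := by
    split_ifs with h
    · rfl
    · simp
  rw [this, ← Finset.sum_add_distrib, eop]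
  refine Finset.sum_congr rfl fun i _ => ?_
  by_cases hi : β i = u'
  · rw [if_pos hi, if_pos hi, eop]
    rw [← Finset.add_sum_erase _ _ (Finset.mem_univ i)]
    rw [← Finset.add_sum_erase _ (fun j => if i ≠ j ∧ β i = u' ∧ β j = u then
        φ (Function.update (Function.update β i v') j v) else 0) (Finset.mem_univ i)]
    rw [if_neg (by simp : ¬ (i ≠ i ∧ β i = u' ∧ β i = u)), zero_add, add_comm]
    congr 1
    · refine Finset.sum_congr rfl fun j hj => ?_
      have hj := (Finset.mem_erase.1 hj).1
      rw [Function.update_of_ne hj]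
      simp [hj.symm, hi]
    · simp
  · rw [if_neg hi, if_neg hi]
    simp [hi]

lemma eop_comm (v' u' v u : ℤ) (φ : (Fin n → ℤ) → ℝ) (β : Fin n → ℤ) :
    eop v' u' (eop v u φ) β - eop v u (eop v' u' φ) β =
      (if v' = u then eop v u' φ β else 0) - if v = u' then eop v' u φ β else 0 := by
  rw [eop_eop, eop_eop, Finset.sum_comm]
  have : ∀ i j : Fin n, (if j ≠ i ∧ β j = u' ∧ β i = u then
        φ (Function.update (Function.update β j v') i v) else 0) = if i ≠ j ∧ β i = u ∧ β j = u' then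
        φ (Function.update (Function.update β i v) j v') else 0 := by
    intro i j
    by_cases h : i = j
    · subst h; simp
    · rw [Function.update_comm (Ne.symm h)]
      refine if_congr ?_ rfl rfl
      constructor
      · rintro ⟨a, b, c⟩; exact ⟨h, c, b⟩
      · rintro ⟨a, b, c⟩; exact ⟨Ne.symm h, c, b⟩
  simp only [this]
  ring

/-- the hop operator -/
noncomputable abbrev Ez (n : ℕ) (c : ℤ) : Module.End ℝ (Anti n) := eA n c (c + 1)

lemma Ez_comm {i j : ℤ} (h : i + 2 ≤ j) : Ez n i * Ez n j = Ez n j * Ez n i := by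
  refine LinearMap.ext fun φ => Subtype.ext (funext fun β => ?_)
  have := eop_comm i (i + 1) j (j + 1) φ.1 β
  rw [if_neg (by omega), if_neg (by omega), sub_zero, sub_eq_zero] at this
  exact this

lemma Ez_van (c : ℤ) (φ : Anti n) (β : Fin n → ℤ) (i : Fin n) (hi : β i = c) : (Ez n c φ).1 β = 0 := by
  rw [eA_apply, eop]
  refine Finset.sum_eq_zero fun j _ => ?_
  split_ifs with h
  · have hij : i ≠ j := by rintro rfl; omega
    exact anti_zero φ.2 hij (by rw [Function.update_of_ne hij]; simp [hi])
  · rfl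

lemma Ez_sq (c : ℤ) : Ez n c * Ez n c = 0 := by
  refine LinearMap.ext fun φ => Subtype.ext (funext fun β => ?_)
  rw [Module.End.mul_apply, eA_apply, eop]
  refine Finset.sum_eq_zero fun j _ => ?_
  split_ifs with h
  · exact Ez_van c φ _ j (by simp)
  · rfl

lemma Ez_Z2 {c M : ℤ} (h : c < M) : Ez n c * Ez n M * Ez n c = 0 := by
  refine LinearMap.ext fun φ => Subtype.ext (funext fun β => ?_)
  rw [Module.End.mul_apply, Module.End.mul_apply, eA_apply, eop]
  refine Finset.sum_eq_zero fun j _ => ?_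
  split_ifs with hj
  · rw [eA_apply, eop]
    refine Finset.sum_eq_zero fun i _ => ?_
    split_ifs with hi
    · have hij : j ≠ i := by
        rintro rfl
        simp at hi; omega
      exact Ez_van c φ _ j (by rw [Function.update_of_ne hij]; simp)
    · rfl
  · rfl

/-- functions vanishing when no coordinate is `M+1` -/
def PM (n : ℕ) (M : ℤ) : Submodule ℝ (Anti n) where
  carrier := {φ | ∀ β : Fin n → ℤ, (∀ i, β i ≠ M + 1) → φ.1 β = 0}
  zero_mem' := by intro β _; rfl
  add_mem' := by
    intro a b ha hb β h
    simp [ha β h, hb β h]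
  smul_mem' := by
    intro c a ha β h
    simp [ha β h]

lemma PM_pres {c M : ℤ} (h : c < M) {φ : Anti n} (hφ : φ ∈ PM n M) : Ez n c φ ∈ PM n M := by
  intro β hb
  rw [eA_apply, eop]
  refine Finset.sum_eq_zero fun j _ => ?_
  split_ifs with hj
  · refine hφ _ fun i => ?_
    by_cases hij : i = j
    · subst hij; simp; omega
    · rw [Function.update_of_ne hij]; exact hb i
  · rfl

lemma PM_qq {M : ℕ} (k c : ℕ) (h : c < M) {φ : Anti n} (hφ : φ ∈ PM n M) :
    qq (fun c : ℕ => Ez n (c : ℤ)) M k c φ ∈ PM n M := by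
  induction k generalizing c with
  | zero => exact PM_pres (by exact_mod_cast h) hφ
  | succ k ih =>
    rw [qq, Module.End.mul_apply]
    refine PM_pres (by exact_mod_cast h) ?_
    rw [LinearMap.sum_apply]
    refine Submodule.sum_mem _ fun c hc => ?_
    rw [LinearMap.smul_apply]
    exact Submodule.smul_mem _ _ (ih c (Finset.mem_range.1 hc))

lemma Ez_Z1 (M k c : ℕ) (h : c < M) :
    Ez n (M : ℤ) * qq (fun c : ℕ => Ez n (c : ℤ)) M k c * Ez n (M : ℤ) = 0 := by
  refine LinearMap.ext fun φ => Subtype.ext (funext fun β => ?_)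
  rw [Module.End.mul_apply, Module.End.mul_apply]
  have h1 : Ez n (M : ℤ) φ ∈ PM n M := by
    intro β hb
    rw [eA_apply, eop]
    refine Finset.sum_eq_zero fun j _ => ?_
    rw [if_neg (hb j)]
  have h2 := PM_qq k c h h1
  set ψ := qq (fun c : ℕ => Ez n (c : ℤ)) M k c (Ez n (M : ℤ) φ)
  by_cases hb : ∃ i j, i ≠ j ∧ β i = M + 1 ∧ β j = M + 1
  · obtain ⟨i, j, hij, hi, hj⟩ := hb
    exact anti_zero (Ez n (M : ℤ) ψ).2 hij (by rw [hi, hj])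
  · push Not at hb
    rw [eA_apply, eop]
    refine Finset.sum_eq_zero fun j _ => ?_
    split_ifs with hj
    · refine h2 _ fun i => ?_
      by_cases hij : i = j
      · subst hij; simp
      · rw [Function.update_of_ne hij]; exact hb j i (Ne.symm hij) hj
    · rfl

theorem QQ_Ez (M k : ℕ) : QQ (fun c : ℕ => Ez n (c : ℤ)) M k =
    ∑ v ∈ Finset.range (M - k), eA n v (v + k + 1) := by
  rw [QQ_eq (E := fun c : ℕ => Ez n (c : ℤ)) (fun i j h => Ez_comm (by exact_mod_cast h)) (fun c => Ez_sq _)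
    (fun c M h => Ez_Z2 (by exact_mod_cast h)) (fun M k c h => Ez_Z1 M k c h)
    (fun v u => eA n v u) (fun c => by push_cast; rfl)]
  · refine Finset.sum_congr rfl fun v _ => ?_
    push_cast; rfl
  · intro M v u h1 h2
    refine LinearMap.ext fun φ => Subtype.ext (funext fun β => ?_)
    have := eop_comm M (M + 1) v u φ.1 β
    rw [if_neg (show (v : ℤ) ≠ M + 1 by omega), sub_zero] at this
    refine this.trans ?_
    by_cases h : u = M
    · subst h; simp; rfl
    · rw [if_neg h, if_neg (by omega)]; rfl
end fock

section words

/-- words of length `L` over the letters `0..M-1` -/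
def lw (M : ℕ) : ℕ → Finset (List ℤ)
  | 0 => {[]}
  | L + 1 => (lw M L ×ˢ Finset.range M).image (fun p => p.1 ++ [(p.2 : ℤ)])

lemma sum_lw {A : Type*} [AddCommMonoid A] (M L : ℕ) (f : List ℤ → A) :
    ∑ T ∈ lw M (L + 1), f T = ∑ T ∈ lw M L, ∑ c ∈ Finset.range M, f (T ++ [(c : ℤ)]) := by
  rw [lw, Finset.sum_image, Finset.sum_product]
  rintro ⟨a, b⟩ _ ⟨c, d⟩ _ h
  simp at h
  rw [Prod.mk.injEq]
  exact h

lemma mem_lw (M L : ℕ) (T : List ℤ) : T ∈ lw M L ↔ T.length = L ∧ ∀ x ∈ T, 0 ≤ x ∧ x < M := by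
  induction L generalizing T with
  | zero => simp [lw]; rintro rfl; simp
  | succ L ih =>
    rw [lw, Finset.mem_image]
    constructor
    · rintro ⟨⟨a, b⟩, h, rfl⟩
      rw [Finset.mem_product, ih, Finset.mem_range] at h
      obtain ⟨⟨h1, h2⟩, h3⟩ := h
      refine ⟨by simp [h1], ?_⟩
      intro x hx
      rw [List.mem_append, List.mem_singleton] at hx
      rcases hx with hx | rfl
      · exact h2 x hx
      · simp at h3 ⊢; omega
    · rintro ⟨h1, h2⟩
      rcases List.eq_nil_or_concat T with rfl | ⟨a, b, rfl⟩
      · simp at h1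
      · rw [List.concat_eq_append] at *
        refine ⟨(a, b.toNat), ?_, ?_⟩
        · rw [Finset.mem_product, ih, Finset.mem_range]
          have := h2 b (by simp)
          refine ⟨⟨by simpa using h1, fun x hx => h2 x (by simp [hx])⟩, by dsimp; omega⟩
        · have := h2 b (by simp)
          dsimp
          rw [Int.toNat_of_nonneg this.1]

variable {R : Type*} [Ring R] [Algebra ℝ R]

/-- operator of a word, last letter leftmost -/
def EE (E : ℤ → R) (T : List ℤ) : R := (T.reverse.map E).prod

lemma EE_snoc (E : ℤ → R) (T : List ℤ) (c : ℤ) : EE E (T ++ [c]) = E c * EE E T := by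
  simp [EE]

/-- weight of positions -/
noncomputable def pwt (l : List ℕ) (w : ℕ → ℤ) : ℝ := (l.map fun j => 1 / ((w (j + 1) - w j : ℤ) : ℝ)).prod

lemma pwt_append_left (l : List ℕ) (T T' : List ℤ) (h : ∀ j ∈ l, j + 1 < T.length) :
    pwt l (wfun (T ++ T')) = pwt l (wfun T) := by
  unfold pwt
  congr 1
  refine List.map_congr_left fun j hj => ?_
  have := h j hj
  rw [wfun_append_left _ _ this, wfun_append_left _ _ (by omega)]

lemma qq_words (E : ℤ → R) (M : ℕ) {k : ℕ} (hk : 0 < k) (d : ℕ) (A : R)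
    (hA : A = ∑ T ∈ lw M (d * k), pwt (blk k d) (wfun T) • EE E T) (r : ℕ) (c : ℕ) :
    qq (fun c : ℕ => E c) M r c * A = ∑ T ∈ lw M (d * k + r),
      pwt (blk k d ++ List.range' (d * k) r) (wfun (T ++ [(c : ℤ)])) • EE E (T ++ [(c : ℤ)]) := by
  induction r generalizing c with
  | zero =>
    rw [qq, hA, Finset.mul_sum]
    refine Finset.sum_congr rfl fun T hT => ?_
    rw [mem_lw] at hT
    rw [EE_snoc, mul_smul_comm, List.range'_zero, List.append_nil, pwt_append_left]
    intro j hj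
    rw [hT.1]; exact blk_lt hk d j hj
  | succ r ih =>
    rw [qq, mul_assoc, Finset.sum_mul, ← add_assoc, sum_lw, Finset.mul_sum, Finset.sum_comm]
    refine Finset.sum_congr rfl fun c' _ => ?_
    rw [smul_mul_assoc, ih, Finset.smul_sum, Finset.mul_sum]
    refine Finset.sum_congr rfl fun T hT => ?_
    rw [mem_lw] at hT
    rw [EE_snoc E (T ++ [(c' : ℤ)]), smul_smul, mul_smul_comm]
    congr 1
    have e : List.range' (d * k) (r + 1) = List.range' (d * k) r ++ [d * k + r] := by
      rw [List.range'_concat]; simp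
    have e2 : pwt (blk k d ++ List.range' (d * k) (r + 1)) (wfun (T ++ [(c' : ℤ)] ++ [(c : ℤ)])) =
      pwt (blk k d ++ List.range' (d * k) r) (wfun (T ++ [(c' : ℤ)] ++ [(c : ℤ)])) * (1 / ((c : ℝ) - c')) := by
      rw [e, ← List.append_assoc, pwt, pwt, List.map_append, List.prod_append]
      congr 1
      rw [List.append_assoc]
      rw [← hT.1]
      simp only [List.map_cons, List.map_nil, List.prod_cons, List.prod_nil, List.singleton_append, mul_one]
      rw [wfun_mid1, wfun_mid]
      push_cast; rfl
    rw [e2, mul_comm, pwt_append_left _ (T ++ [(c' : ℤ)])]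
    intro j hj
    rw [List.length_append, hT.1]
    rw [List.mem_append, List.mem_range'] at hj
    rcases hj with hj | ⟨i, hi, rfl⟩
    · have := blk_lt hk d j hj
      omega
    · simp; omega

lemma QQ_words (E : ℤ → R) (M : ℕ) {k : ℕ} (d : ℕ) :
    QQ (fun c : ℕ => E c) M k ^ d = ∑ T ∈ lw M (d * (k + 1)), pwt (blk (k + 1) d) (wfun T) • EE E T := by
  induction d with
  | zero => simp [lw, blk, pwt, EE]
  | succ d ih =>
    rw [pow_succ', QQ, Finset.sum_mul]
    rw [show (d + 1) * (k + 1) = (d * (k + 1) + k) + 1 by ring, sum_lw, Finset.sum_comm]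
    refine Finset.sum_congr rfl fun c _ => ?_
    exact qq_words E M (by omega) d _ ih k c
end words

section eval
variable {n : ℕ}

/-- initial antisymmetric function -/
noncomputable def phi0 (n : ℕ) : Anti n := ⟨fun β => (Matrix.of fun i j : Fin n =>
  if β i = (j : ℤ) + 1 then (1 : ℝ) else 0).det, by
    intro i j h β
    have := Matrix.det_permute (Equiv.swap i j) (Matrix.of fun i j : Fin n =>
      if β i = (j : ℤ) + 1 then (1 : ℝ) else 0)
    rw [Equiv.Perm.sign_swap h] at this
    simpa [Matrix.submatrix] using this⟩

lemma phi0_eval {β : Fin n → ℤ} (hβ : StrictMono β) : open Classical in (phi0 n).1 β =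
    if Set.range β = sqA n then 1 else 0 := by
  classical
  split_ifs with h
  · have : β = fun j : Fin n => (j : ℤ) + 1 := by
      refine StrictMono.range_inj hβ ?_ |>.1 ?_
      · intro i j hij
        have : (i : ℕ) < j := hij
        dsimp; omega
      · rw [h]
        ext y
        simp only [sqA, Set.mem_ofPred_eq, Set.mem_range]
        constructor
        · rintro ⟨h1, h2⟩
          exact ⟨⟨(y - 1).toNat, by omega⟩, by dsimp; omega⟩
        · rintro ⟨i, rfl⟩
          have := i.2
          omega
    rw [phi0, this]
    dsimp
    rw [show (Matrix.of fun i j : Fin n => if (i : ℤ) + 1 = (j : ℤ) + 1 then (1 : ℝ) else 0) = 1 by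
      ext i j
      simp [Matrix.one_apply, Fin.ext_iff]]
    simp
  · have hj : ∃ j : Fin n, ∀ i, β i ≠ (j : ℤ) + 1 := by
      by_contra hc
      push Not at hc
      apply h
      have h1 : sqA n ⊆ Set.range β := by
        intro y hy
        simp only [sqA, Set.mem_ofPred_eq] at hy
        obtain ⟨i, hi⟩ := hc ⟨(y - 1).toNat, by omega⟩
        refine ⟨i, ?_⟩
        rw [hi]; dsimp; omega
      refine (Set.eq_of_subset_of_ncard_le h1 ?_ (Set.finite_range β)).symm
      rw [← Set.image_univ, Set.ncard_image_of_injective _ hβ.injective, Set.ncard_univ, Nat.card_eq_fintype_card, Fintype.card_fin]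
      have := ncard_Icc_int 1 (n : ℤ)
      have e : sqA n = Set.Icc 1 (n : ℤ) := rfl
      rw [e, this]; simp
    obtain ⟨j, hj⟩ := hj
    exact Matrix.det_eq_zero_of_column_eq_zero j (fun i => by simp [hj i])

lemma hpath_snoc {s t : Set ℤ} {T : List ℤ} {c : ℤ} : HPath false s (T ++ [c]) t ↔
    ∃ r, HPath false s T r ∧ Hvalid r c ∧ hop false r c = t := by
  rw [HPath, WValid_append, hopW_append]
  constructor
  · rintro ⟨⟨h1, h2⟩, h3⟩
    exact ⟨_, ⟨h1, rfl⟩, h2.1, h3⟩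
  · rintro ⟨r, ⟨h1, rfl⟩, h2, h3⟩
    exact ⟨⟨h1, h2, trivial⟩, h3⟩

lemma update_mono {β : Fin n → ℤ} (hβ : StrictMono β) {i : Fin n} {c : ℤ} (hi : β i = c + 1)
    (hc : ∀ j, β j ≠ c) : StrictMono (Function.update β i c) := by
  intro a b hab
  have h1 := hβ hab
  rcases eq_or_ne a i with rfl | ha
  · rw [Function.update_self, Function.update_of_ne hab.ne']
    omega
  · rw [Function.update_of_ne ha]
    rcases eq_or_ne b i with rfl | hb
    · rw [Function.update_self]
      have := hc a
      omega
    · rwa [Function.update_of_ne hb]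

lemma EE_eval (T : List ℤ) {β : Fin n → ℤ} (hβ : StrictMono β) : open Classical in
    (EE (Ez n) T (phi0 n)).1 β = if HPath false (sqA n) T (Set.range β) then 1 else 0 := by
  classical
  induction T using List.reverseRecOn generalizing β with
  | nil =>
    simp only [EE, List.reverse_nil, List.map_nil, List.prod_nil, Module.End.one_apply]
    rw [phi0_eval hβ]
    refine if_congr ?_ rfl rfl
    simp [HPath, WValid, hopW, eq_comm]
  | append_singleton T c ih =>
    rw [EE_snoc, Module.End.mul_apply]
    by_cases h1 : ∃ i, β i = c + 1
    · obtain ⟨i, hi⟩ := h1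
      by_cases h2 : ∃ j, β j = c
      · obtain ⟨j, hj⟩ := h2
        rw [Ez_van c _ β j hj, if_neg]
        rw [hpath_snoc]
        rintro ⟨r, _, _, h⟩
        have : c ∈ hop false r c := by rw [h]; exact ⟨j, hj⟩
        rw [mem_hop] at this
        simp at this
      · push Not at h2
        rw [eA_apply, eop, Finset.sum_eq_single i, if_pos hi, ih (update_mono hβ hi h2)]
        · refine if_congr ?_ rfl rfl
          have hr : ∀ y, y ∈ Set.range (Function.update β i c) ↔ y = c ∨ (y ∈ Set.range β ∧ y ≠ c + 1) := by
            intro y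
            constructor
            · rintro ⟨j, rfl⟩
              rcases eq_or_ne j i with rfl | hj
              · left; simp
              · right
                rw [Function.update_of_ne hj]
                exact ⟨⟨j, rfl⟩, fun h => hj (hβ.injective (h.trans hi.symm))⟩
            · rintro (rfl | ⟨⟨j, rfl⟩, hj⟩)
              · exact ⟨i, by simp⟩
              · refine ⟨j, ?_⟩
                rw [Function.update_of_ne]
                rintro rfl
                exact hj hi
          rw [hpath_snoc]
          constructor
          · intro h
            refine ⟨_, h, ⟨(hr c).2 (Or.inl rfl), ?_⟩, ?_⟩
            · rw [hr]; simp
            · ext y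
              rw [mem_hop, hr]
              simp only [Bool.false_eq_true, false_and, or_false]
              constructor
              · rintro (rfl | ⟨rfl | h, h'⟩)
                · exact ⟨i, hi⟩
                · exact absurd rfl h'
                · exact h.1
              · intro hy
                by_cases hyc : y = c + 1
                · exact Or.inl hyc
                · refine Or.inr ⟨Or.inr ⟨hy, hyc⟩, ?_⟩
                  rintro rfl
                  obtain ⟨j, hj⟩ := hy
                  exact h2 j hj
          · rintro ⟨r, h3, h4, h5⟩
            have : r = Set.range (Function.update β i c) := by
              ext y
              rw [hr, ← h5, mem_hop]
              simp only [Bool.false_eq_true, false_and, or_false]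
              constructor
              · intro hy
                by_cases hyc : y = c
                · exact Or.inl hyc
                · refine Or.inr ⟨Or.inr ⟨hy, hyc⟩, ?_⟩
                  rintro rfl
                  exact h4.2 hy
              · rintro (rfl | ⟨rfl | h, h'⟩)
                · exact h4.1
                · exact absurd rfl h'
                · exact h.1
            rwa [← this]
        · intro j _ hj
          rw [if_neg]
          intro h
          exact hj (hβ.injective (h.trans hi.symm))
        · simp
    · push Not at h1
      rw [if_neg]
      · rw [eA_apply, eop]
        refine Finset.sum_eq_zero fun j _ => ?_
        rw [if_neg (h1 j)]
      · rw [hpath_snoc]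
        rintro ⟨r, _, _, h⟩
        have : c + 1 ∈ hop false r c := by rw [mem_hop]; simp
        rw [h] at this
        obtain ⟨j, hj⟩ := this
        exact h1 j hj

/-- the trace as a value of a power of `QQ` -/
theorem sum_bwt {k d : ℕ} (hN : n * n = d * (k + 1)) :
    ∑ T ∈ (WA_finite n).toFinset, bwt (k + 1) d (wfun T) =
    ((QQ (fun c : ℕ => Ez n (c : ℤ)) (2 * n) k ^ d) (phi0 n)).1 (fun i => (n : ℤ) + 1 + i) := by
  classical
  have hm : StrictMono (fun i : Fin n => (n : ℤ) + 1 + i) := by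
    intro i j hij
    have : (i : ℕ) < j := hij
    dsimp; omega
  have hr : Set.range (fun i : Fin n => (n : ℤ) + 1 + i) = sqB n := by
    ext y
    simp only [sqB, Set.mem_ofPred_eq, Set.mem_range]
    constructor
    · rintro ⟨i, rfl⟩
      have := i.2
      omega
    · rintro ⟨h1, h2⟩
      exact ⟨⟨(y - (n + 1)).toNat, by omega⟩, by dsimp; omega⟩
  rw [QQ_words (Ez n), LinearMap.sum_apply]
  have e : (↑(∑ T ∈ lw (2 * n) (d * (k + 1)), (pwt (blk (k + 1) d) (wfun T) • EE (Ez n) T) (phi0 n)) : (Fin n → ℤ) → ℝ)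
      (fun i => (n : ℤ) + 1 + i) = ∑ T ∈ lw (2 * n) (d * (k + 1)),
        pwt (blk (k + 1) d) (wfun T) * (EE (Ez n) T (phi0 n)).1 (fun i => (n : ℤ) + 1 + i) := by
    rw [Submodule.coe_sum, Finset.sum_apply]
    rfl
  rw [e]
  simp only [EE_eval _ hm, hr]
  simp only [mul_ite, mul_one, mul_zero]
  rw [← Finset.sum_filter]
  refine Finset.sum_congr ?_ fun _ _ => rfl
  ext T
  rw [Set.Finite.mem_toFinset, Finset.mem_filter, mem_lw]
  constructor
  · intro h
    refine ⟨⟨by rw [h.2, hN], fun x hx => ?_⟩, h.1⟩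
    have := WA_letters h x hx
    push_cast
    omega
  · rintro ⟨⟨h1, _⟩, h2⟩
    exact ⟨h2, by rw [h1, hN]⟩
end eval

/-- divided power coefficients -/
noncomputable def GG (k : ℕ) (x : ℤ) : ℝ :=
  if 0 ≤ x ∧ (k : ℤ) ∣ x then 1 / (((x / k).toNat).factorial : ℝ) else 0

lemma GG_step {k : ℕ} (hk : 0 < k) (x : ℤ) : (k : ℝ) * GG k (x - k) = x * GG k x := by
  unfold GG
  by_cases hd : (k : ℤ) ∣ x
  · obtain ⟨y, rfl⟩ := hd
    have hk' : (k : ℤ) ≠ 0 := by omega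
    have e : (k : ℤ) * y - k = k * (y - 1) := by ring
    rw [e, Int.mul_ediv_cancel_left _ hk', Int.mul_ediv_cancel_left _ hk']
    have h1 : 0 ≤ (k : ℤ) * y ↔ 0 ≤ y := by
      constructor
      · intro h; by_contra hc; push Not at hc
        have := mul_neg_of_pos_of_neg (show (0 : ℤ) < k by omega) hc
        omega
      · intro h; positivity
    have h2 : 0 ≤ (k : ℤ) * (y - 1) ↔ 0 ≤ y - 1 := by
      constructor
      · intro h; by_contra hc; push Not at hc
        have := mul_neg_of_pos_of_neg (show (0 : ℤ) < k by omega) hc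
        omega
      · intro h; positivity
    simp only [h1, h2, dvd_mul_right, and_true]
    rcases lt_trichotomy y 0 with h | rfl | h
    · rw [if_neg (by omega), if_neg (by omega)]; simp
    · simp
    · obtain ⟨m, rfl⟩ : ∃ m : ℕ, y = m + 1 := ⟨(y - 1).toNat, by omega⟩
      rw [if_pos (by omega), if_pos (by omega)]
      rw [show ((m : ℤ) + 1 - 1).toNat = m by omega, show ((m : ℤ) + 1).toNat = m + 1 by omega, Nat.factorial_succ]
      have : (m.factorial : ℝ) ≠ 0 := by positivity
      have h3 : (m : ℝ) + 1 ≠ 0 := by positivity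
      push_cast
      field_simp
  · have : ¬ (k : ℤ) ∣ x - k := by
      intro h; apply hd
      have := dvd_add h (dvd_refl (k : ℤ))
      simpa using this
    rw [if_neg (by tauto), if_neg (by tauto)]; simp

section
variable {n : ℕ}

/-- the closed form -/
noncomputable def phiD (n k d : ℕ) (β : Fin n → ℤ) : ℝ :=
  if ∑ i, β i = ∑ j : Fin n, ((j : ℤ) + 1) + k * d then
    (d.factorial : ℝ) * (Matrix.of fun i j : Fin n => GG k (β i - (j + 1))).det else 0

lemma phiD_neg {k d : ℕ} {β : Fin n → ℤ} {i : Fin n} (h : β i ≤ 0) : phiD n k d β = 0 := by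
  rw [phiD]
  split_ifs
  · rw [Matrix.det_eq_zero_of_row_eq_zero i, mul_zero]
    intro j
    rw [Matrix.of_apply, GG, if_neg]
    rintro ⟨h1, _⟩
    omega
  · rfl

lemma det_rows (A : Matrix (Fin n) (Fin n) ℝ) (x y : Fin n → ℝ) :
    ∑ i, (A.updateRow i (fun j => (x i - y j) * A i j)).det = (∑ i, x i - ∑ j, y j) * A.det := by
  simp only [Matrix.det_apply', Finset.mul_sum]
  rw [Finset.sum_comm]
  refine Finset.sum_congr rfl fun σ _ => ?_
  rw [← Finset.mul_sum, ← mul_assoc, mul_comm (_ - _) _, mul_assoc]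
  congr 1
  have : ∀ i, ∏ l, A.updateRow i (fun j => (x i - y j) * A i j) (σ l) l = (x i - y (σ⁻¹ i)) * ∏ l, A (σ l) l := by
    intro i
    rw [← Finset.mul_prod_erase _ _ (Finset.mem_univ (σ⁻¹ i)), ← Finset.mul_prod_erase _ (fun l => A (σ l) l) (Finset.mem_univ (σ⁻¹ i)), ← mul_assoc]
    congr 1
    · simp
    · refine Finset.prod_congr rfl fun l hl => ?_
      rw [Matrix.updateRow_ne]
      intro h
      exact (Finset.mem_erase.1 hl).1 (by rw [← h]; simp)
  simp only [this]
  rw [← Finset.sum_mul, Finset.sum_sub_distrib, Equiv.sum_comp σ⁻¹ y]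

lemma phiD_step {k : ℕ} (hk : 0 < k) (d : ℕ) (β : Fin n → ℤ) :
    ∑ i, phiD n k d (Function.update β i (β i - k)) = phiD n k (d + 1) β := by
  have hs : ∀ i, ∑ l, Function.update β i (β i - k) l = ∑ l, β l - k := by
    intro i
    rw [Finset.sum_update_of_mem (Finset.mem_univ i), ← Finset.add_sum_erase _ β (Finset.mem_univ i), ← Finset.erase_eq]
    ring
  simp only [phiD, hs]
  by_cases h : ∑ i, β i = ∑ j : Fin n, ((j : ℤ) + 1) + k * (d + 1 : ℕ)
  · have h' : ∑ i, β i - k = ∑ j : Fin n, ((j : ℤ) + 1) + k * d := by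
      rw [h]; push_cast; ring
    rw [if_pos h]
    simp only [if_pos h']
    have hk0 : (k : ℝ) ≠ 0 := by positivity
    have e : ∀ i, (Matrix.of fun l j : Fin n => GG k (Function.update β i (β i - k) l - (j + 1))) =
        (Matrix.of fun i j : Fin n => GG k (β i - (j + 1))).updateRow i (fun j => ((β i : ℝ) / k - ((j : ℝ) + 1) / k) *
          (Matrix.of fun i j : Fin n => GG k (β i - (j + 1))) i j) := by
      intro i
      ext l j
      rcases eq_or_ne l i with rfl | hl
      · rw [Matrix.updateRow_self, Matrix.of_apply, Matrix.of_apply, Function.update_self]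
        have := GG_step hk (β l - (j + 1))
        rw [show β l - k - ((j : ℤ) + 1) = β l - (j + 1) - k by ring]
        push_cast at this
        field_simp
        linarith
      · rw [Matrix.updateRow_ne hl, Matrix.of_apply, Matrix.of_apply, Function.update_of_ne hl]
    simp only [e]
    rw [← Finset.mul_sum, det_rows, ← mul_assoc]
    congr 1
    rw [← Finset.sum_div, ← Finset.sum_div, ← sub_div]
    have h2 : (∑ i, (β i : ℝ)) = ∑ j : Fin n, ((j : ℝ) + 1) + k * (d + 1) := by
      have := congrArg (fun z : ℤ => (z : ℝ)) h
      push_cast at this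
      exact this
    rw [h2, Nat.factorial_succ]
    push_cast
    field_simp
    ring
  · rw [if_neg h]
    have h' : ¬ (∑ i, β i - k = ∑ j : Fin n, ((j : ℤ) + 1) + k * d) := by
      intro hc; apply h; push_cast; linear_combination hc
    simp [if_neg h']

lemma phi0_eq {k : ℕ} (hk : 0 < k) (β : Fin n → ℤ) : (phi0 n).1 β = phiD n k 0 β := by
  rw [phiD, phi0]
  simp only [Nat.factorial_zero, Nat.cast_one, one_mul, Nat.cast_zero, mul_zero, add_zero]
  have hred : ∀ σ : Equiv.Perm (Fin n), ∏ i, (Matrix.of fun i j : Fin n => if β i = (j : ℤ) + 1 then (1 : ℝ) else 0) (σ i) i =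
      if ∑ i, β i = ∑ j : Fin n, ((j : ℤ) + 1) then ∏ i, (Matrix.of fun i j : Fin n => GG k (β i - (j + 1))) (σ i) i else 0 := by
    intro σ
    have hs : ∑ i, β i = ∑ i, β (σ i) := (Equiv.sum_comp σ β).symm
    by_cases hall : ∀ i, β (σ i) = (i : ℤ) + 1
    · rw [if_pos (by rw [hs]; exact Finset.sum_congr rfl fun i _ => hall i)]
      refine Finset.prod_congr rfl fun i _ => ?_
      simp [hall i, GG]
    · push Not at hall
      obtain ⟨i, hi⟩ := hall
      rw [Finset.prod_eq_zero (Finset.mem_univ i) (by simp [hi])]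
      split_ifs with h
      · symm
        have : ∃ l, β (σ l) < (l : ℤ) + 1 := by
          by_contra hc
          push Not at hc
          rw [hs] at h
          have := (Finset.sum_eq_sum_iff_of_le (fun l _ => hc l)).1 h.symm i (Finset.mem_univ i)
          exact hi this.symm
        obtain ⟨l, hl⟩ := this
        refine Finset.prod_eq_zero (Finset.mem_univ l) ?_
        rw [Matrix.of_apply, GG, if_neg]
        rintro ⟨h1, _⟩
        omega
      · rfl
  simp only [Matrix.det_apply', hred]
  split_ifs <;> simp

lemma QQ_phi {k : ℕ} (d : ℕ) (β : Fin n → ℤ) (hβ : ∀ i, β i ≤ 2 * n) :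
    ((QQ (fun c : ℕ => Ez n (c : ℤ)) (2 * n) k ^ d) (phi0 n)).1 β = phiD n (k + 1) d β := by
  induction d generalizing β with
  | zero => rw [pow_zero, Module.End.one_apply, phi0_eq (k := k + 1) (by omega)]
  | succ d ih =>
    rw [pow_succ', Module.End.mul_apply, QQ_Ez, LinearMap.sum_apply, Submodule.coe_sum, Finset.sum_apply]
    simp only [eA_apply, eop]
    rw [Finset.sum_comm, ← phiD_step (by omega)]
    refine Finset.sum_congr rfl fun i _ => ?_
    by_cases h : 0 ≤ β i - (k + 1)
    · have hb := hβ i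
      rw [Finset.sum_eq_single (β i - (k + 1)).toNat]
      · rw [if_pos (by omega), ← QQ_Ez, Int.toNat_of_nonneg h, ih]
        · push_cast; rfl
        · intro j
          rcases eq_or_ne j i with rfl | hj
          · rw [Function.update_self]; omega
          · rw [Function.update_of_ne hj]; exact hβ j
      · intro v _ hv
        rw [if_neg]
        omega
      · intro hc
        rw [Finset.mem_range] at hc
        omega
    · rw [phiD_neg (i := i), Finset.sum_eq_zero]
      · intro v _
        rw [if_neg]; omega
      · rw [Function.update_self]; push_cast; omega

/-- signed number of fixed points of promotion on the square words -/
theorem fix_det {k d : ℕ} (hn : n ≠ 0) (hk : 0 < k) (hN : n * n = d * k) :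
    (-1) ^ ((n - 1) * d) * ({T | WA n T ∧ wprom^[d] T = T}.ncard : ℝ) =
      (d.factorial : ℝ) * (Matrix.of fun i j : Fin n => GG k ((n : ℤ) + i - j)).det := by
  have hd : 0 < d := by
    rcases Nat.eq_zero_or_pos d with rfl | h
    · simp at hN; omega
    · exact h
  obtain ⟨k, rfl⟩ := Nat.exists_eq_succ_of_ne_zero hk.ne'
  rw [fix_eq_sum hn hk hd hN, Nat.succ_eq_add_one, sum_bwt hN, QQ_phi, phiD, if_pos]
  · congr 2
    ext i j
    rw [Matrix.of_apply, Matrix.of_apply]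
    congr 1
    ring
  · rw [← sub_eq_iff_eq_add', ← Finset.sum_sub_distrib]
    rw [Finset.sum_congr rfl (fun (i : Fin n) _ => show (n : ℤ) + 1 + (i : ℕ) - ((i : ℕ) + 1) = n by ring)]
    simp
    rw [Nat.succ_eq_add_one] at hN
    have : ((n * n : ℕ) : ℤ) = ((d * (k + 1) : ℕ) : ℤ) := by rw [hN]
    push_cast at this
    linarith
  · intro i
    have := i.2
    omega
end

/-- the product of hook lengths of the square -/
def HH (m : ℕ) : ℕ := ∏ i ∈ Finset.range m, ∏ j ∈ Finset.range m, (i + j + 1)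

lemma hook_row (i m : ℕ) : i.factorial * ∏ j ∈ Finset.range m, (i + j + 1) = (i + m).factorial := by
  induction m with
  | zero => simp
  | succ m ih => rw [Finset.prod_range_succ, ← mul_assoc, ih, ← add_assoc, Nat.factorial_succ, mul_comm]

lemma HH_pos (m : ℕ) : 0 < HH m := Finset.prod_pos fun _ _ => Finset.prod_pos fun _ _ => by omega

lemma det_hook (m : ℕ) : (Matrix.of fun i j : Fin m => 1 / (((m + i - j : ℕ).factorial : ℕ) : ℝ)).det = 1 / (HH m : ℝ) := by
  have e : (Matrix.of fun i j : Fin m => 1 / (((m + i - j : ℕ).factorial : ℕ) : ℝ)) =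
      Matrix.of fun i j : Fin m => (1 / ((m + i : ℕ).factorial : ℝ)) *
        (Matrix.of fun i j : Fin m => (descPochhammer ℝ j).eval ((i : ℕ) + (m : ℝ))) i j := by
    ext i j
    rw [Matrix.of_apply, Matrix.of_apply, Matrix.of_apply]
    rw [show ((i : ℕ) : ℝ) + m = ((m + i : ℕ) : ℝ) by push_cast; ring, descPochhammer_eval_eq_descFactorial]
    have hj : (j : ℕ) ≤ m + i := by have := j.2; omega
    have := Nat.factorial_mul_descFactorial hj
    have h1 : (((m + i - j : ℕ).factorial : ℕ) : ℝ) * ((m + i : ℕ).descFactorial j : ℝ) = ((m + i : ℕ).factorial : ℝ) := by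
      exact_mod_cast this
    have h2 : (((m + i - j : ℕ).factorial : ℕ) : ℝ) ≠ 0 := by positivity
    have h3 : (((m + i : ℕ).factorial : ℕ) : ℝ) ≠ 0 := by positivity
    rw [div_mul_eq_mul_div, one_mul, div_eq_div_iff h2 h3]
    linarith
  rw [e, Matrix.det_mul_column, ← Matrix.det_eval_matrixOfPolynomials_eq_det_vandermonde
    (fun i : Fin m => (i : ℕ) + (m : ℝ)) (fun j => descPochhammer ℝ j) (fun j => descPochhammer_natDegree ℝ j)
    (fun j => monic_descPochhammer ℝ j), Matrix.det_vandermonde_add]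
  have h4 : (Matrix.vandermonde fun i : Fin m => ((i : ℕ) : ℝ)).det = ∏ i ∈ Finset.range m, (i.factorial : ℝ) := by
    cases m with
    | zero => simp
    | succ m =>
      rw [Matrix.det_vandermonde_id_eq_superFactorial, ← Nat.prod_range_succ_factorial]
      push_cast; rfl
  rw [h4, Fin.prod_univ_eq_prod_range (fun i => 1 / (((m + i : ℕ).factorial : ℕ) : ℝ)) m, ← Finset.prod_mul_distrib, HH]
  push_cast
  rw [one_div, ← Finset.prod_inv_distrib]
  refine Finset.prod_congr rfl fun i _ => ?_
  have := hook_row i m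
  rw [add_comm m i, ← this]
  have h5 : (i.factorial : ℝ) ≠ 0 := by positivity
  have h6 : (∏ j ∈ Finset.range m, ((i : ℝ) + j + 1)) ≠ 0 := Finset.prod_ne_zero_iff.2 fun j _ => by positivity
  push_cast
  field_simp

lemma det_GG_dvd (m k : ℕ) (hk : 0 < k) :
    (Matrix.of fun i j : Fin (m * k) => GG k (((m * k : ℕ) : ℤ) + i - j)).det = (1 / (HH m : ℝ)) ^ k := by
  rw [← Matrix.det_submatrix_equiv_self (finProdFinEquiv (m := m) (n := k))]
  have : (Matrix.of fun i j : Fin (m * k) => GG k (((m * k : ℕ) : ℤ) + i - j)).submatrix finProdFinEquiv finProdFinEquiv =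
      Matrix.blockDiagonal (fun _ : Fin k => Matrix.of fun i j : Fin m => 1 / (((m + i - j : ℕ).factorial : ℕ) : ℝ)) := by
    ext ⟨a, b⟩ ⟨a', b'⟩
    rw [Matrix.submatrix_apply, Matrix.of_apply, Matrix.blockDiagonal_apply, GG]
    simp only [finProdFinEquiv_apply_val]
    have hb := b.2
    have hb' := b'.2
    have ha' := a'.2
    by_cases h : b = b'
    · subst h
      have e : ((m * k : ℕ) : ℤ) + ((b + k * a : ℕ) : ℤ) - ((b + k * a' : ℕ) : ℤ) = k * ((m + a - a' : ℕ) : ℤ) := by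
        rw [Nat.cast_sub (by omega)]
        push_cast; ring
      rw [e, if_pos rfl, if_pos ⟨by positivity, dvd_mul_right _ _⟩, Int.mul_ediv_cancel_left _ (by omega)]
      simp
    · rw [if_neg h, if_neg]
      rintro ⟨_, h2⟩
      apply h
      have e : ((m * k : ℕ) : ℤ) + ((b + k * a : ℕ) : ℤ) - ((b' + k * a' : ℕ) : ℤ) = k * ((m : ℤ) + a - a') + ((b : ℤ) - b') := by
        push_cast; ring
      rw [e] at h2
      have h3 := (Int.dvd_add_right (dvd_mul_right _ _)).1 h2
      have h4 : (b : ℤ) - b' = 0 := Int.eq_zero_of_abs_lt_dvd h3 (by rw [abs_lt]; omega)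
      apply Fin.ext
      omega
  rw [this, Matrix.det_blockDiagonal, det_hook]
  simp

lemma det_GG_ndvd {n k : ℕ} (hk : 0 < k) (h : ¬ k ∣ n) :
    (Matrix.of fun i j : Fin n => GG k ((n : ℤ) + i - j)).det = 0 := by
  rw [← Matrix.det_transpose, Matrix.det_apply]
  refine Finset.sum_eq_zero fun σ _ => ?_
  suffices ∃ i, (Matrix.of fun i j : Fin n => GG k ((n : ℤ) + i - j)) i (σ i) = 0 by
    obtain ⟨i, hi⟩ := this
    rw [Finset.prod_eq_zero (Finset.mem_univ i) (by rw [Matrix.transpose_apply]; exact hi), smul_zero]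
  by_contra hc
  push Not at hc
  have hdiv : ∀ i : Fin n, (k : ℤ) ∣ (n : ℤ) + i - σ i := by
    intro i
    have := hc i
    rw [Matrix.of_apply, GG] at this
    by_contra h2
    exact this (if_neg (fun h => h2 h.2))
  have hr : 0 < n % k := Nat.pos_of_ne_zero (fun h0 => h (Nat.dvd_of_mod_eq_zero h0))
  have hq := Nat.div_add_mod n k
  have hlt : ∀ t, t ≤ n / k → t * k < n := by
    intro t ht
    have := Nat.mul_le_mul_right k ht
    rw [mul_comm (n / k)] at this
    omega
  have hmod : ∀ t (ht : t ≤ n / k), (σ ⟨t * k, hlt t ht⟩ : ℕ) % k = n % k := by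
    intro t ht
    have h1 := hdiv ⟨t * k, hlt t ht⟩
    have h2 : (k : ℤ) ∣ (n : ℤ) - (σ ⟨t * k, hlt t ht⟩ : ℕ) := by
      have := dvd_sub h1 (dvd_mul_left (k : ℤ) t)
      have e : (n : ℤ) + ((t * k : ℕ) : ℤ) - (σ ⟨t * k, hlt t ht⟩ : ℕ) - t * k = (n : ℤ) - (σ ⟨t * k, hlt t ht⟩ : ℕ) := by
        push_cast; ring
      exact e ▸ this
    have h3 := (Int.emod_eq_emod_iff_emod_sub_eq_zero).2 (Int.emod_eq_zero_of_dvd h2)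
    have h4 : ((n % k : ℕ) : ℤ) = (((σ ⟨t * k, hlt t ht⟩ : ℕ) % k : ℕ) : ℤ) := by push_cast; exact h3
    exact_mod_cast h4.symm
  obtain ⟨x, hx, y, hy, hxy, he⟩ := Finset.exists_ne_map_eq_of_card_lt_of_maps_to
    (s := Finset.range (n / k + 1)) (t := Finset.range (n / k)) (by simp)
    (f := fun t => if ht : t ≤ n / k then (σ ⟨t * k, hlt t ht⟩ : ℕ) / k else 0) (by
      intro t ht
      have ht : t ≤ n / k := by simpa [Nat.lt_succ_iff] using ht
      simp only [dif_pos ht]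
      have h1 := Nat.div_add_mod (σ ⟨t * k, hlt t ht⟩ : ℕ) k
      have h2 := (σ ⟨t * k, hlt t ht⟩).2
      rw [hmod t ht] at h1
      have : k * ((σ ⟨t * k, hlt t ht⟩ : ℕ) / k) < k * (n / k) := by omega
      simpa using Nat.lt_of_mul_lt_mul_left this)
  have hx : x ≤ n / k := by simpa [Nat.lt_succ_iff] using hx
  have hy : y ≤ n / k := by simpa [Nat.lt_succ_iff] using hy
  simp only [dif_pos hx, dif_pos hy] at he
  have h1 := Nat.div_add_mod (σ ⟨x * k, hlt x hx⟩ : ℕ) k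
  have h2 := Nat.div_add_mod (σ ⟨y * k, hlt y hy⟩ : ℕ) k
  rw [hmod x hx, he] at h1
  rw [hmod y hy] at h2
  have h3 := σ.injective (Fin.ext (h1.symm.trans h2))
  have h4 : x * k = y * k := congrArg Fin.val h3
  exact hxy (Nat.eq_of_mul_eq_mul_right hk h4)

/-- Fixed point counts for the square -/
theorem fix_dvd {m k : ℕ} (hk : 0 < k) (hm : 0 < m) :
    ({T | WA (m * k) T ∧ wprom^[m * m * k] T = T}.ncard : ℝ) * (HH m : ℝ) ^ k = ((m * m * k).factorial : ℝ) := by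
  have h := fix_det (n := m * k) (k := k) (d := m * m * k) (Nat.mul_pos hm hk).ne' hk (by ring)
  rw [det_GG_dvd m k hk] at h
  have hs : Even ((m * k - 1) * (m * m * k)) := by
    rcases Nat.even_or_odd (m * k) with he | ho
    · have : (m * k - 1) * (m * m * k) = ((m * k - 1) * m) * (m * k) := by ring
      rw [this]; exact he.mul_left _
    · refine Even.mul_right ?_ _
      obtain ⟨c, hc⟩ := ho
      rw [hc]; simp
  rw [hs.neg_one_pow, one_mul] at h
  rw [h]
  have : (HH m : ℝ) ≠ 0 := by exact_mod_cast (HH_pos m).ne'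
  rw [mul_assoc, ← mul_pow, one_div, inv_mul_cancel₀ this]; simp

theorem fix_ndvd {n k d : ℕ} (hn : n ≠ 0) (hk : 0 < k) (hN : n * n = d * k) (h : ¬ k ∣ n) :
    {T | WA n T ∧ wprom^[d] T = T}.ncard = 0 := by
  have h1 := fix_det hn hk hN
  rw [det_GG_ndvd hk h, mul_zero] at h1
  have h2 : ((-1 : ℝ)) ^ ((n - 1) * d) ≠ 0 := pow_ne_zero _ (by norm_num)
  exact_mod_cast (mul_eq_zero.1 h1).resolve_left h2

lemma WA_card {n : ℕ} (hn : n ≠ 0) : {T | WA n T}.ncard * HH n = (n * n).factorial := by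
  have h := fix_dvd (m := n) (k := 1) one_pos (Nat.pos_of_ne_zero hn)
  rw [pow_one, mul_one, mul_one] at h
  have e : {T | WA n T ∧ wprom^[n * n] T = T} = {T | WA n T} := by
    ext T
    simp only [Set.mem_ofPred_eq]
    exact ⟨fun h => h.1, fun h => ⟨h, WA_period hn h⟩⟩
  rw [e] at h
  exact_mod_cast h

section shifted

/-- state of a strict partition -/
def stS (S : Finset ℕ) : Set ℤ := {y | y = 0 ∨ (0 ≤ y ∧ y.toNat ∈ S)}

/-- lower the part `c+1` -/
def lowS (S : Finset ℕ) (c : ℕ) : Finset ℕ := if c = 0 then S.erase (c + 1) else insert c (S.erase (c + 1))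

open Classical in
/-- number of words -/
noncomputable def cntS (M L : ℕ) (S : Finset ℕ) : ℝ :=
  ∑ T ∈ lw M L, if HPath true {0} T (stS S) then (1 : ℝ) else 0

lemma hpath_snoc' {s t : Set ℤ} {T : List ℤ} {c : ℤ} : HPath true s (T ++ [c]) t ↔
    ∃ r, HPath true s T r ∧ Hvalid r c ∧ hop true r c = t := by
  rw [HPath, WValid_append, hopW_append]
  constructor
  · rintro ⟨⟨h1, h2⟩, h3⟩
    exact ⟨_, ⟨h1, rfl⟩, h2.1, h3⟩
  · rintro ⟨r, ⟨h1, rfl⟩, h2, h3⟩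
    exact ⟨⟨h1, h2, trivial⟩, h3⟩

lemma mem_stS_low {S : Finset ℕ} {c : ℕ} (y : ℤ) :
    y ∈ stS (lowS S c) ↔ y = c ∨ (y ∈ stS S ∧ y ≠ c + 1) := by
  unfold stS lowS
  simp only [Set.mem_ofPred_eq]
  by_cases hc : c = 0
  · subst hc
    rw [if_pos rfl, Finset.mem_erase]
    constructor
    · rintro (h | ⟨h1, h2, h3⟩)
      · left; simpa using h
      · right; exact ⟨Or.inr ⟨h1, h3⟩, by omega⟩
    · rintro (h | ⟨h | ⟨h1, h3⟩, h2⟩)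
      · left; simpa using h
      · left; exact h
      · right; exact ⟨h1, by omega, h3⟩
  · rw [if_neg hc, Finset.mem_insert, Finset.mem_erase]
    constructor
    · rintro (h | ⟨h1, h2 | ⟨h2, h3⟩⟩)
      · right; exact ⟨Or.inl h, by omega⟩
      · left; omega
      · right; exact ⟨Or.inr ⟨h1, h3⟩, by omega⟩
    · rintro (h | ⟨h | ⟨h1, h3⟩, h2⟩)
      · right; exact ⟨by omega, Or.inl (by omega)⟩
      · left; exact h
      · right; exact ⟨h1, Or.inr ⟨by omega, h3⟩⟩

lemma path_low {S : Finset ℕ} {c : ℕ} {T : List ℤ} (h0 : 0 ∉ S) : HPath true {0} (T ++ [(c : ℤ)]) (stS S) ↔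
    c + 1 ∈ S ∧ c ∉ S ∧ HPath true {0} T (stS (lowS S c)) := by
  rw [hpath_snoc']
  constructor
  · rintro ⟨r, h1, h2, h3⟩
    have hc1 : c + 1 ∈ S := by
      have : (c : ℤ) + 1 ∈ stS S := by rw [← h3, mem_hop]; simp
      simp only [stS, Set.mem_ofPred_eq] at this
      rcases this with h | ⟨_, h⟩
      · omega
      · have e : ((c : ℤ) + 1).toNat = c + 1 := by omega
        rwa [e] at h
    have hc2 : c ∉ S := by
      intro hc
      have : (c : ℤ) ∈ stS S := by simp [stS, hc]
      rw [← h3, mem_hop] at this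
      have hc0 : c ≠ 0 := by rintro rfl; exact h0 hc
      simp [hc0] at this
    refine ⟨hc1, hc2, ?_⟩
    have : r = stS (lowS S c) := by
      ext y
      rw [mem_stS_low, ← h3, mem_hop]
      constructor
      · intro hy
        by_cases hyc : y = c
        · exact Or.inl hyc
        · refine Or.inr ⟨Or.inr ⟨hy, Or.inl hyc⟩, ?_⟩
          rintro rfl
          exact h2.2 hy
      · rintro (rfl | ⟨rfl | h, h'⟩)
        · exact h2.1
        · exact absurd rfl h'
        · exact h.1
    rwa [← this]
  · rintro ⟨h1, h2, h3⟩
    refine ⟨_, h3, ⟨(mem_stS_low _).2 (Or.inl rfl), ?_⟩, ?_⟩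
    · rw [mem_stS_low]
      rintro (h | h)
      · omega
      · exact h.2 rfl
    · ext y
      rw [mem_hop, mem_stS_low]
      constructor
      · rintro (rfl | ⟨rfl | h, h'⟩)
        · right
          have e : ((c : ℤ) + 1).toNat = c + 1 := by omega
          exact ⟨by omega, by rwa [e]⟩
        · rcases h' with h' | ⟨_, h'⟩
          · exact absurd rfl h'
          · left; exact h'
        · exact h.1
      · intro hy
        by_cases hyc : y = c + 1
        · exact Or.inl hyc
        · refine Or.inr ⟨Or.inr ⟨hy, hyc⟩, ?_⟩
          by_cases hy0 : y = c
          · right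
            refine ⟨rfl, ?_⟩
            rcases hy with h | ⟨_, h⟩
            · omega
            · subst hy0
              simp at h
              exact absurd h h2
          · left; exact hy0

lemma cntS_succ {M L : ℕ} {S : Finset ℕ} (hS : ∀ x ∈ S, 0 < x ∧ x ≤ M) :
    cntS M (L + 1) S = ∑ x ∈ S, if x - 1 ∈ S then 0 else cntS M L (lowS S (x - 1)) := by
  classical
  have h0 : 0 ∉ S := fun h => by have := hS 0 h; omega
  rw [cntS, sum_lw, Finset.sum_comm]
  have h1 : ∀ c ∈ Finset.range M, (∑ T ∈ lw M L, if HPath true {0} (T ++ [(c : ℤ)]) (stS S) then (1 : ℝ) else 0) =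
      if c + 1 ∈ S then (if c ∈ S then 0 else cntS M L (lowS S c)) else 0 := by
    intro c _
    simp only [path_low h0]
    by_cases hc1 : c + 1 ∈ S
    · by_cases hc2 : c ∈ S
      · simp [hc2]
      · simp [hc1, hc2, cntS]
    · simp [hc1]
  rw [Finset.sum_congr rfl h1, ← Finset.sum_filter]
  refine Finset.sum_nbij' (fun c => c + 1) (fun x => x - 1) ?_ ?_ ?_ ?_ ?_
  · intro c hc; exact (Finset.mem_filter.1 hc).2
  · intro x hx
    have := hS x hx
    rw [Finset.mem_filter, Finset.mem_range, show x - 1 + 1 = x by omega]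
    exact ⟨by omega, hx⟩
  · intro c _; simp
  · intro x hx
    have := hS x hx
    omega
  · intro c _; simp

/-- one pair factor -/
noncomputable def hpf (x y : ℕ) : ℝ := if y < x then ((x : ℝ) - y) / (x + y) else 1

lemma hpf_mul {x y : ℕ} (h : x ≠ y) : hpf x y * hpf y x = |(x : ℝ) - y| / (x + y) := by
  unfold hpf
  rcases lt_or_gt_of_ne h with h | h
  · have : (x : ℝ) < y := by exact_mod_cast h
    rw [if_neg (by omega), if_pos h, one_mul, abs_of_neg (by linarith), neg_sub, add_comm]
  · have : (y : ℝ) < x := by exact_mod_cast h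
    rw [if_pos h, if_neg (by omega), mul_one, abs_of_pos (by linarith)]

/-- the product formula -/
noncomputable def Apr (S : Finset ℕ) : ℝ := ∏ x ∈ S, ((1 / (x.factorial : ℝ)) * ∏ y ∈ S, hpf x y)

/-- the effect of one part -/
noncomputable def Bpr (x : ℕ) (R : Finset ℕ) : ℝ := (1 / (x.factorial : ℝ)) * ∏ y ∈ R, (|(x : ℝ) - y| / (x + y))

lemma Apr_insert {x : ℕ} {R : Finset ℕ} (h : x ∉ R) : Apr (insert x R) = Apr R * Bpr x R := by
  unfold Apr Bpr
  rw [Finset.prod_insert h, Finset.prod_insert h]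
  have e1 : ∀ y ∈ R, (1 / (y.factorial : ℝ)) * ∏ z ∈ insert x R, hpf y z = hpf y x * ((1 / (y.factorial : ℝ)) * ∏ z ∈ R, hpf y z) := by
    intro y _
    rw [Finset.prod_insert h]; ring
  rw [Finset.prod_congr rfl e1, Finset.prod_mul_distrib]
  have e2 : ∀ y ∈ R, |(x : ℝ) - y| / (x + y) = hpf x y * hpf y x := by
    intro y hy
    rw [hpf_mul]; rintro rfl; exact h hy
  have e4 : ∏ y ∈ R, (hpf x y * hpf y x) = (∏ y ∈ R, hpf x y) * ∏ y ∈ R, hpf y x := Finset.prod_mul_distrib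
  rw [Finset.prod_congr rfl e2, e4]
  have e3 : hpf x x = 1 := by simp [hpf]
  rw [e3]; ring

lemma Apr_low {S : Finset ℕ} (hS : 0 ∉ S) {x : ℕ} (hx : x ∈ S) :
    (if x - 1 ∈ S then 0 else Apr (lowS S (x - 1))) = Apr (S.erase x) * Bpr (x - 1) (S.erase x) := by
  have hx0 : x ≠ 0 := by rintro rfl; exact hS hx
  have e : x - 1 + 1 = x := by omega
  by_cases h : x - 1 ∈ S
  · rw [if_pos h, Bpr, Finset.prod_eq_zero (i := x - 1)]
    · simp
    · rw [Finset.mem_erase]; exact ⟨by omega, h⟩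
    · simp
  · rw [if_neg h, lowS]
    split_ifs with h1
    · rw [e, h1, Bpr, Finset.prod_eq_one]
      · simp
      · intro y hy
        have hy0 : y ≠ 0 := by rintro rfl; exact hS (Finset.mem_of_mem_erase hy)
        have : (0 : ℝ) < y := by positivity
        simp
        exact hy0
    · rw [e, Apr_insert]
      intro hc; exact h (Finset.mem_of_mem_erase hc)

open Polynomial in
lemma lagrange_id {S : Finset ℕ} (hS : 0 ∉ S) :
    ∑ x ∈ S, (x : ℝ) * ∏ y ∈ S.erase x, (((x : ℝ) * (x - 1) - y * (y + 1)) / ((x : ℝ) * (x - 1) - y * (y - 1))) = ∑ x ∈ S, (x : ℝ) := by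
  rcases S.eq_empty_or_nonempty with rfl | hne
  · simp
  have hinj : Set.InjOn (fun x : ℕ => (x : ℝ) * (x - 1)) S := by
    intro a ha b hb hab
    have ha0 : 1 ≤ a := Nat.one_le_iff_ne_zero.2 (by rintro rfl; exact hS ha)
    have hb0 : 1 ≤ b := Nat.one_le_iff_ne_zero.2 (by rintro rfl; exact hS hb)
    have ha1 : (1 : ℝ) ≤ a := by exact_mod_cast ha0
    have hb1 : (1 : ℝ) ≤ b := by exact_mod_cast hb0
    dsimp at hab
    have : ((a : ℝ) - b) * (a + b - 1) = 0 := by linear_combination hab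
    rcases mul_eq_zero.1 this with h | h
    · exact_mod_cast (sub_eq_zero.1 h)
    · linarith
  set P : ℝ[X] := ∏ y ∈ S, (X - C ((y : ℝ) * (y + 1))) with hP
  set Q : ℝ[X] := ∏ y ∈ S, (X - C ((y : ℝ) * (y - 1))) with hQ
  have hPm : P.Monic := monic_prod_of_monic _ _ fun y _ => monic_X_sub_C _
  have hQm : Q.Monic := monic_prod_of_monic _ _ fun y _ => monic_X_sub_C _
  have hPd : P.degree = S.card := by
    rw [hP, degree_prod, Finset.sum_congr rfl (fun y _ => degree_X_sub_C _)]; simp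
  have hQd : Q.degree = S.card := by
    rw [hQ, degree_prod, Finset.sum_congr rfl (fun y _ => degree_X_sub_C _)]; simp
  have hdeg : (P - Q).degree < S.card := by
    rw [← hPd]
    refine degree_sub_lt_left (hPd.trans hQd.symm) hPm.ne_zero ?_
    rw [hPm.leadingCoeff, hQm.leadingCoeff]
  have key := Lagrange.coeff_eq_sum hinj hdeg
  rw [coeff_sub, hP, hQ, prod_X_sub_C_coeff_card_pred S (fun y : ℕ => (y : ℝ) * (y + 1)) hne.card_pos,
    prod_X_sub_C_coeff_card_pred S (fun y : ℕ => (y : ℝ) * (y - 1)) hne.card_pos, ← hP, ← hQ] at key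
  have e : ∀ x ∈ S, (P - Q).eval ((x : ℝ) * (x - 1)) / ∏ y ∈ S.erase x, ((x : ℝ) * (x - 1) - y * (y - 1)) =
      - 2 * ((x : ℝ) * ∏ y ∈ S.erase x, (((x : ℝ) * (x - 1) - y * (y + 1)) / ((x : ℝ) * (x - 1) - y * (y - 1)))) := by
    intro x hx
    have hQ0 : Q.eval ((x : ℝ) * (x - 1)) = 0 := by
      rw [hQ, eval_prod]
      exact Finset.prod_eq_zero hx (by simp)
    have hP1 : P.eval ((x : ℝ) * (x - 1)) = (-2 * x) * ∏ y ∈ S.erase x, ((x : ℝ) * (x - 1) - y * (y + 1)) := by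
      rw [hP, eval_prod, ← Finset.mul_prod_erase _ _ hx]
      simp only [eval_sub, eval_X, eval_C]
      congr 1; ring
    rw [eval_sub, hQ0, hP1, Finset.prod_div_distrib]
    ring
  rw [Finset.sum_congr rfl e, ← Finset.mul_sum] at key
  have e2 : -∑ y ∈ S, (y : ℝ) * (y + 1) - -∑ y ∈ S, (y : ℝ) * (y - 1) = - 2 * ∑ y ∈ S, (y : ℝ) := by
    rw [neg_sub_neg, ← Finset.sum_sub_distrib, Finset.mul_sum]
    exact Finset.sum_congr rfl fun y _ => by ring
  rw [e2] at key
  linarith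

lemma Apr_rec {S : Finset ℕ} (hS : 0 ∉ S) :
    ∑ x ∈ S, (if x - 1 ∈ S then 0 else Apr (lowS S (x - 1))) = (∑ x ∈ S, (x : ℝ)) * Apr S := by
  rw [← lagrange_id hS, Finset.sum_mul]
  refine Finset.sum_congr rfl fun x hx => ?_
  rw [Apr_low hS hx]
  conv_rhs => rw [← Finset.insert_erase hx]
  rw [Apr_insert (Finset.notMem_erase x S), Finset.insert_erase hx]
  have hx0 : 1 ≤ x := Nat.one_le_iff_ne_zero.2 (by rintro rfl; exact hS hx)
  obtain ⟨z, rfl⟩ : ∃ z, x = z + 1 := ⟨x - 1, by omega⟩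
  rw [Bpr, Bpr, Nat.factorial_succ]
  have hf : (z.factorial : ℝ) ≠ 0 := by positivity
  have hz : (z : ℝ) + 1 ≠ 0 := by positivity
  have : ∀ y ∈ S.erase (z + 1), |((z + 1 - 1 : ℕ) : ℝ) - y| / ((z + 1 - 1 : ℕ) + y) =
     (((z + 1 : ℕ) : ℝ) * ((z + 1 : ℕ) - 1) - y * (y + 1)) / (((z + 1 : ℕ) : ℝ) * ((z + 1 : ℕ) - 1) - y * (y - 1)) *
      (|((z + 1 : ℕ) : ℝ) - y| / ((z + 1 : ℕ) + y)) := by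
    intro y hy
    rw [Finset.mem_erase] at hy
    have hy0 : 1 ≤ y := Nat.one_le_iff_ne_zero.2 (by rintro rfl; exact hS hy.2)
    have hy1 : (1 : ℝ) ≤ y := by exact_mod_cast hy0
    have hz0 : (0 : ℝ) ≤ z := by positivity
    push_cast
    rw [show ((z : ℝ) + 1) * (z + 1 - 1) - y * (y + 1) = (z - y) * (z + 1 + y) by ring,
      show ((z : ℝ) + 1) * (z + 1 - 1) - y * (y - 1) = (z + 1 - y) * (z + y) by ring]
    have h1 : (z : ℝ) + y ≠ 0 := by linarith
    have h2 : (z : ℝ) + 1 + y ≠ 0 := by linarith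
    rcases lt_or_gt_of_ne hy.1 with h | h
    · have h3 : (y : ℝ) ≤ z := by exact_mod_cast (by omega : y ≤ z)
      have h4 : (z : ℝ) + 1 - y ≠ 0 := by linarith
      rw [abs_of_nonneg (by linarith), abs_of_nonneg (by linarith)]
      field_simp
    · have h3 : (z : ℝ) + 1 < y := by exact_mod_cast h
      have h4 : (z : ℝ) + 1 - y ≠ 0 := by linarith
      rw [abs_of_neg (by linarith), abs_of_neg (by linarith)]
      field_simp
  rw [Finset.prod_congr rfl this, Finset.prod_mul_distrib, show z + 1 - 1 = z by omega]
  push_cast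
  field_simp

lemma lowS_sum {S : Finset ℕ} {c : ℕ} (h1 : c + 1 ∈ S) (h2 : c ∉ S) : ∑ x ∈ lowS S c, x + 1 = ∑ x ∈ S, x := by
  rw [← Finset.add_sum_erase S _ h1, lowS]
  split_ifs with h
  · subst h; omega
  · rw [Finset.sum_insert (fun hc => h2 (Finset.mem_of_mem_erase hc))]; omega

theorem cntS_eq (M L : ℕ) (S : Finset ℕ) (hS : ∀ x ∈ S, 0 < x ∧ x ≤ M) (hL : ∑ x ∈ S, x = L) :
    cntS M L S = (L.factorial : ℝ) * Apr S := by
  classical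
  induction L generalizing S with
  | zero =>
    have : S = ∅ := by
      rw [Finset.eq_empty_iff_forall_notMem]
      intro x hx
      have h1 := (Finset.sum_eq_zero_iff.1 hL) x hx
      have := hS x hx
      omega
    subst this
    have e : stS ∅ = {0} := by ext y; simp [stS]
    rw [cntS, lw, Finset.sum_singleton, if_pos ⟨trivial, e.symm⟩]
    simp [Apr]
  | succ L ih =>
    have h0 : 0 ∉ S := fun h => by have := hS 0 h; omega
    rw [cntS_succ hS]
    have : ∀ x ∈ S, (if x - 1 ∈ S then 0 else cntS M L (lowS S (x - 1))) =
        (L.factorial : ℝ) * (if x - 1 ∈ S then 0 else Apr (lowS S (x - 1))) := by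
      intro x hx
      have hxp := hS x hx
      split_ifs with h
      · simp
      · refine ih _ ?_ ?_
        · intro y hy
          rw [lowS] at hy
          split_ifs at hy with h1
          · exact hS y (Finset.mem_of_mem_erase hy)
          · rw [Finset.mem_insert] at hy
            rcases hy with rfl | hy
            · omega
            · exact hS y (Finset.mem_of_mem_erase hy)
        · have := lowS_sum (S := S) (c := x - 1) (by rwa [show x - 1 + 1 = x by omega]) h
          omega
    rw [Finset.sum_congr rfl this, ← Finset.mul_sum, Apr_rec h0, Nat.factorial_succ]
    have e : ∑ x ∈ S, (x : ℝ) = ((L + 1 : ℕ) : ℝ) := by rw [← hL]; push_cast; rfl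
    rw [e]
    push_cast; ring
end shifted

/-- the odd parts -/
def oddS (n : ℕ) : Finset ℕ := (Finset.range n).image (fun i => 2 * i + 1)

lemma oddS_succ (n : ℕ) : oddS (n + 1) = insert (2 * n + 1) (oddS n) := by
  rw [oddS, Finset.range_add_one, Finset.image_insert]; rfl

lemma oddS_nmem (n : ℕ) : 2 * n + 1 ∉ oddS n := by
  simp [oddS]

lemma mem_oddS (n x : ℕ) : x ∈ oddS n ↔ x < 2 * n ∧ x % 2 = 1 := by
  simp only [oddS, Finset.mem_image, Finset.mem_range]
  constructor
  · rintro ⟨a, h, rfl⟩; omega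
  · rintro ⟨h1, h2⟩; exact ⟨x / 2, by omega, by omega⟩

lemma oddS_sum (n : ℕ) : ∑ x ∈ oddS n, x = n * n := by
  induction n with
  | zero => rfl
  | succ n ih => rw [oddS_succ, Finset.sum_insert (oddS_nmem n), ih]; ring

lemma stS_oddS (n : ℕ) : stS (oddS n) = stB n := by
  ext y
  simp only [stS, stB, Set.mem_ofPred_eq, mem_oddS]
  omega

lemma Bpr_odd (n : ℕ) : Bpr (2 * n + 1) (oddS n) * ((2 * n + 1).factorial * (2 * n).factorial : ℝ) = (n.factorial : ℝ) * n.factorial := by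
  have h2 := hook_row n n
  have h3 : ∏ i ∈ Finset.range n, ((n : ℝ) - i) = n.factorial := by
    rw [← Nat.descFactorial_self n, Nat.descFactorial_eq_prod_range, Nat.cast_prod]
    refine Finset.prod_congr rfl fun i hi => ?_
    rw [Nat.cast_sub (Finset.mem_range.1 hi).le]
  have h2' : (n.factorial : ℝ) * ∏ i ∈ Finset.range n, ((n : ℝ) + i + 1) = (2 * n).factorial := by
    rw [two_mul, ← h2]; push_cast; rfl
  have hp : (∏ i ∈ Finset.range n, ((n : ℝ) + i + 1)) ≠ 0 := by
    refine Finset.prod_ne_zero_iff.2 fun i _ => ?_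
    positivity
  rw [Bpr, oddS, Finset.prod_image (by intro a _ b _ h; simpa using h)]
  have e : ∀ i ∈ Finset.range n, |((2 * n + 1 : ℕ) : ℝ) - (2 * i + 1 : ℕ)| / ((2 * n + 1 : ℕ) + (2 * i + 1 : ℕ)) = ((n : ℝ) - i) / (n + i + 1) := by
    intro i hi
    have : (i : ℝ) ≤ n := by exact_mod_cast (Finset.mem_range.1 hi).le
    have h0 : (n : ℝ) + i + 1 ≠ 0 := by positivity
    have h1 : (n : ℝ) * 2 + 1 + (i * 2 + 1) ≠ 0 := by positivity
    push_cast
    rw [abs_of_nonneg (by linarith), div_eq_div_iff (by positivity) h0]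
    ring
  rw [Finset.prod_congr rfl e, Finset.prod_div_distrib, h3, ← h2']
  have : ((2 * n + 1).factorial : ℝ) ≠ 0 := by positivity
  field_simp

lemma HH_succ (n : ℕ) : HH (n + 1) * (n.factorial * n.factorial) = HH n * ((2 * n + 1).factorial * (2 * n).factorial) := by
  have h1 := hook_row n (n + 1)
  have h2 := hook_row n n
  have e : HH (n + 1) = HH n * (∏ j ∈ Finset.range n, (n + j + 1)) * ∏ j ∈ Finset.range (n + 1), (n + j + 1) := by
    rw [HH, Finset.prod_range_succ]
    congr 1
    rw [HH, ← Finset.prod_mul_distrib]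
    refine Finset.prod_congr rfl fun i _ => ?_
    rw [Finset.prod_range_succ, add_comm i n]
  rw [e, show 2 * n + 1 = n + (n + 1) by ring, ← h1, two_mul, ← h2]
  ring

lemma Apr_odd (n : ℕ) : Apr (oddS n) * HH n = 1 := by
  induction n with
  | zero => simp [Apr, oddS, HH]
  | succ n ih =>
    rw [oddS_succ, Apr_insert (oddS_nmem n)]
    have h1 := Bpr_odd n
    have h2 : (HH (n + 1) : ℝ) * (n.factorial * n.factorial) = HH n * ((2 * n + 1).factorial * (2 * n).factorial) := by exact_mod_cast HH_succ n
    have hf : (n.factorial : ℝ) * n.factorial ≠ 0 := by positivity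
    refine mul_right_cancel₀ hf ?_
    linear_combination (Apr (oddS n) * Bpr (2 * n + 1) (oddS n)) * h2 + Apr (oddS n) * HH n * h1 + ((n.factorial : ℝ) * n.factorial) * ih

theorem Psi_surj {n : ℕ} (hn : n ≠ 0) (T : List ℤ) (hT : WA n T) : ∃ Q, WB n Q ∧ Psi n Q = T := by
  classical
  set B := (lw (2 * n) (n * n)).filter (fun T => HPath true {0} T (stB n)) with hB
  have hBW : ∀ Q ∈ B, WB n Q := by
    intro Q hQ
    rw [hB, Finset.mem_filter, mem_lw] at hQ
    exact ⟨hQ.2, hQ.1.1⟩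
  have hcard : (B.card : ℝ) * HH n = (n * n).factorial := by
    have h := cntS_eq (2 * n) (n * n) (oddS n) (by intro x hx; rw [mem_oddS] at hx; omega) (oddS_sum n)
    rw [cntS, stS_oddS, Finset.sum_boole] at h
    have h' : (B.card : ℝ) = ((n * n).factorial : ℝ) * Apr (oddS n) := by
      rw [← h]
    rw [h', mul_assoc, Apr_odd, mul_one]
  have hA := WA_card hn
  have hAf := WA_finite n
  have hle : hAf.toFinset.card ≤ B.card := by
    have h1 : {T | WA n T}.ncard = hAf.toFinset.card := Set.ncard_eq_toFinset_card _ hAf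
    have h2 : B.card * HH n = (n * n).factorial := by exact_mod_cast hcard
    rw [h1, ← h2] at hA
    exact (Nat.eq_of_mul_eq_mul_right (HH_pos n) hA).le
  obtain ⟨Q, hQ, h⟩ := Finset.surj_on_of_inj_on_of_card_le (s := B) (t := hAf.toFinset) (fun Q _ => Psi n Q)
    (fun Q hQ => by rw [Set.Finite.mem_toFinset]; exact Psi_WA (hBW Q hQ))
    (fun Q Q' hQ hQ' h => Psi_inj (hBW Q hQ) (hBW Q' hQ') h) hle T (by rw [Set.Finite.mem_toFinset]; exact hT)
  exact ⟨Q, hBW Q hQ, h.symm⟩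

/-! ## The bridge between words and shifted tableaux -/

/-- position (shifted by `i`) of the `a`-th occurrence of `z` -/
def go : ℕ → ℕ → ℤ → List ℤ → ℕ
  | _, _, _, [] => 0
  | i, a, z, y :: w => if y = z then (if a = 0 then i else go (i + 1) (a - 1) z w) else go (i + 1) a z w

/-- the filling of a word -/
def phi (w : List ℤ) (c : ℕ × ℕ) : ℕ := go 1 c.1 ((c.2 : ℤ) - c.1) w

lemma go_append (i a : ℕ) (z : ℤ) (u v : List ℤ) :
    go i a z (u ++ v) = if a < u.count z then go i a z u else go (i + u.length) (a - u.count z) z v := by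
  induction u generalizing i a with
  | nil => simp
  | cons y u ih =>
    rw [List.cons_append, go, go]
    by_cases hy : y = z
    · subst hy
      rw [if_pos rfl, if_pos rfl, List.count_cons_self]
      by_cases ha : a = 0
      · rw [if_pos ha, if_pos ha, if_pos (by omega)]
      · rw [if_neg ha, if_neg ha, ih, List.length_cons, show i + 1 + u.length = i + (u.length + 1) by omega,
          show a - 1 - u.count y = a - (u.count y + 1) by omega]
        exact if_congr (by omega) rfl rfl
    · rw [if_neg hy, if_neg hy, List.count_cons_of_ne hy, ih, List.length_cons,
        show i + 1 + u.length = i + (u.length + 1) by omega]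

lemma go_zero {i a : ℕ} {z : ℤ} {w : List ℤ} (h : w.count z ≤ a) : go i a z w = 0 := by
  induction w generalizing i a with
  | nil => rfl
  | cons y w ih =>
    rw [go]
    by_cases hy : y = z
    · subst hy
      rw [List.count_cons_self] at h
      rw [if_pos rfl, if_neg (by omega)]
      exact ih (by omega)
    · rw [List.count_cons_of_ne hy] at h
      rw [if_neg hy]
      exact ih h

lemma go_dec (a : ℕ) (z : ℤ) (w : List ℤ) (h : a < w.count z) :
    ∃ u v, w = u ++ z :: v ∧ u.count z = a ∧ ∀ i, go i a z w = i + u.length := by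
  induction w generalizing a with
  | nil => simp at h
  | cons y w ih =>
    by_cases hy : y = z
    · subst hy
      rw [List.count_cons_self] at h
      by_cases ha : a = 0
      · refine ⟨[], w, rfl, by simp [ha], fun i => by simp [go, ha]⟩
      · obtain ⟨u, v, h1, h2, h3⟩ := ih (a - 1) (by omega)
        refine ⟨y :: u, v, by rw [h1]; rfl, by rw [List.count_cons_self]; omega, fun i => ?_⟩
        rw [go, if_pos rfl, if_neg ha, h3, List.length_cons]; omega
    · rw [List.count_cons_of_ne hy] at h
      obtain ⟨u, v, h1, h2, h3⟩ := ih a h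
      refine ⟨y :: u, v, by rw [h1]; rfl, by rw [List.count_cons_of_ne hy, h2], fun i => ?_⟩
      rw [go, if_neg hy, h3, List.length_cons]; omega

lemma go_self (i : ℕ) (z : ℤ) (u v : List ℤ) : go i (u.count z) z (u ++ z :: v) = i + u.length := by
  rw [go_append, if_neg (by omega), go, if_pos rfl, if_pos (by omega)]

lemma go_pos {i a : ℕ} {z : ℤ} {w : List ℤ} (hi : 1 ≤ i) : go i a z w ≠ 0 ↔ a < w.count z := by
  constructor
  · intro h
    by_contra hc
    exact h (go_zero (by omega))
  · intro h
    obtain ⟨u, v, _, _, h3⟩ := go_dec a z w h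
    rw [h3]; omega

lemma go_ge {i a : ℕ} {z : ℤ} {w : List ℤ} : go i a z w = 0 ∨ i ≤ go i a z w := by
  by_cases h : a < w.count z
  · obtain ⟨u, v, _, _, h3⟩ := go_dec a z w h
    rw [h3]; omega
  · left; exact go_zero (by omega)

lemma go_le {i a : ℕ} {z : ℤ} {w : List ℤ} (h : a < w.count z) : go i a z w < i + w.length := by
  obtain ⟨u, v, h1, _, h3⟩ := go_dec a z w h
  rw [h3, h1, List.length_append, List.length_cons]; omega

lemma go_sub_one {i a : ℕ} {z : ℤ} {w : List ℤ} : go (i + 1) a z w - 1 = go i a z w := by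
  by_cases h : a < w.count z
  · obtain ⟨u, v, _, _, h3⟩ := go_dec a z w h
    rw [h3, h3]; omega
  · rw [go_zero (by omega), go_zero (by omega)]

/-- counts along a path -/
lemma path_inv (w : List ℤ) (h : WValid true {0} w) :
    (∀ z ∈ w, 0 ≤ z) ∧ (∀ z : ℤ, 0 ≤ z → w.count (z + 1) ≤ w.count z ∧ w.count z ≤ w.count (z + 1) + 1) ∧
    hopW true {0} w = {y | y = 0 ∨ (1 ≤ y ∧ w.count (y - 1) = w.count y + 1)} := by
  induction w using List.reverseRecOn with
  | nil =>
    refine ⟨by simp, by simp, ?_⟩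
    ext y; simp [hopW]
  | append_singleton w x ih =>
    rw [WValid_append] at h
    obtain ⟨i1, i2, i3⟩ := ih h.1
    have hv := h.2.1
    rw [i3] at hv
    have hc : ∀ z, (w ++ [x]).count z = w.count z + if x = z then 1 else 0 := by
      intro z
      rw [List.count_append, List.count_singleton]
      simp
    have hx1 : 0 ≤ x := by
      rcases hv.1 with h | h <;> omega
    have hx2 : w.count (x + 1) = w.count x := by
      have h2 := hv.2
      have := i2 x hx1
      simp only [Set.mem_ofPred_eq, not_or, not_and] at h2
      have := h2.2 (by omega)
      rw [show x + 1 - 1 = x by ring] at this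
      omega
    refine ⟨?_, ?_, ?_⟩
    · intro z hz
      rw [List.mem_append, List.mem_singleton] at hz
      rcases hz with hz | rfl
      · exact i1 z hz
      · exact hx1
    · intro z hz
      rw [hc, hc]
      have := i2 z hz
      by_cases h1 : x = z
      · subst h1
        rw [if_pos rfl, if_neg (by omega)]; omega
      · rw [if_neg h1]
        by_cases h2 : x = z + 1
        · rw [if_pos h2]
          have h3 : w.count (x - 1) = w.count x + 1 := by
            rcases hv.1 with h | h
            · omega
            · exact h.2
          rw [h2, show z + 1 - 1 = z by ring] at h3
          omega
        · rw [if_neg h2]; omega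
    · rw [hopW_append]
      ext y
      simp only [hopW, mem_hop, i3, Set.mem_ofPred_eq, hc]
      by_cases h1 : y = x + 1
      · subst h1
        simp [hx2]; omega
      · by_cases h2 : y = x
        · subst h2
          have : w.count (y - 1) ≤ w.count y + 1 ∨ y = 0 := by
            by_cases h : y = 0
            · exact Or.inr h
            · left
              have := i2 (y - 1) (by omega)
              rw [show y - 1 + 1 = y by ring] at this
              exact this.2
          have e : y ≠ y - 1 := by omega
          simp [e, h1]
          omega
        · rw [if_neg (by omega), if_neg (by omega)]
          simp [h1, h2]

lemma valid_counts {u v : List ℤ} {x : ℤ} (h : WValid true {0} (u ++ x :: v)) :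
    0 ≤ x ∧ u.count (x + 1) = u.count x ∧ (1 ≤ x → u.count (x - 1) = u.count x + 1) := by
  rw [WValid_append] at h
  obtain ⟨i1, i2, i3⟩ := path_inv u h.1
  have hv := h.2.1
  rw [i3] at hv
  have hx1 : 0 ≤ x := by
    rcases hv.1 with h | h <;> omega
  refine ⟨hx1, ?_, ?_⟩
  · have h2 := hv.2
    have := i2 x hx1
    simp only [Set.mem_ofPred_eq, not_or, not_and] at h2
    have := h2.2 (by omega)
    rw [show x + 1 - 1 = x by ring] at this
    omega
  · intro hx
    rcases hv.1 with h | h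
    · omega
    · exact h.2

lemma WB_counts {n : ℕ} {w : List ℤ} (h : WB n w) (z : ℕ) : w.count (z : ℤ) = (2 * n - z) / 2 := by
  obtain ⟨i1, i2, i3⟩ := path_inv w h.1.1
  rw [h.1.2] at i3
  have hb : ∀ z : ℕ, w.count (z : ℤ) = w.count ((z : ℤ) + 1) + if z < 2 * n ∧ z % 2 = 0 then 1 else 0 := by
    intro z
    have h1 : ((z : ℤ) + 1 ∈ stB n) ↔ w.count (z : ℤ) = w.count ((z : ℤ) + 1) + 1 := by
      rw [i3]
      simp only [Set.mem_ofPred_eq, show (z : ℤ) + 1 - 1 = z by ring]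
      omega
    have h2 := i2 z (by omega)
    simp only [stB, Set.mem_ofPred_eq] at h1
    split_ifs with h3
    · exact h1.1 (by omega)
    · by_contra hc
      have := h1.2 (by omega)
      omega
  -- eventually zero
  have hz : ∀ k z : ℕ, 2 * n ≤ z → w.count (z : ℤ) = w.count ((z + k : ℕ) : ℤ) := by
    intro k
    induction k with
    | zero => intro z _; rfl
    | succ k ih =>
      intro z hz
      rw [ih z hz, hb, if_neg (by omega)]
      push_cast
      rw [add_zero, add_assoc]
  have hbig : ∃ K : ℕ, ∀ x ∈ w, x < K := by
    clear hz hb i1 i2 i3 h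
    induction w with
    | nil => exact ⟨0, by simp⟩
    | cons y w ih =>
      obtain ⟨K, hK⟩ := ih
      refine ⟨K + y.toNat + 1, fun x hx => ?_⟩
      rcases List.mem_cons.1 hx with rfl | hx
      · push_cast; omega
      · have := hK x hx; push_cast; omega
  obtain ⟨K, hK⟩ := hbig
  have hz0 : ∀ z : ℕ, 2 * n ≤ z → w.count (z : ℤ) = 0 := by
    intro z hz'
    rw [hz K z hz', List.count_eq_zero]
    intro hm
    have := hK _ hm
    push_cast at this
    omega
  by_cases hzn : 2 * n ≤ z
  · rw [hz0 z hzn]; omega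
  · obtain ⟨k, hk⟩ : ∃ k, z + k = 2 * n := ⟨2 * n - z, by omega⟩
    clear hzn
    induction k generalizing z with
    | zero => rw [hz0 z (by omega)]; omega
    | succ k ih =>
      rw [hb z]
      have := ih (z + 1) (by omega)
      push_cast at this
      rw [this]
      split_ifs <;> omega

/-- the hybrid filling with the hole at the letter `x` -/
def Gv (u : List ℤ) (x : ℤ) (r : List ℤ) (c : ℕ × ℕ) : ℕ :=
  if c.1 < u.count ((c.2 : ℤ) - c.1) then go 1 c.1 ((c.2 : ℤ) - c.1) u
  else if (c.2 : ℤ) - c.1 = x then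
    (if c.1 = u.count x then 0 else go (u.length + 1) (c.1 - u.count x - 1) x r)
  else go (u.length + 1) (c.1 - u.count ((c.2 : ℤ) - c.1)) ((c.2 : ℤ) - c.1) r

/-- the cell of the next letter -/
def cel (u : List ℤ) (x : ℤ) : ℕ × ℕ := (u.count x, u.count x + x.toNat)

lemma count_snoc (u : List ℤ) (y z : ℤ) : (u ++ [y]).count z = u.count z + if y = z then 1 else 0 := by
  rw [List.count_append, List.count_singleton]; simp

lemma go_snoc (u : List ℤ) (y z : ℤ) (a : ℕ) : go 1 a z (u ++ [y]) =
    if a < u.count z then go 1 a z u else if y = z ∧ a = u.count z then u.length + 1 else 0 := by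
  rw [go_append]
  by_cases h : a < u.count z
  · rw [if_pos h, if_pos h]
  · rw [if_neg h, if_neg h, go]
    by_cases hy : y = z
    · by_cases ha : a = u.count z
      · rw [if_pos hy, if_pos (by omega), if_pos ⟨hy, ha⟩]; omega
      · rw [if_pos hy, if_neg (by omega), if_neg (by tauto)]; rfl
    · rw [if_neg hy, if_neg (by tauto)]; rfl

lemma Gv_far {u r : List ℤ} {x y : ℤ} (h : x ≠ y) : Gv u x (y :: r) = Gv (u ++ [y]) x r := by
  funext ⟨a, b⟩
  unfold Gv
  dsimp only
  generalize (b : ℤ) - a = z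
  rw [count_snoc, count_snoc, go_snoc, List.length_append, List.length_singleton]
  simp only [go]
  by_cases hzy : y = z
  · subst hzy
    have h' : ¬ y = x := fun e => h e.symm
    simp only [h', if_true, if_false, true_and]
    by_cases h1 : a < u.count y
    · rw [if_pos h1, if_pos (by omega), if_pos h1]
    · by_cases h2 : a = u.count y
      · rw [if_neg h1, if_pos (by omega), if_pos (by omega), if_neg h1, if_pos h2]
      · rw [if_neg h1, if_neg (by omega), if_neg (by omega), Nat.sub_sub]
  · have h' : ¬ y = x := fun e => h e.symm
    simp only [hzy, h', if_false, add_zero, false_and]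
    by_cases h1 : a < u.count z
    · simp [h1]
    · simp [h1]

lemma cel_far {u : List ℤ} {x y : ℤ} (h : x ≠ y) : cel (u ++ [y]) x = cel u x := by
  unfold cel
  rw [count_snoc, if_neg (fun e => h e.symm), add_zero]

lemma Gv_near {u r : List ℤ} {x y : ℤ} (h : x ≠ y) (hx : 0 ≤ x) (hy : 0 ≤ y) :
    Function.update (Function.update (Gv u x (y :: r)) (cel u y) 0) (cel u x) (u.length + 1) =
      Gv (u ++ [x]) y r := by
  funext ⟨a, b⟩
  have h' : ¬ y = x := fun e => h e.symm
  rw [Function.update_apply, Function.update_apply]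
  have e1 : ((a, b) = cel u x) ↔ ((b : ℤ) - a = x ∧ a = u.count x) := by
    unfold cel; rw [Prod.mk.injEq]; omega
  have e2 : ((a, b) = cel u y) ↔ ((b : ℤ) - a = y ∧ a = u.count y) := by
    unfold cel; rw [Prod.mk.injEq]; omega
  rw [if_congr e1 rfl rfl, if_congr e2 rfl rfl]
  unfold Gv
  dsimp only
  generalize (b : ℤ) - a = z
  rw [count_snoc, count_snoc, go_snoc, List.length_append, List.length_singleton]
  simp only [go]
  by_cases hzx : z = x
  · subst hzx
    simp only [h, h', if_true, if_false, true_and, false_and]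
    by_cases h1 : a = u.count z
    · rw [if_pos h1, if_pos (by omega), if_neg (by omega), if_pos h1]
    · rw [if_neg h1]
      by_cases h2 : a < u.count z
      · simp [h2, show a < u.count z + 1 by omega]
      · rw [if_neg h2, if_neg h1, if_neg (by omega), Nat.sub_sub]
  · have hzx' : ¬ x = z := fun e => hzx e.symm
    by_cases hzy : z = y
    · subst hzy
      simp only [h, h', if_true, if_false, true_and, false_and, add_zero]
      by_cases h1 : a = u.count z
      · simp [h1]
      · by_cases h2 : a < u.count z
        · simp [h1, h2]
        · rw [if_neg h1, if_neg h2, if_neg (by omega), if_neg h2, if_neg h1]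
    · have hzy' : ¬ y = z := fun e => hzy e.symm
      simp only [hzx, hzx', hzy, hzy', if_false, false_and, add_zero]
      by_cases h2 : a < u.count z
      · simp [h2]
      · simp [h2]

lemma Gv_right {u r : List ℤ} {x : ℤ} (hx : 0 ≤ x) (h : u.count (x + 1) = u.count x) :
    Gv u x r ((cel u x).1, (cel u x).2 + 1) = go (u.length + 1) 0 (x + 1) r := by
  unfold Gv cel
  dsimp only
  have e : ((u.count x + x.toNat + 1 : ℕ) : ℤ) - (u.count x : ℕ) = x + 1 := by push_cast; omega
  rw [e, if_neg (by omega), if_neg (by omega), h, Nat.sub_self]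

lemma Gv_down {u r : List ℤ} {x : ℤ} (hx : 1 ≤ x) (h : u.count (x - 1) = u.count x + 1) :
    Gv u x r ((cel u x).1 + 1, (cel u x).2) = go (u.length + 1) 0 (x - 1) r := by
  unfold Gv cel
  dsimp only
  have e : ((u.count x + x.toNat : ℕ) : ℤ) - (u.count x + 1 : ℕ) = x - 1 := by push_cast; omega
  rw [e, if_neg (by omega), if_neg (by omega), h, Nat.sub_self]

lemma Gv_down0 {u r : List ℤ} (hu : ∀ z ∈ u, 0 ≤ z) (hr : ∀ z ∈ r, 0 ≤ z) :
    Gv u 0 r ((cel u 0).1 + 1, (cel u 0).2) = 0 := by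
  unfold Gv cel
  dsimp only
  have e : ((u.count 0 + (0 : ℤ).toNat : ℕ) : ℤ) - (u.count 0 + 1 : ℕ) = -1 := by push_cast; omega
  have h1 : u.count (-1) = 0 := List.count_eq_zero.2 fun h => by have := hu _ h; omega
  have h2 : r.count (-1) = 0 := List.count_eq_zero.2 fun h => by have := hr _ h; omega
  rw [e, if_neg (by omega), if_neg (by omega)]
  exact go_zero (by omega)

lemma jdt_word {u r : List ℤ} {x : ℤ} {fuel : ℕ} (hf : r.length ≤ fuel)
    (h : WValid true {0} (u ++ x :: r)) :
    jdtSlide fuel (Gv u x r) (cel u x) =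
      (Gv (u ++ (thru x r).1) (thru x r).2 [], cel (u ++ (thru x r).1) (thru x r).2) := by
  induction r generalizing u x fuel with
  | nil =>
    simp only [thru, List.append_nil]
    cases fuel with
    | zero => rfl
    | succ fuel =>
      obtain ⟨c1, c2, c3⟩ := valid_counts h
      have hR : Gv u x [] ((cel u x).1, (cel u x).2 + 1) = 0 := by rw [Gv_right c1 c2]; rfl
      have hD : Gv u x [] ((cel u x).1 + 1, (cel u x).2) = 0 := by
        by_cases hx : x = 0
        · subst hx
          refine Gv_down0 ?_ (by simp)
          intro z hz
          exact (path_inv _ h).1 z (List.mem_append_left _ hz)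
        · rw [Gv_down (by omega) (c3 (by omega))]; rfl
      rw [jdtSlide]
      rw [hR, hD, if_pos ⟨rfl, rfl⟩]
  | cons y r ih =>
    obtain ⟨c1, c2, c3⟩ := valid_counts h
    have hpos := (path_inv _ h).1
    have hxy : x ≠ y := by
      rw [WValid_append] at h
      exact Hvalid_ne h.2.2.1
    have hy : 0 ≤ y := hpos y (by simp)
    by_cases hfar : Far x y
    · rw [thru, if_pos hfar, Gv_far hxy, ← cel_far hxy, ih (by simp at hf; omega)]
      · simp
      · rw [WValid_append] at h ⊢
        rw [WValid_append]
        refine ⟨⟨h.1, ?_, trivial⟩, ?_⟩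
        · exact (Hvalid_comm hfar).1 h.2.2.1
        · rw [hopW_append]
          refine ⟨?_, ?_⟩
          · exact (Hvalid_comm hfar.symm).2 h.2.1
          · have := h.2.2.2
            rw [hop_comm _ _ hfar] at this
            exact this
    · rw [thru, if_neg hfar]
      obtain ⟨fuel, rfl⟩ : ∃ k, fuel = k + 1 := ⟨fuel - 1, by simp at hf; omega⟩
      have hih := ih (u := u ++ [x]) (x := y) (fuel := fuel) (by simp at hf; omega) (by simpa using h)
      have hG := Gv_near (u := u) (r := r) hxy c1 hy
      have hR : Gv u x (y :: r) ((cel u x).1, (cel u x).2 + 1) = go (u.length + 1) 0 (x + 1) (y :: r) := Gv_right c1 c2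
      have hcy : cel (u ++ [x]) y = cel u y := cel_far hxy.symm
      have happ : u ++ x :: (thru y r).1 = u ++ [x] ++ (thru y r).1 := by simp
      dsimp only
      rw [happ, ← hih, ← hG, hcy, jdtSlide]
      rw [hR, go]
      unfold Far at hfar
      by_cases hup : y = x + 1
      · rw [if_pos hup, if_pos rfl]
        have hD : Gv u x (y :: r) ((cel u x).1 + 1, (cel u x).2) = 0 ∨ u.length + 2 ≤ Gv u x (y :: r) ((cel u x).1 + 1, (cel u x).2) := by
          by_cases hx : x = 0
          · subst hx
            left
            refine Gv_down0 ?_ ?_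
            · intro z hz; exact hpos z (List.mem_append_left _ hz)
            · intro z hz; exact hpos z (List.mem_append_right _ (List.mem_cons_of_mem _ hz))
          · rw [Gv_down (by omega) (c3 (by omega)), go, if_neg (by omega)]
            exact go_ge
        have hcel : cel u y = ((cel u x).1, (cel u x).2 + 1) := by
          unfold cel
          rw [hup, c2, Prod.mk.injEq]; dsimp only; omega
        rw [if_neg (by omega), if_pos (by omega), hcel]
      · have hdn : y = x - 1 := by omega
        have hD : Gv u x (y :: r) ((cel u x).1 + 1, (cel u x).2) = u.length + 1 := by
          rw [Gv_down (by omega) (c3 (by omega)), go, if_pos hdn, if_pos rfl]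
        have hcel : cel u y = ((cel u x).1 + 1, (cel u x).2) := by
          unfold cel
          rw [hdn, c3 (by omega), Prod.mk.injEq]; dsimp only; omega
        have hgo : go (u.length + 1 + 1) 0 (x + 1) r = 0 ∨ u.length + 1 + 1 ≤ go (u.length + 1 + 1) 0 (x + 1) r := go_ge
        rw [if_neg hup, hD, if_neg (by omega), if_neg (by omega), hcel]

lemma Gv_final (u : List ℤ) {x : ℤ} (hx : 0 ≤ x) :
    Function.update (Gv u x []) (cel u x) (u.length + 1) = phi (u ++ [x]) := by
  funext ⟨a, b⟩
  rw [Function.update_apply]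
  have e1 : ((a, b) = cel u x) ↔ ((b : ℤ) - a = x ∧ a = u.count x) := by
    unfold cel; rw [Prod.mk.injEq]; omega
  rw [if_congr e1 rfl rfl]
  unfold Gv phi
  dsimp only
  rw [go_snoc]
  generalize (b : ℤ) - a = z
  by_cases h1 : z = x
  · subst h1
    by_cases h2 : a = u.count z
    · simp [h2]
    · simp [h2, go]
  · have h1' : ¬ x = z := fun e => h1 e.symm
    simp [h1, h1', go]

theorem promote_phi {w : List ℤ} {N : ℕ} (hN : w.length = N) (h : WValid true {0} w) :
    promote N (phi w) = phi (wprom w) := by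
  cases w with
  | nil =>
    simp at hN
    subst hN
    funext c
    simp [promote, jdtSlide, phi, go, wprom]
  | cons x r =>
    have e : (fun c => phi (x :: r) c - 1) = Gv [] x r := by
      funext ⟨a, b⟩
      unfold Gv phi
      dsimp only
      generalize (b : ℤ) - a = z
      rw [show go 1 a z (x :: r) = if x = z then (if a = 0 then 1 else go 2 (a - 1) z r) else go 2 a z r from rfl]
      by_cases h1 : z = x
      · subst h1
        by_cases h2 : a = 0
        · simp [h2]
        · rw [if_pos rfl, if_neg h2, go_sub_one]; simp [h2]
      · have h1' : ¬ x = z := fun e => h1 e.symm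
        rw [if_neg h1', go_sub_one]; simp [h1]
    have hc : ((0, 0) : ℕ × ℕ) = cel [] x := by
      have : x = 0 := h.1.1
      subst this; rfl
    have hlast : 0 ≤ (thru x r).2 := by
      have h2 : HPath true {0} ((thru x r).1 ++ [(thru x r).2]) (hopW true {0} (x :: r)) := thru_path_iff.2 ⟨h, rfl⟩
      exact (path_inv _ h2.1).1 _ (by simp)
    unfold promote
    dsimp only
    rw [e, hc, jdt_word (by rw [← hN]; simp) (by simpa using h)]
    dsimp only
    rw [List.nil_append, wprom, ← Gv_final _ hlast, thru_length, ← hN, List.length_cons]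

lemma shiftCell_dbl (n a b : ℕ) : shiftCell (dblStair n) (a, b) ↔ a ≤ b ∧ a < (2 * n - (b - a)) / 2 := by
  unfold shiftCell dblStair
  dsimp only
  by_cases h : a < n
  · have : ((List.range n).map (fun i => 2 * n - 1 - 2 * i)).getD a 0 = 2 * n - 1 - 2 * a := by
      simp [List.getD, h]
    rw [this]; omega
  · have : ((List.range n).map (fun i => 2 * n - 1 - 2 * i)).getD a 0 = 0 := by
      simp [List.getD, h]
    rw [this]; omega

lemma WB_cell {n : ℕ} {w : List ℤ} (h : WB n w) (a b : ℕ) :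
    shiftCell (dblStair n) (a, b) ↔ a < w.count ((b : ℤ) - a) := by
  rw [shiftCell_dbl]
  by_cases hab : a ≤ b
  · have e : (b : ℤ) - a = ((b - a : ℕ) : ℤ) := by omega
    rw [e, WB_counts h]; tauto
  · have : w.count ((b : ℤ) - a) = 0 := List.count_eq_zero.2 fun hm => by
      have := (path_inv w h.1.1).1 _ hm; omega
    rw [this]; omega

lemma go_inj {w : List ℤ} {a a' : ℕ} {z z' : ℤ} (h : a < w.count z) (h' : a' < w.count z')
    (e : go 1 a z w = go 1 a' z' w) : a = a' ∧ z = z' := by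
  obtain ⟨u, v, h1, h2, h3⟩ := go_dec a z w h
  obtain ⟨u', v', h1', h2', h3'⟩ := go_dec a' z' w h'
  rw [h3, h3'] at e
  have := List.append_inj (h1.symm.trans h1') (by omega)
  obtain ⟨rfl, h5⟩ := this
  have hz : z = z' := by simp at h5; exact h5.1
  subst hz
  exact ⟨by omega, rfl⟩

theorem phi_std {n : ℕ} {w : List ℤ} (h : WB n w) : IsStdFilling (shiftCell (dblStair n)) (n ^ 2) (phi w) := by
  have hl : w.length = n ^ 2 := by rw [h.2, sq]
  refine ⟨?_, ?_, ?_, ?_, ?_, ?_⟩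
  · rintro ⟨a, b⟩ hc
    rw [WB_cell h] at hc
    exact go_zero (by dsimp only; omega)
  · rintro ⟨a, b⟩ hc
    rw [WB_cell h] at hc
    have h1 := (go_pos (i := 1) le_rfl).2 hc
    have h2 := go_le (i := 1) hc
    unfold phi
    dsimp only
    omega
  · rintro ⟨a, b⟩ ⟨a', b'⟩ hc hc' e
    rw [WB_cell h] at hc hc'
    have := go_inj hc hc' e
    rw [Prod.mk.injEq]; omega
  · intro v hv1 hv2
    have hlt : v - 1 < w.length := by omega
    have hw : w = w.take (v - 1) ++ w[v - 1] :: w.drop (v - 1 + 1) := by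
      rw [List.getElem_cons_drop, List.take_append_drop]
    set u := w.take (v - 1) with hu
    set x := w[v - 1] with hx
    have hx0 : 0 ≤ x := (path_inv w h.1.1).1 x (List.getElem_mem _)
    have e : ((u.count x + x.toNat : ℕ) : ℤ) - (u.count x : ℕ) = x := by push_cast; omega
    refine ⟨(u.count x, u.count x + x.toNat), ?_, ?_⟩
    · rw [WB_cell h, e]
      conv_rhs => rw [hw]
      rw [List.count_append, List.count_cons_self]; omega
    · unfold phi
      dsimp only
      rw [e]
      conv_lhs => rw [hw]
      rw [go_self, hu, List.length_take]; omega
  · intro a b hc hc'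
    rw [WB_cell h] at hc hc'
    obtain ⟨u, v, h1, h2, h3⟩ := go_dec _ _ w hc'
    have hv := valid_counts (h1 ▸ h.1.1)
    unfold phi
    dsimp only
    rw [h3, h1, go_append]
    have e : ((b + 1 : ℕ) : ℤ) - a - 1 = (b : ℤ) - a := by push_cast; ring
    rw [e] at hv
    have hab : a ≤ b := by
      by_contra hab
      have : w.count ((b : ℤ) - a) = 0 := List.count_eq_zero.2 fun hm => by
        have := (path_inv w h.1.1).1 _ hm; omega
      omega
    have h4 := hv.2.2 (by push_cast; omega)
    have h5 : a < u.count ((b : ℤ) - a) := by omega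
    rw [if_pos h5]
    exact go_le h5
  · intro a b hc hc'
    rw [WB_cell h] at hc hc'
    obtain ⟨u, v, h1, h2, h3⟩ := go_dec _ _ w hc'
    have hv := valid_counts (h1 ▸ h.1.1)
    unfold phi
    dsimp only
    rw [h3, h1, go_append]
    have e : (b : ℤ) - (a + 1 : ℕ) + 1 = (b : ℤ) - a := by push_cast; ring
    rw [e] at hv
    have h5 : a < u.count ((b : ℤ) - a) := by omega
    rw [if_pos h5]
    exact go_le h5

theorem phi_inj {n : ℕ} {w w' : List ℤ} (h : WB n w) (h' : WB n w') (e : phi w = phi w') : w = w' := by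
  refine List.ext_getElem (by rw [h.2, h'.2]) fun i hi hi' => ?_
  have hw : w = w.take i ++ w[i] :: w.drop (i + 1) := by
    rw [List.getElem_cons_drop, List.take_append_drop]
  have hx0 : 0 ≤ w[i] := (path_inv w h.1.1).1 _ (List.getElem_mem _)
  generalize hx : w[i] = x at hw hx0
  have hz : (((w.take i).count x + x.toNat : ℕ) : ℤ) - ((w.take i).count x : ℕ) = x := by push_cast; omega
  have h1 : phi w ((w.take i).count x, (w.take i).count x + x.toNat) = i + 1 := by
    unfold phi
    dsimp only
    rw [hz]
    have := go_self 1 x (w.take i) (w.drop (i + 1))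
    rw [← hw] at this
    rw [this, List.length_take]; omega
  rw [e] at h1
  unfold phi at h1
  dsimp only at h1
  rw [hz] at h1
  obtain ⟨u, v, k1, k2, k3⟩ := go_dec _ _ w' ((go_pos (i := 1) le_rfl).1 (by rw [h1]; omega))
  rw [k3] at h1
  have hui : u.length = i := by omega
  subst hui
  simp [k1]

theorem phi_surj {n : ℕ} {f : ℕ × ℕ → ℕ} (hf : IsStdFilling (shiftCell (dblStair n)) (n ^ 2) f) :
    ∃ w, WB n w ∧ phi w = f := by
  obtain ⟨f1, f2, f3, f4, f5, f6⟩ := hf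
  have key : ∀ i ≤ n ^ 2, ∃ w : List ℤ, w.length = i ∧ WValid true {0} w ∧
      ∀ c, phi w c = if f c ≤ i then f c else 0 := by
    intro i
    induction i with
    | zero =>
      intro _
      refine ⟨[], rfl, trivial, fun c => ?_⟩
      unfold phi go
      split_ifs with h <;> omega
    | succ i ih =>
      intro hi
      obtain ⟨w, hwl, hwv, hw⟩ := ih (by omega)
      obtain ⟨⟨a, b⟩, hc, hfc⟩ := f4 (i + 1) (by omega) hi
      have hsh := (shiftCell_dbl n a b).1 hc
      -- counts versus the filling
      have hcnt : ∀ a' b' : ℕ, a' < w.count ((b' : ℤ) - a') ↔ (f (a', b') ≠ 0 ∧ f (a', b') ≤ i) := by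
        intro a' b'
        rw [← go_pos (i := 1) le_rfl]
        have := hw (a', b')
        unfold phi at this
        dsimp only at this
        rw [this]
        split_ifs with h
        · simp [h]
        · simp [h]
      have hless : ∀ a' b' : ℕ, shiftCell (dblStair n) (a', b') → f (a', b') < i + 1 → a' < w.count ((b' : ℤ) - a') := by
        intro a' b' h1 h2
        rw [hcnt]
        have := f2 _ h1
        omega
      set x : ℤ := (b : ℤ) - a with hx
      have hx0 : 0 ≤ x := by omega
      obtain ⟨i1, i2, i3⟩ := path_inv w hwv
      have hge : ¬ a < w.count x := by
        rw [hcnt]; omega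
      have hup : a ≤ w.count (x + 1) := by
        by_cases ha : a = 0
        · omega
        · have hs : shiftCell (dblStair n) (a - 1, b) := by rw [shiftCell_dbl]; omega
          have h1 := f6 (a - 1) b hs (by rw [show a - 1 + 1 = a by omega]; exact hc)
          rw [show a - 1 + 1 = a by omega, hfc] at h1
          have := hless _ _ hs h1
          rw [show (b : ℤ) - (a - 1 : ℕ) = x + 1 by omega] at this
          omega
      have hcx := i2 x hx0
      have hcx1 : w.count x = a := by omega
      have hcx2 : w.count (x + 1) = a := by omega
      have hleft : 1 ≤ x → w.count (x - 1) = a + 1 := by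
        intro hx1
        have hs : shiftCell (dblStair n) (a, b - 1) := by rw [shiftCell_dbl]; omega
        have h1 := f5 a (b - 1) hs (by rw [show b - 1 + 1 = b by omega]; exact hc)
        rw [show b - 1 + 1 = b by omega, hfc] at h1
        have := hless _ _ hs h1
        rw [show ((b - 1 : ℕ) : ℤ) - a = x - 1 by omega] at this
        have h2 := i2 (x - 1) (by omega)
        rw [show x - 1 + 1 = x by ring] at h2
        omega
      refine ⟨w ++ [x], by simp [hwl], ?_, ?_⟩
      · rw [WValid_append]
        refine ⟨hwv, ⟨?_, ?_⟩, trivial⟩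
        · rw [i3]
          by_cases h : x = 0
          · exact Or.inl h
          · exact Or.inr ⟨by omega, by rw [hleft (by omega), hcx1]⟩
        · rw [i3]
          rintro (h | ⟨_, h⟩)
          · omega
          · rw [show x + 1 - 1 = x by ring] at h
            omega
      · rintro ⟨a', b'⟩
        unfold phi
        dsimp only
        rw [go_snoc]
        have hw' := hw (a', b')
        unfold phi at hw'
        dsimp only at hw'
        by_cases h1 : a' < w.count ((b' : ℤ) - a')
        · rw [if_pos h1, hw']
          rw [hcnt] at h1
          rw [if_pos h1.2, if_pos (by omega)]
        · rw [if_neg h1]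
          rw [hcnt] at h1
          by_cases h2 : x = (b' : ℤ) - a' ∧ a' = w.count ((b' : ℤ) - a')
          · rw [if_pos h2]
            have ha : a' = a := by rw [h2.2, ← h2.1, hcx1]
            have hb : b' = b := by omega
            subst ha hb
            rw [hfc, if_pos le_rfl, hwl]
          · rw [if_neg h2]
            by_cases h3 : f (a', b') = i + 1
            · exfalso
              have hc' : shiftCell (dblStair n) (a', b') := by
                by_contra h4
                have := f1 _ h4
                omega
              have := f3 _ _ hc hc' (by rw [hfc, h3])
              rw [Prod.mk.injEq] at this
              obtain ⟨rfl, rfl⟩ := this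
              exact h2 ⟨rfl, hcx1.symm⟩
            · split_ifs with h4
              · omega
              · rfl
  obtain ⟨w, hwl, hwv, hw⟩ := key (n ^ 2) le_rfl
  have hphi : phi w = f := by
    funext c
    rw [hw c]
    by_cases hc : shiftCell (dblStair n) c
    · rw [if_pos (f2 c hc).2]
    · simp [f1 c hc]
  refine ⟨w, ⟨⟨hwv, ?_⟩, by rw [hwl, sq]⟩, hphi⟩
  obtain ⟨i1, i2, i3⟩ := path_inv w hwv
  have hcnt : ∀ z : ℕ, w.count (z : ℤ) = (2 * n - z) / 2 := by
    intro z
    have h1 : ∀ a : ℕ, a < w.count (z : ℤ) ↔ a < (2 * n - z) / 2 := by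
      intro a
      have h2 := shiftCell_dbl n a (a + z)
      rw [show a + z - a = z by omega] at h2
      have h3 : a < (2 * n - z) / 2 ↔ shiftCell (dblStair n) (a, a + z) := by rw [h2]; omega
      rw [h3, ← go_pos (i := 1) le_rfl]
      have h4 : go 1 a (z : ℤ) w = f (a, a + z) := by
        rw [← hphi]
        unfold phi
        dsimp only
        rw [show ((a + z : ℕ) : ℤ) - a = z by push_cast; ring]
      rw [h4]
      constructor
      · intro h; by_contra hc; exact h (f1 _ hc)
      · intro h; have := f2 _ h; omega
    have h5 := h1 (w.count (z : ℤ))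
    have h6 := h1 ((2 * n - z) / 2)
    omega
  rw [i3]
  ext y
  simp only [stB, Set.mem_ofPred_eq]
  by_cases hy : 1 ≤ y
  · obtain ⟨m, rfl⟩ : ∃ m : ℕ, y = (m : ℤ) + 1 := ⟨(y - 1).toNat, by omega⟩
    have h1 := hcnt m
    have h2 := hcnt (m + 1)
    push_cast at h2
    rw [show (m : ℤ) + 1 - 1 = m by ring, h1, h2]
    omega
  · omega

section qpart
open Finset Polynomial

lemma tri_prod {M : Type*} [CommMonoid M] (F : ℕ → M) (m : ℕ) :
    ∏ i ∈ range m, ∏ j ∈ range i, F j = ∏ j ∈ range m, F j ^ (m - 1 - j) := by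
  induction m with
  | zero => simp
  | succ m ih =>
    rw [prod_range_succ, ih, prod_range_succ, show m + 1 - 1 - m = 0 by omega, pow_zero, mul_one, ← prod_mul_distrib]
    refine prod_congr rfl fun j hj => ?_
    rw [mem_range] at hj
    rw [← pow_succ]
    congr 1; omega

lemma sq_prod {M : Type*} [CommMonoid M] (F : ℕ → M) (n : ℕ) :
    ∏ i ∈ range n, ∏ j ∈ range n, F (i + j + 1) =
      F n ^ n * ∏ i ∈ Icc 1 (n - 1), (F i * F (2 * n - i)) ^ i := by
  rcases n with _ | N
  · simp
  have h1 : ∀ i ∈ range (N + 1), ∏ j ∈ range (N + 1), F (i + j + 1) =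
      (∏ j ∈ range (N + 1 - i), F (i + j + 1)) * ∏ j ∈ range i, F (N + 1 + j + 1) := by
    intro i hi
    rw [mem_range] at hi
    conv_lhs => rw [show N + 1 = (N + 1 - i) + i by omega, prod_range_add]
    congr 1
    refine prod_congr rfl fun j _ => ?_
    congr 1; omega
  rw [prod_congr rfl h1, prod_mul_distrib, ← prod_range_diag_flip (N + 1) (fun i j => F (i + j + 1)),
    tri_prod (fun j => F (N + 1 + j + 1))]
  have h2 : ∏ m ∈ range (N + 1), ∏ k ∈ range (m + 1), F (k + (m - k) + 1) = ∏ m ∈ range (N + 1), F (m + 1) ^ (m + 1) := by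
    refine prod_congr rfl fun m _ => ?_
    rw [prod_congr rfl (g := fun _ => F (m + 1))]
    · simp
    · intro k hk
      rw [mem_range] at hk
      congr 1; omega
  have h3 : ∏ j ∈ range (N + 1), F (N + 1 + j + 1) ^ (N + 1 - 1 - j) = ∏ j ∈ range (N + 1), F (2 * (N + 1) - j) ^ j := by
    rw [← prod_range_reflect]
    refine prod_congr rfl fun j hj => ?_
    rw [mem_range] at hj
    congr 2 <;> omega
  rw [h2, h3, prod_range_succ, prod_range_succ' (fun j => F (2 * (N + 1) - j) ^ j), pow_zero, mul_one]
  have h4 : Icc 1 (N + 1 - 1) = (range N).image (fun i => i + 1) := by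
    ext x
    simp only [mem_Icc, mem_image, mem_range]
    constructor
    · intro h; exact ⟨x - 1, by omega, by omega⟩
    · rintro ⟨a, h, rfl⟩; omega
  rw [h4, prod_image (by intro a _ b _ h; simpa using h)]
  simp only [mul_pow]
  rw [prod_mul_distrib]
  rw [mul_comm (∏ x ∈ range N, F (x + 1) ^ (x + 1)), mul_assoc]

/-- number of boxes with hook divisible by `e` -/
def hcount (n e : ℕ) : ℕ := ∑ i ∈ range n, ∑ j ∈ range n, if e ∣ i + j + 1 then 1 else 0

lemma row_count {e : ℕ} (he : 0 < e) (i n : ℕ) :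
    (∑ j ∈ range n, if e ∣ i + j + 1 then 1 else 0) + i / e = (i + n) / e := by
  induction n with
  | zero => simp
  | succ n ih =>
    rw [sum_range_succ, ← add_assoc i n 1, Nat.succ_div, ← ih]
    omega

lemma sum_mod {e : ℕ} (he : 0 < e) (b : ℕ) (hb : b < e) (a : ℕ) :
    (∑ i ∈ range (a * e + b), if e ≤ i % e + b then 1 else 0) = a * b + (b - (e - b)) := by
  induction a with
  | zero =>
    rw [zero_mul, zero_add, zero_mul, zero_add, sum_boole]
    have : (range b).filter (fun i => e ≤ i % e + b) = Ico (e - b) b := by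
      ext i
      rw [mem_filter, mem_range, mem_Ico]
      constructor
      · rintro ⟨h1, h2⟩
        rw [Nat.mod_eq_of_lt (by omega)] at h2
        omega
      · rintro ⟨h1, h2⟩
        rw [Nat.mod_eq_of_lt (by omega)]
        omega
    rw [this]; simp
  | succ a ih =>
    rw [show (a + 1) * e + b = e + (a * e + b) by ring, sum_range_add]
    have h1 : ∀ i ∈ range (a * e + b), (if e ≤ (e + i) % e + b then 1 else 0) = if e ≤ i % e + b then 1 else 0 := by
      intro i _; rw [Nat.add_mod_left]
    rw [sum_congr rfl h1, ih, sum_boole]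
    have : (range e).filter (fun i => e ≤ i % e + b) = Ico (e - b) e := by
      ext i
      rw [mem_filter, mem_range, mem_Ico]
      constructor
      · rintro ⟨h1, h2⟩
        rw [Nat.mod_eq_of_lt (by omega)] at h2
        omega
      · rintro ⟨h1, h2⟩
        rw [Nat.mod_eq_of_lt (by omega)]
        omega
    rw [this]
    simp only [Nat.card_Ico, Nat.cast_id]
    rw [show e - (e - b) = b by omega]; ring

lemma hcount_eq {e : ℕ} (he : 0 < e) (a b : ℕ) (hb : b < e) :
    hcount (a * e + b) e = a * (a * e + b) + (a * b + (b - (e - b))) := by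
  unfold hcount
  have h : ∀ i ∈ range (a * e + b), (∑ j ∈ range (a * e + b), if e ∣ i + j + 1 then 1 else 0) =
      a + if e ≤ i % e + b then 1 else 0 := by
    intro i _
    have h1 := row_count he i (a * e + b)
    have h2 : (i + (a * e + b)) / e = i / e + a + if e ≤ i % e + b then 1 else 0 := by
      rw [Nat.add_div he, Nat.mul_comm a e, Nat.mul_add_div he, Nat.mul_add_mod, Nat.div_eq_of_lt hb,
        Nat.mod_eq_of_lt hb, add_zero]
    omega
  rw [sum_congr rfl h, sum_add_distrib, sum_mod he b hb]
  simp [mul_comm]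

lemma hcount_le {e : ℕ} (he : 0 < e) (n : ℕ) : e * hcount n e ≤ n * n ∧ (¬ e ∣ n → e * hcount n e < n * n) := by
  have hb := Nat.mod_lt n he
  have hn : n = n / e * e + n % e := by rw [Nat.mul_comm]; exact (Nat.div_add_mod n e).symm
  have hd : ¬ e ∣ n → 0 < n % e := fun h => Nat.pos_of_ne_zero fun h' => h (Nat.dvd_of_mod_eq_zero h')
  generalize n / e = a at *
  generalize n % e = b at *
  have h := hcount_eq he a b hb
  rw [← hn] at h
  rw [h]
  rcases le_or_gt b (e - b) with h1 | h1
  · rw [show b - (e - b) = 0 by omega]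
    refine ⟨?_, fun h2 => ?_⟩
    · rw [hn]; nlinarith
    · have := hd h2
      rw [hn]; nlinarith
  · obtain ⟨c, hc⟩ : ∃ c, e = b + c := ⟨e - b, by omega⟩
    have hcp : 0 < c := by omega
    obtain ⟨d, hd'⟩ : ∃ d, b = c + d := ⟨b - c, by omega⟩
    rw [show b - (e - b) = d by omega]
    subst hd'
    subst hc
    have : (c + d + c) * d < (c + d) * (c + d) := by nlinarith
    refine ⟨?_, fun _ => ?_⟩
    · rw [hn]; nlinarith
    · rw [hn]; nlinarith

lemma qInt_cyc {m E : ℕ} (hm : 0 < m) (hE : m ≤ E) :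
    qInt m = ∏ e ∈ Icc 2 E, cyclotomic e ℤ ^ (if e ∣ m then 1 else 0) := by
  rw [qInt, ← prod_cyclotomic_eq_geom_sum hm]
  have : (Icc 2 E).filter (fun e => e ∣ m) = m.divisors.erase 1 := by
    ext e
    simp only [mem_filter, mem_Icc, mem_erase, Nat.mem_divisors]
    constructor
    · rintro ⟨h1, h2⟩; exact ⟨by omega, h2, by omega⟩
    · rintro ⟨h1, h2, h3⟩
      have := Nat.le_of_dvd hm h2
      have := Nat.pos_of_dvd_of_pos h2 hm
      exact ⟨by omega, h2⟩
  rw [← this, prod_filter]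
  refine prod_congr rfl fun e _ => ?_
  split_ifs <;> simp

lemma qFact_cyc {N E : ℕ} (hE : N ≤ E) : qFact N = ∏ e ∈ Icc 2 E, cyclotomic e ℤ ^ (N / e) := by
  rw [qFact]
  have h : ∀ m ∈ range N, qInt (m + 1) = ∏ e ∈ Icc 2 E, cyclotomic e ℤ ^ (if e ∣ m + 1 then 1 else 0) := by
    intro m hm
    rw [mem_range] at hm
    exact qInt_cyc (by omega) (by omega)
  rw [prod_congr rfl h, prod_comm]
  refine prod_congr rfl fun e he => ?_
  rw [mem_Icc] at he
  rw [prod_pow_eq_pow_sum]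
  congr 1
  have := row_count (e := e) (by omega) 0 N
  simpa using this

lemma den_cyc {n E : ℕ} (hE : 2 * n ≤ E) : ∏ i ∈ range n, ∏ j ∈ range n, qInt (i + j + 1) =
    ∏ e ∈ Icc 2 E, cyclotomic e ℤ ^ (hcount n e) := by
  have h : ∀ i ∈ range n, ∏ j ∈ range n, qInt (i + j + 1) = ∏ e ∈ Icc 2 E, cyclotomic e ℤ ^ (∑ j ∈ range n, if e ∣ i + j + 1 then 1 else 0) := by
    intro i hi
    rw [mem_range] at hi
    have h : ∀ j ∈ range n, qInt (i + j + 1) = ∏ e ∈ Icc 2 E, cyclotomic e ℤ ^ (if e ∣ i + j + 1 then 1 else 0) := by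
      intro j hj
      rw [mem_range] at hj
      exact qInt_cyc (by omega) (by omega)
    rw [prod_congr rfl h, prod_comm]
    exact prod_congr rfl fun e _ => prod_pow_eq_pow_sum _ _ _
  rw [prod_congr rfl h, prod_comm]
  exact prod_congr rfl fun e _ => prod_pow_eq_pow_sum _ _ _

lemma den_monic (n : ℕ) : (∏ i ∈ range n, ∏ j ∈ range n, qInt (i + j + 1)).Monic := by
  rw [den_cyc (E := 2 * n) le_rfl]
  exact monic_prod_of_monic _ _ fun e _ => (cyclotomic.monic e ℤ).pow _

theorem qHook_cyc {n E : ℕ} (h1 : 2 * n ≤ E) (h2 : n * n ≤ E) :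
    qHookSquare n = ∏ e ∈ Icc 2 E, cyclotomic e ℤ ^ (n * n / e - hcount n e) := by
  rw [qHookSquare, ← sq_prod qInt n]
  have : qFact (n ^ 2) = (∏ i ∈ range n, ∏ j ∈ range n, qInt (i + j + 1)) *
      ∏ e ∈ Icc 2 E, cyclotomic e ℤ ^ (n * n / e - hcount n e) := by
    rw [sq, qFact_cyc h2, den_cyc h1, ← prod_mul_distrib]
    refine prod_congr rfl fun e he => ?_
    rw [mem_Icc] at he
    rw [← pow_add]
    congr 1
    have : hcount n e ≤ n * n / e := by
      rw [Nat.le_div_iff_mul_le (by omega), mul_comm]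
      exact (hcount_le (by omega) n).1
    omega
  rw [this, mul_divByMonic_cancel_left _ (den_monic n)]

theorem qHook_mul (n : ℕ) : qHookSquare n * ∏ i ∈ range n, ∏ j ∈ range n, qInt (i + j + 1) = qFact (n * n) := by
  have h1 : 2 * n ≤ 2 * n + n * n := by omega
  have h2 : n * n ≤ 2 * n + n * n := by omega
  rw [qHook_cyc h1 h2, qFact_cyc h2, den_cyc h1, ← prod_mul_distrib]
  refine prod_congr rfl fun e he => ?_
  rw [mem_Icc] at he
  rw [← pow_add]
  congr 1
  have : hcount n e ≤ n * n / e := by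
    rw [Nat.le_div_iff_mul_le (by omega), mul_comm]
    exact (hcount_le (by omega) n).1
  omega

theorem qHook_zero {n k : ℕ} {ξ : ℂ} (hξ : IsPrimitiveRoot ξ k) (hk : k ∣ n * n) (hkn : ¬ k ∣ n) :
    aeval ξ (qHookSquare n) = 0 := by
  have hn : n ≠ 0 := by rintro rfl; simp at hkn
  have hk0 : 0 < k := Nat.pos_of_dvd_of_pos hk (by positivity)
  have hk1 : k ≠ 1 := by rintro rfl; simp at hkn
  have hkE : k ≤ 2 * n + n * n := le_trans (Nat.le_of_dvd (by positivity) hk) (by omega)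
  rw [qHook_cyc (E := 2 * n + n * n) (by omega) (by omega), map_prod]
  refine prod_eq_zero (i := k) (by rw [mem_Icc]; omega) ?_
  have h0 : aeval ξ (cyclotomic k ℤ) = 0 := by
    have := hξ.isRoot_cyclotomic hk0
    rw [aeval_def, eval₂_eq_eval_map, map_cyclotomic]
    exact this
  rw [map_pow, h0]
  refine zero_pow ?_
  have h3 := (hcount_le hk0 n).2 hkn
  have h4 : n * n / k * k = n * n := Nat.div_mul_cancel hk
  have : hcount n k < n * n / k := by
    rw [← h4, mul_comm] at h3
    exact lt_of_mul_lt_mul_right h3 (Nat.zero_le k)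
  omega
end qpart

section qpart2
open Finset Polynomial

lemma prod_blocks {M : Type*} [CommMonoid M] (F : ℕ → M) (m k : ℕ) :
    ∏ j ∈ range (m * k), F j = ∏ t ∈ range m, ∏ j ∈ range k, F (t * k + j) := by
  induction m with
  | zero => simp
  | succ m ih => rw [prod_range_succ, ← ih, Nat.succ_mul, prod_range_add]

/-- sliding a window -/
lemma window {R : Type*} [CommMonoid R] (F : ℕ → R) (k s : ℕ) :
    (∏ j ∈ range k, F (s + 1 + j + 1)) * F (s + 1) = (∏ j ∈ range k, F (s + j + 1)) * F (s + k + 1) := by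
  have h1 := prod_range_succ (fun j => F (s + j + 1)) k
  have h2 := prod_range_succ' (fun j => F (s + j + 1)) k
  rw [h1] at h2
  rw [h2]
  congr 1
  refine prod_congr rfl fun j _ => ?_
  congr 1; omega

lemma qInt_X_sub (m : ℕ) : qInt m * (X - 1) = X ^ m - 1 := by
  rw [qInt]; exact geom_sum_mul _ _

lemma X_sub_ne : (X - 1 : ℤ[X]) ≠ 0 := by
  have := X_sub_C_ne_zero (1 : ℤ)
  simpa using this

lemma qInt_ne {m : ℕ} (hm : 0 < m) : qInt m ≠ 0 := by
  intro h
  have h1 := congrArg (eval 1) h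
  simp [qInt, eval_finsetSum] at h1
  omega

lemma qInt_mul (k l : ℕ) : qInt (k * l) = qInt k * expand ℤ k (qInt l) := by
  refine mul_right_cancel₀ X_sub_ne ?_
  rw [qInt_X_sub, mul_right_comm, qInt_X_sub]
  have h : (X ^ k - 1 : ℤ[X]) = expand ℤ k (X - 1) := by simp
  rw [h, ← map_mul, mul_comm (X - 1), qInt_X_sub]
  simp [pow_mul]

/-- regular part -/
noncomputable def Qp (k j : ℕ) : ℤ[X] := if k ∣ j then expand ℤ k (qInt (j / k)) else qInt j
/-- singular part -/
noncomputable def Ap (k j : ℕ) : ℤ[X] := if k ∣ j then qInt k else 1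

lemma qInt_split (k j : ℕ) : qInt j = Ap k j * Qp k j := by
  unfold Ap Qp
  split_ifs with h
  · rw [← qInt_mul, Nat.mul_div_cancel' h]
  · rw [one_mul]

lemma Ap_ne {k : ℕ} (hk : 0 < k) (j : ℕ) : Ap k j ≠ 0 := by
  unfold Ap
  split_ifs
  · exact qInt_ne hk
  · exact one_ne_zero

lemma Ap_block {k : ℕ} (hk : 0 < k) (s : ℕ) : ∏ j ∈ range k, Ap k (s + j + 1) = qInt k := by
  induction s with
  | zero =>
    rw [prod_eq_single (k - 1)]
    · rw [Ap, if_pos]; rw [show 0 + (k - 1) + 1 = k by omega]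
    · intro j hj hj'
      rw [mem_range] at hj
      rw [Ap, if_neg]
      intro h
      have := Nat.le_of_dvd (by omega) h
      omega
    · intro h; rw [mem_range] at h; omega
  | succ s ih =>
    have h := window (Ap k) k s
    have e : Ap k (s + k + 1) = Ap k (s + 1) := by
      unfold Ap
      rw [show s + k + 1 = s + 1 + k by ring]
      simp
    rw [e] at h
    rw [mul_right_cancel₀ (Ap_ne hk _) h, ih]

lemma Ap_blocks {k : ℕ} (hk : 0 < k) (s m : ℕ) : ∏ j ∈ range (m * k), Ap k (s + j + 1) = qInt k ^ m := by
  rw [prod_blocks, prod_congr rfl (g := fun _ => qInt k)]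
  · simp
  · intro t _
    rw [← Ap_block hk (s + t * k)]
    refine prod_congr rfl fun j _ => ?_
    congr 1; ring

variable {k : ℕ} {ξ : ℂ}

lemma Qp_dvd (hξ : IsPrimitiveRoot ξ k) (hk : 0 < k) (l : ℕ) : aeval ξ (Qp k (k * l)) = l := by
  rw [Qp, if_pos (Dvd.intro _ rfl), Nat.mul_div_cancel_left _ hk, expand_aeval, hξ.pow_eq_one]
  simp [qInt]

lemma Qp_ndvd (hξ : IsPrimitiveRoot ξ k) {j : ℕ} (h : ¬ k ∣ j) :
    aeval ξ (Qp k j) ≠ 0 ∧ aeval ξ (Qp k (j + k)) = aeval ξ (Qp k j) := by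
  have h' : ¬ k ∣ j + k := by simpa using h
  have hk1 : ξ ≠ 1 := by
    rintro rfl
    exact h (dvd_trans (hξ.dvd_of_pow_eq_one 1 (by simp)) (one_dvd j))
  have e : ∀ i, aeval ξ (qInt i) = (ξ ^ i - 1) / (ξ - 1) := by
    intro i
    rw [qInt, map_sum, ← geom_sum_eq hk1]
    simp
  rw [Qp, Qp, if_neg h, if_neg h', e, e, pow_add, hξ.pow_eq_one, mul_one]
  refine ⟨?_, rfl⟩
  refine div_ne_zero (sub_ne_zero.2 fun hc => h ?_) (sub_ne_zero.2 hk1)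
  exact (hξ.pow_eq_one_iff_dvd j).1 hc

lemma Qp_block (hξ : IsPrimitiveRoot ξ k) (hk : 0 < k) (s : ℕ) :
    ∏ j ∈ range k, aeval ξ (Qp k (s + j + 1)) =
      (∏ j ∈ range k, aeval ξ (Qp k (j + 1))) * ((s / k + 1 : ℕ) : ℂ) := by
  induction s with
  | zero => simp
  | succ s ih =>
    have h := window (fun j => aeval ξ (Qp k j)) k s
    rw [ih] at h
    by_cases hd : k ∣ s + 1
    · obtain ⟨l, hl⟩ := hd
      have hl0 : l ≠ 0 := by rintro rfl; omega
      have e1 : s + k + 1 = k * (l + 1) := by rw [mul_add, ← hl]; ring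
      have e2 : s / k + 1 = l := by
        have h3 : (s + 1) / k = l := by rw [hl, Nat.mul_div_cancel_left _ hk]
        rw [Nat.succ_div, if_pos ⟨l, hl⟩] at h3
        exact h3
      have e3 : (s + 1) / k + 1 = l + 1 := by rw [hl, Nat.mul_div_cancel_left _ hk]
      rw [e1, hl, Qp_dvd hξ hk, Qp_dvd hξ hk, e2, ← hl] at h
      rw [e3]
      refine mul_right_cancel₀ (Nat.cast_ne_zero.2 hl0) (h.trans ?_)
      ring
    · have e2 : (s + 1) / k = s / k := by rw [Nat.succ_div, if_neg hd, add_zero]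
      have := Qp_ndvd hξ hd
      rw [show s + k + 1 = s + 1 + k by ring, this.2] at h
      rw [e2]
      exact mul_right_cancel₀ this.1 h

lemma Qp_blocks (hξ : IsPrimitiveRoot ξ k) (hk : 0 < k) (s m : ℕ) :
    ∏ j ∈ range (m * k), aeval ξ (Qp k (s + j + 1)) =
      (∏ j ∈ range k, aeval ξ (Qp k (j + 1))) ^ m * ∏ t ∈ range m, ((s / k + t + 1 : ℕ) : ℂ) := by
  rw [prod_blocks]
  have : ∀ t ∈ range m, ∏ j ∈ range k, aeval ξ (Qp k (s + (t * k + j) + 1)) =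
      (∏ j ∈ range k, aeval ξ (Qp k (j + 1))) * ((s / k + t + 1 : ℕ) : ℂ) := by
    intro t _
    have h := Qp_block hξ hk (s + t * k)
    rw [Nat.add_mul_div_right _ _ hk] at h
    rw [← h]
    refine prod_congr rfl fun j _ => ?_
    rw [← add_assoc s]
  rw [prod_congr rfl this, prod_mul_distrib, prod_const, card_range]

lemma Qp_P_ne (hξ : IsPrimitiveRoot ξ k) (hk : 0 < k) : ∏ j ∈ range k, aeval ξ (Qp k (j + 1)) ≠ 0 := by
  refine prod_ne_zero_iff.2 fun j _ => ?_
  by_cases h : k ∣ j + 1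
  · obtain ⟨l, hl⟩ := h
    rw [hl, Qp_dvd hξ hk]
    refine Nat.cast_ne_zero.2 ?_
    rintro rfl
    omega
  · exact (Qp_ndvd hξ h).1

theorem qHook_val (hξ : IsPrimitiveRoot ξ k) (hk : 0 < k) (m : ℕ) :
    aeval ξ (qHookSquare (m * k)) * (HH m : ℂ) ^ k = ((m * m * k).factorial : ℂ) := by
  have h := qHook_mul (m * k)
  have e1 : ∏ i ∈ range (m * k), ∏ j ∈ range (m * k), qInt (i + j + 1) =
      qInt k ^ (m * m * k) * ∏ i ∈ range (m * k), ∏ j ∈ range (m * k), Qp k (i + j + 1) := by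
    have : ∀ i ∈ range (m * k), ∏ j ∈ range (m * k), qInt (i + j + 1) = qInt k ^ m * ∏ j ∈ range (m * k), Qp k (i + j + 1) := by
      intro i _
      rw [prod_congr rfl (fun j _ => qInt_split k (i + j + 1)), prod_mul_distrib, Ap_blocks hk]
    rw [prod_congr rfl this, prod_mul_distrib, prod_const, card_range, ← pow_mul, mul_assoc]
  have e2 : qFact (m * k * (m * k)) = qInt k ^ (m * m * k) * ∏ j ∈ range (m * m * k * k), Qp k (0 + j + 1) := by
    rw [qFact, show m * k * (m * k) = m * m * k * k by ring, ← Ap_blocks hk 0, ← prod_mul_distrib]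
    refine prod_congr rfl fun j _ => ?_
    rw [← qInt_split, zero_add]
  rw [e1, e2, mul_left_comm] at h
  have h2 := mul_left_cancel₀ (pow_ne_zero _ (qInt_ne hk)) h
  have h3 := congrArg (aeval ξ) h2
  rw [map_mul, map_prod, map_prod, Qp_blocks hξ hk] at h3
  have e3 : ∀ i ∈ range (m * k), aeval ξ (∏ j ∈ range (m * k), Qp k (i + j + 1)) =
      (∏ j ∈ range k, aeval ξ (Qp k (j + 1))) ^ m * ∏ t ∈ range m, ((i / k + t + 1 : ℕ) : ℂ) := by
    intro i _
    rw [map_prod, Qp_blocks hξ hk]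
  rw [prod_congr rfl e3, prod_mul_distrib, prod_const, card_range, ← pow_mul, prod_blocks] at h3
  have e4 : ∏ t ∈ range m, ∏ j ∈ range k, ∏ l ∈ range m, (((t * k + j) / k + l + 1 : ℕ) : ℂ) = (HH m : ℂ) ^ k := by
    rw [HH, Nat.cast_prod, ← prod_pow]
    refine prod_congr rfl fun t _ => ?_
    rw [prod_congr rfl (g := fun _ => ((∏ j ∈ range m, (t + j + 1) : ℕ) : ℂ))]
    · simp
    · intro j hj
      rw [mem_range] at hj
      rw [Nat.cast_prod, mul_comm t k, Nat.mul_add_div hk, Nat.div_eq_of_lt hj, add_zero]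
  have e5 : ∏ t ∈ range (m * m * k), ((0 / k + t + 1 : ℕ) : ℂ) = ((m * m * k).factorial : ℂ) := by
    rw [← prod_range_add_one_eq_factorial, Nat.cast_prod]
    refine prod_congr rfl fun t _ => ?_
    rw [Nat.zero_div, zero_add]
  rw [e4, e5, show m * (m * k) = m * m * k by ring, mul_left_comm] at h3
  exact mul_left_cancel₀ (pow_ne_zero _ (Qp_P_ne hξ hk)) h3
end qpart2

lemma promote_iter {n : ℕ} {w : List ℤ} (h : WB n w) (d : ℕ) :
    (promote (n ^ 2))^[d] (phi w) = phi (wprom^[d] w) ∧ WB n (wprom^[d] w) := by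
  induction d with
  | zero => exact ⟨rfl, h⟩
  | succ d ih =>
    rw [Function.iterate_succ_apply', Function.iterate_succ_apply', ih.1]
    exact ⟨promote_phi (by rw [ih.2.2, sq]) ih.2.1.1, wprom_WB ih.2⟩

lemma Psi_iter {n : ℕ} (hn : n ≠ 0) {w : List ℤ} (h : WB n w) (d : ℕ) :
    wprom^[d] (Psi n w) = Psi n (wprom^[d] w) := by
  induction d with
  | zero => rfl
  | succ d ih =>
    rw [Function.iterate_succ_apply', Function.iterate_succ_apply', ih]
    exact (Psi_wprom (Psi_surj hn) (promote_iter h d).2).symm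

theorem fix_bridge {n : ℕ} (hn : n ≠ 0) (d : ℕ) :
    ({f | IsStdFilling (shiftCell (dblStair n)) (n ^ 2) f ∧ (promote (n ^ 2))^[d] f = f}).ncard =
      {T | WA n T ∧ wprom^[d] T = T}.ncard := by
  have h1 : {f | IsStdFilling (shiftCell (dblStair n)) (n ^ 2) f ∧ (promote (n ^ 2))^[d] f = f} =
      phi '' {Q | WB n Q ∧ wprom^[d] Q = Q} := by
    ext f
    simp only [Set.mem_image, Set.mem_ofPred_eq]
    constructor
    · rintro ⟨hf, hp⟩
      obtain ⟨w, hw, rfl⟩ := phi_surj hf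
      have := promote_iter hw d
      rw [this.1] at hp
      exact ⟨w, ⟨hw, phi_inj this.2 hw hp⟩, rfl⟩
    · rintro ⟨w, ⟨hw, hp⟩, rfl⟩
      exact ⟨phi_std hw, by rw [(promote_iter hw d).1, hp]⟩
  have h2 : {T | WA n T ∧ wprom^[d] T = T} = Psi n '' {Q | WB n Q ∧ wprom^[d] Q = Q} := by
    ext T
    simp only [Set.mem_image, Set.mem_ofPred_eq]
    constructor
    · rintro ⟨hT, hp⟩
      obtain ⟨w, hw, rfl⟩ := Psi_surj hn T hT
      rw [Psi_iter hn hw] at hp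
      exact ⟨w, ⟨hw, Psi_inj (promote_iter hw d).2 hw hp⟩, rfl⟩
    · rintro ⟨w, ⟨hw, hp⟩, rfl⟩
      exact ⟨Psi_WA hw, by rw [Psi_iter hn hw, hp]⟩
  rw [h1, h2, Set.InjOn.ncard_image, Set.InjOn.ncard_image]
  · intro a ha b hb h; exact Psi_inj ha.1 hb.1 h
  · intro a ha b hb h; exact phi_inj ha.1 hb.1 h

lemma fix_gcd {n : ℕ} (hn : n ≠ 0) (d : ℕ) :
    {T | WA n T ∧ wprom^[d] T = T} = {T | WA n T ∧ wprom^[Nat.gcd d (n * n)] T = T} := by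
  ext T
  simp only [Set.mem_ofPred_eq]
  refine and_congr_right fun hT => ?_
  constructor
  · intro h
    exact Function.IsPeriodicPt.gcd (f := wprom) (x := T) h (WA_period hn hT)
  · intro h
    exact Function.IsPeriodicPt.trans_dvd (f := wprom) (x := T) h (Nat.gcd_dvd_left _ _)

lemma case_zero (d : ℕ) :
    {f | IsStdFilling (shiftCell (dblStair 0)) (0 ^ 2) f ∧ (promote (0 ^ 2))^[d] f = f} = {fun _ => 0} := by
  ext f
  simp only [Set.mem_ofPred_eq, Set.mem_singleton_iff]
  have hc : ∀ c, ¬ shiftCell (dblStair 0) c := by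
    rintro ⟨a, b⟩ h
    rw [shiftCell_dbl] at h
    omega
  constructor
  · rintro ⟨h, _⟩
    funext c
    exact h.1 c (hc c)
  · rintro rfl
    refine ⟨⟨fun _ _ => rfl, fun c h => absurd h (hc c), fun c _ h => absurd h (hc c), fun v h1 h2 => ?_,
      fun a b h => absurd h (hc _), fun a b h => absurd h (hc _)⟩, ?_⟩
    · simp at h2; omega
    · have h0 : promote (0 ^ 2) (fun _ => 0) = fun _ => 0 := by
        funext c
        simp [promote, jdtSlide]
      exact Function.iterate_fixed h0 d

/-- (Petersen–Serrano, Corollary 4.2.)  Let `X = SYT'(2n-1, 2n-3, …, 1)` be the set of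
standard shifted Young tableaux of doubled staircase shape, and let `C = ℤ/n²ℤ` act on `X`
by jeu de taquin promotion.  Then `(X, C, X(q))` exhibits the cyclic sieving phenomenon,
where `X(q) = [n²]_q! / ([n]_q^n ∏_(i=1)^(n-1) ([i]_q [2n-i]_q)^i)` is the `q`-analogue of
the hook length formula for the `n × n` square Young diagram: for every `d ≥ 0`, the number
of such tableaux fixed by `p^d` equals `X(ζ^d)`, `ζ` being a primitive `n²`-th root of
unity. -/
theorem doubled_staircase_promotion_cyclic_sieving
    (n : ℕ) (ζ : ℂ) (hζ : IsPrimitiveRoot ζ (n ^ 2)) (d : ℕ) :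
    (({f | IsStdFilling (shiftCell (dblStair n)) (n ^ 2) f ∧
        (promote (n ^ 2))^[d] f = f}).ncard : ℂ) =
      Polynomial.aeval (ζ ^ d) (qHookSquare n) := by
  rcases eq_or_ne n 0 with rfl | hn
  · rw [case_zero, Set.ncard_singleton, qHook_cyc (E := 0) (by simp) (by simp)]
    simp
  rw [fix_bridge hn, fix_gcd hn]
  have hN : 0 < n * n := by positivity
  rw [sq] at hζ
  set g := Nat.gcd d (n * n) with hg
  have hgp : 0 < g := Nat.gcd_pos_of_pos_right _ hN
  obtain ⟨k, hk⟩ : g ∣ n * n := Nat.gcd_dvd_right _ _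
  have hkp : 0 < k := Nat.pos_of_ne_zero (by rintro rfl; omega)
  have hξ : IsPrimitiveRoot (ζ ^ d) k := by
    have h1 : orderOf ζ = n * n := hζ.eq_orderOf.symm
    have h2 : orderOf (ζ ^ d) = k := by
      have h3 : n * n / g = k := Nat.div_eq_of_eq_mul_right hgp hk
      rcases eq_or_ne d 0 with hd | hd
      · have hgn : g = n * n := by rw [hg, hd, Nat.gcd_zero_left]
        rw [hd, pow_zero, orderOf_one, ← h3, hgn, Nat.div_self hN]
      · rw [orderOf_pow' _ hd, h1, Nat.gcd_comm, ← hg, h3]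
    rw [← h2]
    exact IsPrimitiveRoot.orderOf _
  by_cases hkn : k ∣ n
  · obtain ⟨m, rfl⟩ := hkn
    rw [mul_comm k m] at *
    have hm : 0 < m := Nat.pos_of_ne_zero (by rintro rfl; simp at hn)
    have hgm : g = m * m * k := by
      refine Nat.eq_of_mul_eq_mul_right hkp ?_
      rw [← hk]; ring
    have h1 := fix_dvd hkp hm
    have h2 := qHook_val hξ hkp m
    rw [hgm]
    have h1' : ({T | WA (m * k) T ∧ wprom^[m * m * k] T = T}.ncard : ℂ) * (HH m : ℂ) ^ k = ((m * m * k).factorial : ℂ) := by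
      exact_mod_cast h1
    have hH : (HH m : ℂ) ^ k ≠ 0 := pow_ne_zero _ (Nat.cast_ne_zero.2 (HH_pos m).ne')
    exact mul_right_cancel₀ hH (h1'.trans h2.symm)
  · rw [fix_ndvd hn hkp hk hkn, qHook_zero hξ (Dvd.intro_left _ hk.symm) hkn]
    simp
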